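/- Let Ĝ : ℍ^q → ℍ^k and Ẑ : ℍ^m → ℍ^n be ℝ-linear maps on Hermitian matrices that send positive semidefinite matrices to positive semidefinite matrices and positive definite matrices to positive definite matrices, let S be an n×k complex matrix with S†S = I_k, and let α ∈ [1/2, 1). Define Ψ̂_α(ρ,σ) := Tr[(Ĝ(ρ)^{1/2} S† Ẑ(σ)^{(1−α)/α} S Ĝ(ρ)^{1/2})^α] on positive definite ρ ∈ ℍ^q, σ ∈ ℍ^m. Then the function f(u, ρ, σ) := −log(Ψ̂_α(ρ,σ) − u) − log det(ρ) − log det(σ), defined on the open convex set D := {(u,ρ,σ) ∈ ℝ × ℍ^q × ℍ^m : ρ ≻ 0, σ ≻ 0, u < Ψ̂_α(ρ,σ)}, is a (1+q+m)-self-concordant barrier for the closure of D. -/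

import Mathlib

open Matrix
open scoped ComplexOrder

noncomputable section

/-- The real vector space of `d × d` complex Hermitian (self-adjoint) matrices. -/
abbrev Herm (d : ℕ) := selfAdjoint (Matrix (Fin d) (Fin d) ℂ)

/-- The real power of a matrix, taken via the continuous functional calculus applied to
`x ↦ x ^ p` (real `rpow`). -/
def mpow {n : ℕ} (A : Matrix (Fin n) (Fin n) ℂ) (p : ℝ) : Matrix (Fin n) (Fin n) ℂ :=
  cfc (fun x : ℝ => x ^ p) A

/-- `Ψ_{α,S}(G, Z) := Tr[(G^{1/2} Sᴴ Z^{(1−α)/α} S G^{1/2})^α]` (real-valued). -/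
def PsiS {n k : ℕ} (α : ℝ) (S : Matrix (Fin n) (Fin k) ℂ)
    (G : Matrix (Fin k) (Fin k) ℂ) (Z : Matrix (Fin n) (Fin n) ℂ) : ℝ :=
  ((mpow (mpow G (1 / 2) * Sᴴ * mpow Z ((1 - α) / α) * S * mpow G (1 / 2)) α).trace).re

/-- A `C³` function `f` on an open convex set `D` of a finite-dimensional real vector space
is a `ν`-self-concordant barrier for `cl D` if: (i) `f` is convex on `D`; (ii) `f(x) → +∞`
as `x` approaches any boundary point of `D`; (iii) `|D³f(x)[h,h,h]| ≤ 2 (D²f(x)[h,h])^{3/2}`;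
(iv) `(Df(x)[h])² ≤ ν · D²f(x)[h,h]`, for all `x ∈ D` and all directions `h`, where the
derivatives are taken along the line `t ↦ x + t h`. -/
def IsSelfConcordantBarrier {V : Type*} [AddCommGroup V] [Module ℝ V] [TopologicalSpace V]
    (ν : ℝ) (D : Set V) (f : V → ℝ) : Prop :=
  ConvexOn ℝ D f ∧
  (∀ x ∈ frontier D, Filter.Tendsto f (nhdsWithin x D) Filter.atTop) ∧
  (∀ x ∈ D, ∀ h : V,
    |iteratedDeriv 3 (fun t : ℝ => f (x + t • h)) 0|
      ≤ 2 * (iteratedDeriv 2 (fun t : ℝ => f (x + t • h)) 0) ^ (3 / 2 : ℝ)) ∧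
  (∀ x ∈ D, ∀ h : V,
    (deriv (fun t : ℝ => f (x + t • h)) 0) ^ 2
      ≤ ν * iteratedDeriv 2 (fun t : ℝ => f (x + t • h)) 0)

section FractionalIntegral

open Set MeasureTheory Filter Topology

variable {𝔸 : Type*} [NormedRing 𝔸] [NormedAlgebra ℂ 𝔸]

/-- The unnormalised Balakrishnan integral `∫₀^∞ t^(s-1) X (X + t)⁻¹ dt` for `X ^ s`. -/
def fracInt (s : ℝ) (X : 𝔸) : 𝔸 :=
  ∫ t in Ioi (0 : ℝ), ((t ^ (s - 1) : ℝ) : ℂ) • (X * Ring.inverse (X + algebraMap ℂ 𝔸 (t : ℂ)))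

/-- The spectrum of `X` does not meet the closed negative half-line. -/
def SlitSpec (X : 𝔸) : Prop := ∀ t : ℝ, 0 ≤ t → IsUnit (X + algebraMap ℂ 𝔸 (t : ℂ))

lemma integrableOn_weight {s : ℝ} (hs : s ∈ Ioo (0 : ℝ) 1) :
    IntegrableOn (fun t : ℝ => t ^ (s - 1) * (1 + t)⁻¹) (Ioi 0) := by
  refine (Real.integrableOn_rpowIntegrand₀₁_Ioi hs zero_le_one).congr_fun ?_ measurableSet_Ioi
  intro t ht
  simp only [Real.rpowIntegrand₀₁_eq_pow_div hs (le_of_lt ht) zero_le_one]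
  rw [add_comm t 1]; ring

lemma mul_inverse_add {X : 𝔸} {c : ℂ} (h : IsUnit (X + algebraMap ℂ 𝔸 c)) :
    X * Ring.inverse (X + algebraMap ℂ 𝔸 c) =
      1 - c • Ring.inverse (X + algebraMap ℂ 𝔸 c) := by
  have := Ring.mul_inverse_cancel _ h
  rw [add_mul, ← Algebra.smul_def] at this
  exact eq_sub_of_add_eq this

variable [CompleteSpace 𝔸]

lemma resolvent_bound {E : Type*} [TopologicalSpace E] {X : E → 𝔸} {p₀ : E}
    (hX : ContinuousAt X p₀) (h : SlitSpec (X p₀)) :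
    ∃ C : ℝ, 0 ≤ C ∧ ∀ᶠ p in 𝓝 p₀, ∀ t : ℝ, 0 ≤ t → IsUnit (X p + algebraMap ℂ 𝔸 (t : ℂ)) ∧
      ‖Ring.inverse (X p + algebraMap ℂ 𝔸 (t : ℂ))‖ ≤ C * (1 + t)⁻¹ := by
  set Y : E × ℝ → 𝔸 := fun z => (1 - (z.2 : ℂ)) • X z.1 + algebraMap ℂ 𝔸 (z.2 : ℂ) with hY
  have hYc : ∀ τ : ℝ, ContinuousAt Y (p₀, τ) := by
    intro τ
    have h1 : ContinuousAt (fun z : E × ℝ => X z.1) (p₀, τ) :=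
      ContinuousAt.comp (f := Prod.fst) (g := X) hX continuousAt_fst
    have h2 : ContinuousAt (fun z : E × ℝ => (z.2 : ℂ)) (p₀, τ) := by fun_prop
    exact ((continuousAt_const.sub h2).smul h1).add
      ((continuous_algebraMap ℂ 𝔸).continuousAt.comp h2)
  have hYu : ∀ τ ∈ Icc (0 : ℝ) 1, IsUnit (Y (p₀, τ)) := by
    rintro τ ⟨h0, h1⟩
    rcases eq_or_lt_of_le h1 with rfl | h1
    · simp [hY]
    · have hpos : (0 : ℝ) < 1 - τ := by linarith
      have hne : (1 - (τ : ℂ)) ≠ 0 := by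
        have : ((1 - τ : ℝ) : ℂ) ≠ 0 := by exact_mod_cast hpos.ne'
        simpa using this
      have := h (τ / (1 - τ)) (by positivity)
      have h3 : Y (p₀, τ) = (Units.mk0 _ hne) •
          (X p₀ + algebraMap ℂ 𝔸 ((τ / (1 - τ) : ℝ) : ℂ)) := by
        simp only [hY, Units.smul_mk0, smul_add, Algebra.algebraMap_eq_smul_one, smul_smul]
        congr 2
        push_cast
        field_simp
      rw [h3]
      exact this.smul _
  have hinv : ∀ τ ∈ Icc (0 : ℝ) 1, ContinuousAt (fun z => ‖Ring.inverse (Y z)‖) (p₀, τ) := by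
    intro τ hτ
    obtain ⟨u, hu⟩ := hYu τ hτ
    have : ContinuousAt Ring.inverse (Y (p₀, τ)) := hu ▸ NormedRing.inverse_continuousAt u
    exact (ContinuousAt.comp (f := Y) (g := Ring.inverse) this (hYc τ)).norm
  have hcont : ContinuousOn (fun τ : ℝ => ‖Ring.inverse (Y (p₀, τ))‖) (Icc 0 1) := by
    intro τ hτ
    exact (ContinuousAt.comp (f := fun τ : ℝ => (p₀, τ))
      (g := fun z => ‖Ring.inverse (Y z)‖) (hinv τ hτ) (by fun_prop)).continuousWithinAt
  obtain ⟨C₀, hC₀⟩ := isCompact_Icc.bddAbove_image hcont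
  have hC₀' : ∀ τ ∈ Icc (0 : ℝ) 1, ‖Ring.inverse (Y (p₀, τ))‖ ≤ C₀ := fun τ hτ =>
    hC₀ (mem_image_of_mem _ hτ)
  have hC₀0 : 0 ≤ C₀ := (norm_nonneg _).trans (hC₀' 0 (by simp))
  have hev : ∀ᶠ p in 𝓝 p₀, ∀ τ ∈ Icc (0 : ℝ) 1,
      IsUnit (Y (p, τ)) ∧ ‖Ring.inverse (Y (p, τ))‖ < C₀ + 1 := by
    refine isCompact_Icc.eventually_forall_of_forall_eventually
      (P := fun p τ => IsUnit (Y (p, τ)) ∧ ‖Ring.inverse (Y (p, τ))‖ < C₀ + 1) ?_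
    intro τ hτ
    refine ((hYc τ).eventually (Units.isOpen.mem_nhds (hYu τ hτ))).and ?_
    exact (hinv τ hτ).eventually (gt_mem_nhds (by linarith [hC₀' τ hτ]))
  refine ⟨C₀ + 1, by linarith, hev.mono fun p hp t ht => ?_⟩
  have h1t : (0 : ℝ) < 1 + t := by linarith
  have hne : ((1 + t : ℝ) : ℂ) ≠ 0 := by exact_mod_cast h1t.ne'
  obtain ⟨hu, hn⟩ := hp (t / (1 + t))
    ⟨by positivity, by rw [div_le_one h1t]; linarith⟩
  have h3 : X p + algebraMap ℂ 𝔸 (t : ℂ) = (Units.mk0 _ hne) • Y (p, t / (1 + t)) := by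
    simp only [hY, Units.smul_mk0, smul_add, Algebra.algebraMap_eq_smul_one, smul_smul]
    push_cast at hne ⊢
    congr 2
    · rw [mul_sub, mul_div_cancel₀ _ hne]; simp
    · rw [mul_div_cancel₀ _ hne]
  refine ⟨h3 ▸ hu.smul _, ?_⟩
  obtain ⟨v, hv⟩ := hu
  set c : ℂ := ((1 + t : ℝ) : ℂ)
  have h4 : X p + algebraMap ℂ 𝔸 (t : ℂ) = ((⟨c • (v : 𝔸), c⁻¹ • ((v⁻¹ : 𝔸ˣ) : 𝔸),
      by rw [smul_mul_smul_comm, Units.mul_inv, mul_inv_cancel₀ hne, one_smul],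
      by rw [smul_mul_smul_comm, Units.inv_mul, inv_mul_cancel₀ hne, one_smul]⟩ : 𝔸ˣ) : 𝔸) := by
    rw [h3, ← hv]; rfl
  rw [h4, Ring.inverse_unit]
  rw [← hv, Ring.inverse_unit] at hn
  rw [Units.inv_mk, norm_smul, norm_inv, Complex.norm_real, Real.norm_eq_abs, abs_of_pos h1t,
    mul_comm]
  gcongr

lemma continuousOn_inverse_add {X : 𝔸} (h : SlitSpec X) :
    ContinuousOn (fun t : ℝ => Ring.inverse (X + algebraMap ℂ 𝔸 (t : ℂ))) (Ioi 0) := by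
  intro t ht
  obtain ⟨u, hu⟩ := h t (le_of_lt ht)
  have h1 : ContinuousAt Ring.inverse (X + algebraMap ℂ 𝔸 (t : ℂ)) :=
    hu ▸ NormedRing.inverse_continuousAt u
  have h2 : ContinuousAt (fun t : ℝ => X + algebraMap ℂ 𝔸 (t : ℂ)) t :=
    continuousAt_const.add ((continuous_algebraMap ℂ 𝔸).continuousAt.comp
      Complex.continuous_ofReal.continuousAt)
  exact (ContinuousAt.comp (f := fun t : ℝ => X + algebraMap ℂ 𝔸 (t : ℂ)) h1 h2).continuousWithinAt

lemma continuousOn_weight (s : ℝ) :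
    ContinuousOn (fun t : ℝ => ((t ^ (s - 1) : ℝ) : ℂ)) (Ioi 0) := by
  refine Complex.continuous_ofReal.comp_continuousOn ?_
  intro t ht
  exact (Real.continuousAt_rpow_const t _ (Or.inl (ne_of_gt ht))).continuousWithinAt

lemma integrableOn_fracInt {s : ℝ} (hs : s ∈ Ioo (0 : ℝ) 1) {X : 𝔸} (h : SlitSpec X) :
    IntegrableOn (fun t : ℝ => ((t ^ (s - 1) : ℝ) : ℂ) •
      (X * Ring.inverse (X + algebraMap ℂ 𝔸 (t : ℂ)))) (Ioi 0) := by
  obtain ⟨C, hC, hev⟩ := resolvent_bound (X := fun x : 𝔸 => x) (p₀ := X) continuousAt_id h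
  have hb := hev.self_of_nhds
  refine Integrable.mono' ((integrableOn_weight hs).mul_const (‖X‖ * C)) ?_ ?_
  · exact ((continuousOn_weight s).smul
      (continuousOn_const.mul (continuousOn_inverse_add h))).aestronglyMeasurable measurableSet_Ioi
  · refine (ae_restrict_iff' measurableSet_Ioi).2 (ae_of_all _ fun t ht => ?_)
    have ht' : (0 : ℝ) < t := ht
    rw [norm_smul, Complex.norm_real, Real.norm_eq_abs, abs_of_nonneg (by positivity), mul_assoc]
    gcongr
    calc _ ≤ ‖X‖ * ‖Ring.inverse (X + algebraMap ℂ 𝔸 (t : ℂ))‖ := norm_mul_le _ _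
      _ ≤ ‖X‖ * (C * (1 + t)⁻¹) := by gcongr; exact (hb t ht'.le).2
      _ = _ := by ring

lemma map_fracInt {s : ℝ} (hs : s ∈ Ioo (0 : ℝ) 1) {X : 𝔸} (h : SlitSpec X)
    {F : Type*} [NormedAddCommGroup F] [NormedSpace ℂ F] [CompleteSpace F] (L : 𝔸 →L[ℂ] F) :
    L (fracInt s X) = ∫ t in Ioi (0 : ℝ), ((t ^ (s - 1) : ℝ) : ℂ) •
      L (X * Ring.inverse (X + algebraMap ℂ 𝔸 (t : ℂ))) := by
  rw [fracInt, ← L.integral_comp_comm (integrableOn_fracInt hs h)]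
  simp

lemma differentiableOn_fracInt {s : ℝ} (hs : s ∈ Ioo (0 : ℝ) 1) {U : Set ℂ} (hU : IsOpen U)
    {X : ℂ → 𝔸} (hX : DifferentiableOn ℂ X U) (h : ∀ p ∈ U, SlitSpec (X p)) :
    DifferentiableOn ℂ (fun p => fracInt s (X p)) U := by
  intro p₀ hp₀
  have hXc : ContinuousAt X p₀ := (hX.differentiableAt (hU.mem_nhds hp₀)).continuousAt
  have hX'c : ContinuousAt (deriv X) p₀ :=
    ((hX.deriv hU).differentiableAt (hU.mem_nhds hp₀)).continuousAt
  obtain ⟨C, hC, hev⟩ := resolvent_bound hXc (h p₀ hp₀)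
  have hev2 : ∀ᶠ p in 𝓝 p₀, ‖deriv X p‖ < ‖deriv X p₀‖ + 1 :=
    hX'c.norm.eventually (gt_mem_nhds (by linarith))
  set D := ‖deriv X p₀‖ + 1
  have hD : 0 ≤ D := by positivity
  have hall := (hev.and hev2).and (hU.mem_nhds hp₀)
  set V := {p | ((∀ t : ℝ, 0 ≤ t → IsUnit (X p + algebraMap ℂ 𝔸 (t : ℂ)) ∧
      ‖Ring.inverse (X p + algebraMap ℂ 𝔸 (t : ℂ))‖ ≤ C * (1 + t)⁻¹) ∧
      ‖deriv X p‖ < D) ∧ p ∈ U} with hV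
  have hVn : V ∈ 𝓝 p₀ := hall
  have key := hasDerivAt_integral_of_dominated_loc_of_deriv_le (μ := volume.restrict (Ioi (0 : ℝ)))
    (F := fun p t => ((t ^ (s - 1) : ℝ) : ℂ) •
      (X p * Ring.inverse (X p + algebraMap ℂ 𝔸 (t : ℂ))))
    (F' := fun p t => ((t ^ (s - 1) : ℝ) : ℂ) • ((t : ℂ) •
      (Ring.inverse (X p + algebraMap ℂ 𝔸 (t : ℂ)) * deriv X p *
        Ring.inverse (X p + algebraMap ℂ 𝔸 (t : ℂ)))))
    (bound := fun t => t ^ (s - 1) * (1 + t)⁻¹ * (C * D * C)) (x₀ := p₀) (s := V) hVn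
    ?_ (integrableOn_fracInt hs (h p₀ hp₀)) ?_ ?_ ((integrableOn_weight hs).mul_const _) ?_
  · exact key.2.differentiableAt.differentiableWithinAt
  · filter_upwards [hU.mem_nhds hp₀] with p hp
    exact (integrableOn_fracInt hs (h p hp)).aestronglyMeasurable
  · have hc := continuousOn_inverse_add (h p₀ hp₀)
    exact ((continuousOn_weight s).smul (Complex.continuous_ofReal.continuousOn.smul
      ((hc.mul continuousOn_const).mul hc))).aestronglyMeasurable measurableSet_Ioi
  · refine (ae_restrict_iff' measurableSet_Ioi).2 (ae_of_all _ fun t ht p hp => ?_)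
    have ht' : (0 : ℝ) < t := ht
    obtain ⟨⟨h1, h2⟩, -⟩ := hp
    have h3 := (h1 t ht'.le).2
    rw [norm_smul, norm_smul, Complex.norm_real, Complex.norm_real, Real.norm_eq_abs,
      Real.norm_eq_abs, abs_of_nonneg (by positivity), abs_of_pos ht', mul_assoc (t ^ (s - 1))]
    refine mul_le_mul_of_nonneg_left ?_ (by positivity)
    have h4 : ‖Ring.inverse (X p + algebraMap ℂ 𝔸 (t : ℂ)) * deriv X p *
        Ring.inverse (X p + algebraMap ℂ 𝔸 (t : ℂ))‖ ≤
        (C * (1 + t)⁻¹) * D * (C * (1 + t)⁻¹) := by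
      refine (norm_mul_le _ _).trans ?_
      gcongr
      refine (norm_mul_le _ _).trans ?_
      gcongr
    calc _ ≤ t * ((C * (1 + t)⁻¹) * D * (C * (1 + t)⁻¹)) := by gcongr
      _ = (t * (1 + t)⁻¹) * ((1 + t)⁻¹ * (C * D * C)) := by ring
      _ ≤ 1 * ((1 + t)⁻¹ * (C * D * C)) := by
        gcongr
        rw [← div_eq_mul_inv, div_le_one (by linarith)]; linarith
      _ = _ := one_mul _
  · refine (ae_restrict_iff' measurableSet_Ioi).2 (ae_of_all _ fun t ht p hp => ?_)
    have ht' : (0 : ℝ) < t := ht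
    obtain ⟨⟨h1, h2⟩, hpU⟩ := hp
    have hXd : HasDerivAt X (deriv X p) p :=
      (hX.differentiableAt (hU.mem_nhds hpU)).hasDerivAt
    obtain ⟨u, hu⟩ := (h1 t ht'.le).1
    have h5 : HasDerivAt (fun p => Ring.inverse (X p + algebraMap ℂ 𝔸 (t : ℂ)))
        (-(Ring.inverse (X p + algebraMap ℂ 𝔸 (t : ℂ)) * deriv X p *
        Ring.inverse (X p + algebraMap ℂ 𝔸 (t : ℂ)))) p := by
      have := hasFDerivAt_ringInverse (𝕜 := ℂ) u
      rw [hu] at this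
      have := this.comp_hasDerivAt p (hXd.add_const (algebraMap ℂ 𝔸 (t : ℂ)))
      refine this.congr_deriv ?_
      simp [← hu]
    have h6 := ((h5.const_smul (t : ℂ)).const_sub 1).const_smul ((t ^ (s - 1) : ℝ) : ℂ)
    have h7 : ∀ᶠ p' in 𝓝 p, ((t ^ (s - 1) : ℝ) : ℂ) •
        (X p' * Ring.inverse (X p' + algebraMap ℂ 𝔸 (t : ℂ))) = ((t ^ (s - 1) : ℝ) : ℂ) •
        (1 - (t : ℂ) • Ring.inverse (X p' + algebraMap ℂ 𝔸 (t : ℂ))) := by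
      filter_upwards [hU.mem_nhds hpU] with p' hp'
      rw [mul_inverse_add (h p' hp' t ht'.le)]
    refine (h6.congr_of_eventuallyEq h7).congr_deriv ?_
    simp

end FractionalIntegral

section FractionalPower

open Set MeasureTheory Filter Topology

variable {𝔸 : Type*} [NormedRing 𝔸] [NormedAlgebra ℂ 𝔸]

/-- The power `X ^ s`, `0 < s < 1`, through the Balakrishnan integral. -/
def fpow (s : ℝ) (X : 𝔸) : 𝔸 :=
  ((∫ t in Ioi (0 : ℝ), Real.rpowIntegrand₀₁ s t 1 : ℝ) : ℂ)⁻¹ • fracInt s X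

lemma inverse_smul_of_isUnit {c : ℂ} (hc : c ≠ 0) {Y : 𝔸} (hY : IsUnit Y) :
    Ring.inverse (c • Y) = c⁻¹ • Ring.inverse Y := by
  obtain ⟨v, rfl⟩ := hY
  have h4 : c • (v : 𝔸) = ((⟨c • (v : 𝔸), c⁻¹ • ((v⁻¹ : 𝔸ˣ) : 𝔸),
      by rw [smul_mul_smul_comm, Units.mul_inv, mul_inv_cancel₀ hc, one_smul],
      by rw [smul_mul_smul_comm, Units.inv_mul, inv_mul_cancel₀ hc, one_smul]⟩ : 𝔸ˣ) : 𝔸) := rfl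
  rw [h4, Ring.inverse_unit, Ring.inverse_unit]
  rfl

lemma fracInt_ofReal_smul (s : ℝ) {X : 𝔸} (h : SlitSpec X) {x : ℝ} (hx : 0 < x) :
    fracInt s ((x : ℂ) • X) = ((x ^ s : ℝ) : ℂ) • fracInt s X := by
  have hxc : (x : ℂ) ≠ 0 := by exact_mod_cast hx.ne'
  have h1 := integral_comp_mul_left_Ioi (fun t : ℝ => ((t ^ (s - 1) : ℝ) : ℂ) •
    (((x : ℂ) • X) * Ring.inverse ((x : ℂ) • X + algebraMap ℂ 𝔸 (t : ℂ)))) 0 hx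
  rw [mul_zero] at h1
  have h2 : fracInt s ((x : ℂ) • X) = x • ∫ t in Ioi (0 : ℝ), (((x * t) ^ (s - 1) : ℝ) : ℂ) •
    (((x : ℂ) • X) * Ring.inverse ((x : ℂ) • X + algebraMap ℂ 𝔸 ((x * t : ℝ) : ℂ))) := by
    rw [h1, smul_smul, mul_inv_cancel₀ hx.ne', one_smul]
    rfl
  rw [h2, fracInt, ← integral_smul, ← integral_smul]
  refine setIntegral_congr_fun measurableSet_Ioi fun t ht => ?_
  have ht' : (0 : ℝ) < t := ht
  have h3 : (x : ℂ) • X + algebraMap ℂ 𝔸 ((x * t : ℝ) : ℂ) =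
      (x : ℂ) • (X + algebraMap ℂ 𝔸 (t : ℂ)) := by
    rw [smul_add, Algebra.algebraMap_eq_smul_one, Algebra.algebraMap_eq_smul_one, smul_smul,
      Complex.ofReal_mul]
  rw [h3, inverse_smul_of_isUnit hxc (h t ht'.le), smul_mul_smul_comm, mul_inv_cancel₀ hxc,
    one_smul, ← Complex.coe_smul, smul_smul, smul_smul]
  congr 1
  rw [Real.mul_rpow hx.le ht'.le, ← Complex.ofReal_mul, ← Complex.ofReal_mul, ← mul_assoc]
  congr 2
  rw [Real.rpow_sub_one hx.ne']
  field_simp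

lemma fpow_ofReal_smul (s : ℝ) {X : 𝔸} (h : SlitSpec X) {x : ℝ} (hx : 0 < x) :
    fpow s ((x : ℂ) • X) = ((x ^ s : ℝ) : ℂ) • fpow s X := by
  rw [fpow, fracInt_ofReal_smul s h hx, smul_comm, fpow]

variable [CompleteSpace 𝔸]

lemma differentiableOn_fpow {s : ℝ} (hs : s ∈ Ioo (0 : ℝ) 1) {U : Set ℂ} (hU : IsOpen U)
    {X : ℂ → 𝔸} (hX : DifferentiableOn ℂ X U) (h : ∀ p ∈ U, SlitSpec (X p)) :
    DifferentiableOn ℂ (fun p => fpow s (X p)) U :=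
  (differentiableOn_fracInt hs hU hX h).fun_const_smul _

lemma fpow_smul {s : ℝ} (hs : s ∈ Ioo (0 : ℝ) 1) {X : 𝔸} {U : Set ℂ} (hU : IsOpen U)
    (hUc : IsPreconnected U) (h1 : (1 : ℂ) ∈ U) (hUs : U ⊆ Complex.slitPlane)
    (h : ∀ z ∈ U, SlitSpec (z • X)) {z : ℂ} (hz : z ∈ U) :
    fpow s (z • X) = z ^ (s : ℂ) • fpow s X := by
  have hX : SlitSpec X := by simpa using h 1 h1
  have hf : AnalyticOnNhd ℂ (fun z : ℂ => fpow s (z • X)) U :=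
    (differentiableOn_fpow hs hU (differentiableOn_id.smul_const X) h).analyticOnNhd hU
  have hg : AnalyticOnNhd ℂ (fun z : ℂ => z ^ (s : ℂ) • fpow s X) U := by
    refine DifferentiableOn.analyticOnNhd (fun z hz => ?_) hU
    exact ((differentiableAt_id.cpow_const (hUs hz)).smul_const _).differentiableWithinAt
  refine hf.eqOn_of_preconnected_of_frequently_eq hg hUc h1 ?_ hz
  have ht : Tendsto (fun x : ℝ => (x : ℂ)) (𝓝[≠] 1) (𝓝[≠] 1) := by
    refine tendsto_nhdsWithin_iff.2 ⟨?_, ?_⟩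
    · exact (Complex.continuous_ofReal.tendsto' 1 1 (by simp)).mono_left nhdsWithin_le_nhds
    · filter_upwards [self_mem_nhdsWithin] with x hx
      simpa using hx
  refine ht.frequently (Eventually.frequently ?_)
  filter_upwards [nhdsWithin_le_nhds (lt_mem_nhds (zero_lt_one' ℝ))] with x hx
  rw [fpow_ofReal_smul s hX hx, Complex.ofReal_cpow hx.le]

lemma slitSpec_complex {z : ℂ} (hz : z ∈ Complex.slitPlane) : SlitSpec z := by
  intro t ht
  rw [isUnit_iff_ne_zero]
  intro h0
  have : z = ((-t : ℝ) : ℂ) := by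
    push_cast
    simpa using eq_neg_of_add_eq_zero_left h0
  rw [this, Complex.ofReal_mem_slitPlane] at hz
  linarith

lemma fpow_one_complex {s : ℝ} (hs : s ∈ Ioo (0 : ℝ) 1) : fpow s (1 : ℂ) = 1 := by
  have h : fracInt s (1 : ℂ) = ((∫ t in Ioi (0 : ℝ), Real.rpowIntegrand₀₁ s t 1 : ℝ) : ℂ) := by
    rw [fracInt, ← integral_complex_ofReal]
    refine setIntegral_congr_fun measurableSet_Ioi fun t ht => ?_
    simp only [Real.rpowIntegrand₀₁_eq_pow_div hs (le_of_lt ht) zero_le_one]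
    simp [div_eq_mul_inv, add_comm]
  rw [fpow, h, smul_eq_mul, inv_mul_cancel₀]
  exact_mod_cast (Real.integral_rpowIntegrand₀₁_one_pos hs).ne'

lemma fpow_complex {s : ℝ} (hs : s ∈ Ioo (0 : ℝ) 1) {z : ℂ} (hz : z ∈ Complex.slitPlane) :
    fpow s z = z ^ (s : ℂ) := by
  have := fpow_smul hs (X := (1 : ℂ)) Complex.isOpen_slitPlane
    (Complex.starConvex_one_slitPlane.isPathConnected (by simp)).isConnected.isPreconnected
    (by simp) subset_rfl (fun z hz => by simpa using slitSpec_complex hz) hz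
  simpa [fpow_one_complex hs] using this

end FractionalPower

section ScalarSectors

open Real

lemma cpow_mul_eq_exp {p κ : ℂ} (hp : p ≠ 0) (hκ : κ ≠ 0) (s : ℝ) :
    p ^ (s : ℂ) * κ = Complex.exp (s * Complex.log p + Complex.log κ) := by
  rw [Complex.cpow_def_of_ne_zero hp, Complex.exp_add, Complex.exp_log hκ, mul_comm (s : ℂ)]

lemma im_cpow_mul {p κ : ℂ} (hp : p ≠ 0) (hκ : κ ≠ 0) (s : ℝ) :
    ∃ c : ℝ, 0 < c ∧ (p ^ (s : ℂ) * κ).im = c * sin (s * p.arg + κ.arg) := by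
  rw [cpow_mul_eq_exp hp hκ, Complex.exp_im]
  refine ⟨exp (s * Complex.log p + Complex.log κ).re, exp_pos _, ?_⟩
  congr 2
  simp [Complex.log_im]

lemma abs_arg_le_of_im_cpow_mul {p κ : ℂ} {s : ℝ} (hs : s ∈ Set.Ioc (0 : ℝ) 1) (hp : 0 < p.re)
    (hκ : 0 < κ.re)
    (h : ∀ ε : ℝ, 0 ≤ ε * p.im →
      0 ≤ ε * (p ^ (s : ℂ) * κ).im ∧ 0 ≤ -ε * (p⁻¹ ^ (s : ℂ) * κ).im) :
    |κ.arg| ≤ s * |p.arg| := by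
  have hp0 : p ≠ 0 := by rintro rfl; simp at hp
  have hκ0 : κ ≠ 0 := by rintro rfl; simp at hκ
  have hpa : |p.arg| < π / 2 := Complex.abs_arg_lt_pi_div_two_iff.2 (Or.inl hp)
  have hκa : |κ.arg| < π / 2 := Complex.abs_arg_lt_pi_div_two_iff.2 (Or.inl hκ)
  have hia : p⁻¹.arg = -p.arg := by
    rw [Complex.arg_inv, if_neg]
    intro h
    rw [h, abs_of_pos pi_pos] at hpa
    linarith [pi_pos]
  obtain ⟨c, hc, h1⟩ := im_cpow_mul hp0 hκ0 s
  obtain ⟨d, hd, h2⟩ := im_cpow_mul (inv_ne_zero hp0) hκ0 s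
  rw [hia] at h2
  have hsp : |s * p.arg| < π / 2 := by
    rw [abs_mul, abs_of_pos hs.1]
    calc s * |p.arg| ≤ 1 * |p.arg| := by gcongr; exact hs.2
      _ < _ := by linarith
  rw [abs_lt] at hκa hsp
  have key : ∀ ε : ℝ, ε = 1 ∨ ε = -1 → 0 ≤ ε * p.im →
      0 ≤ ε * (s * p.arg + κ.arg) ∧ ε * κ.arg ≤ ε * (s * p.arg) := by
    intro ε hε hεp
    obtain ⟨h3, h4⟩ := h ε hεp
    rw [h1] at h3
    rw [h2] at h4
    rcases hε with rfl | rfl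
    · constructor
      · by_contra! hneg
        have : sin (s * p.arg + κ.arg) < 0 :=
          sin_neg_of_neg_of_neg_pi_lt (by linarith) (by linarith)
        nlinarith
      · by_contra! hneg
        have : 0 < sin (s * -p.arg + κ.arg) :=
          sin_pos_of_pos_of_lt_pi (by linarith) (by linarith)
        nlinarith
    · constructor
      · by_contra! hneg
        have : 0 < sin (s * p.arg + κ.arg) :=
          sin_pos_of_pos_of_lt_pi (by linarith) (by linarith)
        nlinarith
      · by_contra! hneg
        have : sin (s * -p.arg + κ.arg) < 0 :=
          sin_neg_of_neg_of_neg_pi_lt (by linarith) (by linarith)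
        nlinarith
  rw [← abs_of_pos hs.1, ← abs_mul]
  rcases le_total 0 p.im with hi | hi
  · have := key 1 (Or.inl rfl) (by linarith)
    rw [abs_le]
    have h5 := le_abs_self (s * p.arg)
    constructor <;> linarith
  · have := key (-1) (Or.inr rfl) (by linarith)
    rw [abs_le]
    have h5 := neg_abs_le (s * p.arg)
    have h6 := neg_le_abs (s * p.arg)
    constructor <;> linarith

lemma mem_slitPlane_and_im_mul_cpow {p g κ : ℂ} {α r : ℝ} (hα : 1 / 2 ≤ α)
    (hr : α * (1 + r) = 1) (hp : 0 < p.re) (hg : g ≠ 0) (hκ : κ ≠ 0)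
    (hga : |g.arg| ≤ |p.arg|) (hκa : |κ.arg| ≤ r * |p.arg|) :
    g / star κ ∈ Complex.slitPlane ∧
      ∀ ε : ℝ, 0 ≤ ε * p.im → 0 ≤ ε * (p * (g / star κ) ^ (α : ℂ)).im := by
  have hp0 : p ≠ 0 := by rintro rfl; simp at hp
  have hα0 : 0 < α := by linarith
  have hpa : |p.arg| < π / 2 := Complex.abs_arg_lt_pi_div_two_iff.2 (Or.inl hp)
  set w : ℂ := Complex.log g - star (Complex.log κ) with hw
  have hμ : g / star κ = Complex.exp w := by
    rw [hw, Complex.exp_sub, Complex.exp_log hg]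
    congr 1
    have := Complex.exp_conj (Complex.log κ)
    rw [Complex.exp_log hκ] at this
    exact this.symm
  have hwi : w.im = g.arg + κ.arg := by simp [hw, Complex.log_im]
  have hwb : α * |w.im| ≤ |p.arg| := by
    have h1 : |w.im| ≤ (1 + r) * |p.arg| := by
      rw [hwi]
      refine (abs_add_le _ _).trans ?_
      linarith
    calc α * |w.im| ≤ α * ((1 + r) * |p.arg|) := by gcongr
      _ = |p.arg| := by rw [← mul_assoc, hr, one_mul]
  have hwpi : |w.im| < π := by
    have : 0 ≤ |w.im| := abs_nonneg _
    nlinarith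
  have hlog : Complex.log (g / star κ) = w := by
    rw [hμ, Complex.log_exp (by linarith [(abs_lt.1 hwpi).1]) (by linarith [(abs_lt.1 hwpi).2])]
  have hne : g / star κ ≠ 0 := hμ ▸ Complex.exp_ne_zero _
  refine ⟨?_, fun ε hε => ?_⟩
  · rw [Complex.mem_slitPlane_iff_arg]
    refine ⟨?_, hne⟩
    rw [← Complex.log_im, hlog]
    exact (lt_of_abs_lt hwpi).ne
  · have h1 : p * (g / star κ) ^ (α : ℂ) = Complex.exp (Complex.log p + w * α) := by
      rw [Complex.cpow_def_of_ne_zero hne, hlog, Complex.exp_add, Complex.exp_log hp0]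
    have h2 : (Complex.log p + w * α).im = p.arg + α * w.im := by
      simp [Complex.log_im]; ring
    have h3 : |α * w.im| ≤ |p.arg| := by rwa [abs_mul, abs_of_pos hα0]
    rw [h1, Complex.exp_im, h2]
    have h4 := abs_le.1 h3
    have h5 := abs_lt.1 hpa
    rw [mul_left_comm]
    refine mul_nonneg (exp_pos _).le ?_
    rcases lt_trichotomy p.im 0 with hi | hi | hi
    · have hε' : ε ≤ 0 := by nlinarith
      have ha : p.arg < 0 := Complex.arg_neg_iff.2 hi
      rw [abs_of_neg ha] at h4
      exact mul_nonneg_of_nonpos_of_nonpos hε'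
        (sin_nonpos_of_nonpos_of_neg_pi_le (by linarith) (by linarith))
    · have ha : p.arg = 0 := Complex.arg_eq_zero_iff.2 ⟨hp.le, hi⟩
      rw [ha, abs_zero] at h4
      rw [ha, show α * w.im = 0 by linarith]
      simp
    · have hε' : 0 ≤ ε := by nlinarith
      have ha : 0 ≤ p.arg := Complex.arg_nonneg_iff.2 hi.le
      rw [abs_of_nonneg ha] at h4
      exact mul_nonneg hε' (sin_nonneg_of_nonneg_of_le_pi (by linarith)
        (by linarith))

end ScalarSectors

section QuadraticForm

open Set MeasureTheory
open scoped Matrix.Norms.Operator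

set_option linter.unusedSectionVars false

variable {ι : Type*} [Fintype ι] [DecidableEq ι]

/-- The quadratic form `v ↦ ⟨v, X v⟩`. -/
def qform (X : Matrix ι ι ℂ) (v : ι → ℂ) : ℂ := star v ⬝ᵥ X *ᵥ v

/-- The quadratic form at a fixed vector as a functional of the matrix. -/
def qformCLM (v : ι → ℂ) : Matrix ι ι ℂ →L[ℂ] ℂ :=
  LinearMap.toContinuousLinearMap
    { toFun := fun X => qform X v
      map_add' := fun X Y => by simp [qform, add_mulVec]
      map_smul' := fun c X => by simp [qform, smul_mulVec] }

lemma qformCLM_apply (v : ι → ℂ) (X : Matrix ι ι ℂ) : qformCLM v X = qform X v := rfl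

lemma qform_add (X Y : Matrix ι ι ℂ) (v : ι → ℂ) : qform (X + Y) v = qform X v + qform Y v :=
  map_add (qformCLM v) X Y

lemma qform_smul (c : ℂ) (X : Matrix ι ι ℂ) (v : ι → ℂ) : qform (c • X) v = c * qform X v :=
  map_smul (qformCLM v) c X

lemma qform_zero (X : Matrix ι ι ℂ) : qform X 0 = 0 := by simp [qform]

lemma add_algebraMap_mulVec (X : Matrix ι ι ℂ) (c : ℂ) (v : ι → ℂ) :
    (X + algebraMap ℂ (Matrix ι ι ℂ) c) *ᵥ v = X *ᵥ v + c • v := by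
  rw [Algebra.algebraMap_eq_smul_one, add_mulVec, smul_mulVec, one_mulVec]

lemma isUnit_of_forall_mulVec_ne_zero {X : Matrix ι ι ℂ} (h : ∀ v ≠ 0, X *ᵥ v ≠ 0) :
    IsUnit X := by
  rw [isUnit_iff_isUnit_det, isUnit_iff_ne_zero]
  intro h0
  obtain ⟨v, hv, hv0⟩ := exists_mulVec_eq_zero_iff.2 h0
  exact h v hv hv0

lemma slitSpec_of_mulVec_ne {X : Matrix ι ι ℂ}
    (h : ∀ v ≠ 0, ∀ μ : ℂ, X *ᵥ v = μ • v → μ ∈ Complex.slitPlane) : SlitSpec X := by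
  intro t ht
  refine isUnit_of_forall_mulVec_ne_zero fun v hv h0 => ?_
  rw [add_algebraMap_mulVec] at h0
  have := h v hv (-(t : ℂ)) (by rw [neg_smul]; exact eq_neg_of_add_eq_zero_left h0)
  rw [← Complex.ofReal_neg, Complex.ofReal_mem_slitPlane] at this
  linarith

lemma slitSpec_of_qform {X : Matrix ι ι ℂ}
    (h : ∀ v ≠ 0, qform X v ∈ Complex.slitPlane) : SlitSpec X := by
  refine slitSpec_of_mulVec_ne fun v hv μ hμ => ?_
  have h1 : qform X v = μ * (star v ⬝ᵥ v) := by
    rw [qform, hμ, dotProduct_smul, smul_eq_mul]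
  obtain ⟨c, hc⟩ : ∃ c : ℝ, (star v ⬝ᵥ v) = c :=
    ⟨(star v ⬝ᵥ v).re,
      Complex.ext rfl (Complex.nonneg_iff.1 (dotProduct_star_self_nonneg v)).2.symm⟩
  have hpos : 0 < c := by
    have := dotProduct_star_self_pos_iff.2 hv
    rw [hc] at this
    exact_mod_cast this
  have h2 := h v hv
  rw [h1, hc, Complex.mem_slitPlane_iff] at h2
  rw [Complex.mem_slitPlane_iff]
  simpa [hpos, hpos.ne'] using h2

lemma slitSpec_smul_of_accretive {X : Matrix ι ι ℂ} (h : ∀ v ≠ 0, 0 < (qform X v).re) {p : ℂ}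
    (hp : 0 < p.re) : SlitSpec (p • X) := by
  refine slitSpec_of_qform fun v hv => ?_
  rw [qform_smul, Complex.mem_slitPlane_iff]
  have h1 := h v hv
  by_contra! hcon
  obtain ⟨h2, h3⟩ := hcon
  simp only [Complex.mul_re, Complex.mul_im] at h2 h3
  have h4 : p.re * (qform X v).re ≤ p.im * (qform X v).im := by linarith
  have h5 : 0 < p.re * (qform X v).re := by positivity
  have h6 : p.re * ((qform X v).im ^ 2) = - ((qform X v).re * (p.im * (qform X v).im)) := by
    linear_combination (qform X v).im * h3
  nlinarith [mul_nonneg hp.le (sq_nonneg (qform X v).im)]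

lemma slitSpec_of_accretive {X : Matrix ι ι ℂ} (h : ∀ v ≠ 0, 0 < (qform X v).re) :
    SlitSpec X := by
  simpa using slitSpec_smul_of_accretive h (p := 1) (by simp)

lemma qform_mul_inverse {X : Matrix ι ι ℂ} {t : ℝ}
    (h : IsUnit (X + algebraMap ℂ (Matrix ι ι ℂ) (t : ℂ))) {v : ι → ℂ} (hv : v ≠ 0) :
    ∃ y ≠ 0, ∃ c : ℝ, 0 ≤ c ∧
      qform (X * Ring.inverse (X + algebraMap ℂ (Matrix ι ι ℂ) (t : ℂ))) v =
        c + t * qform X y := by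
  set R := Ring.inverse (X + algebraMap ℂ (Matrix ι ι ℂ) (t : ℂ)) with hR
  have hRv : X *ᵥ (R *ᵥ v) + (t : ℂ) • (R *ᵥ v) = v := by
    rw [← add_algebraMap_mulVec, mulVec_mulVec, hR, Ring.mul_inverse_cancel _ h, one_mulVec]
  set y := R *ᵥ v
  have hy : y ≠ 0 := by
    intro h0
    rw [h0] at hRv
    simp at hRv
    exact hv hRv.symm
  have h0 := Complex.nonneg_iff.1 (dotProduct_star_self_nonneg (X *ᵥ y))
  refine ⟨y, hy, (star (X *ᵥ y) ⬝ᵥ (X *ᵥ y)).re, h0.1, ?_⟩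
  have h1 : ((star (X *ᵥ y) ⬝ᵥ (X *ᵥ y)).re : ℂ) = star (X *ᵥ y) ⬝ᵥ (X *ᵥ y) :=
    Complex.ext rfl h0.2
  rw [h1, qform, qform, ← mulVec_mulVec]
  change star v ⬝ᵥ X *ᵥ y = _
  nth_rewrite 1 [← hRv]
  simp [add_dotProduct]

lemma map_fpow_qform {s : ℝ} (hs : s ∈ Ioo (0 : ℝ) 1) {X : Matrix ι ι ℂ} (h : SlitSpec X)
    (v : ι → ℂ) (L : ℂ →L[ℝ] ℝ) :
    ∃ c : ℝ, 0 < c ∧ L (qform (fpow s X) v) = c * ∫ t in Ioi (0 : ℝ), t ^ (s - 1) *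
      L (qform (X * Ring.inverse (X + algebraMap ℂ (Matrix ι ι ℂ) (t : ℂ))) v) ∧
      IntegrableOn (fun t : ℝ => t ^ (s - 1) *
        L (qform (X * Ring.inverse (X + algebraMap ℂ (Matrix ι ι ℂ) (t : ℂ))) v)) (Ioi 0) := by
  refine ⟨(∫ t in Ioi (0 : ℝ), Real.rpowIntegrand₀₁ s t 1)⁻¹,
    inv_pos.2 (Real.integral_rpowIntegrand₀₁_one_pos hs), ?_⟩
  have h1 := (qformCLM v).integrable_comp (integrableOn_fracInt hs h)
  have h2 : IntegrableOn (fun t : ℝ => L (qformCLM v (((t ^ (s - 1) : ℝ) : ℂ) •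
      (X * Ring.inverse (X + algebraMap ℂ (Matrix ι ι ℂ) (t : ℂ)))))) (Ioi 0) :=
    L.integrable_comp h1
  have h3 : (fun t : ℝ => L (qformCLM v (((t ^ (s - 1) : ℝ) : ℂ) •
      (X * Ring.inverse (X + algebraMap ℂ (Matrix ι ι ℂ) (t : ℂ)))))) = fun t : ℝ => t ^ (s - 1) *
        L (qform (X * Ring.inverse (X + algebraMap ℂ (Matrix ι ι ℂ) (t : ℂ))) v) := by
    funext t
    rw [map_smul, Complex.coe_smul, map_smul, smul_eq_mul, qformCLM_apply]
  rw [h3] at h2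
  refine ⟨?_, h2⟩
  have e1 : ∫ t in Ioi (0 : ℝ), L (qformCLM v (((t ^ (s - 1) : ℝ) : ℂ) •
      (X * Ring.inverse (X + algebraMap ℂ (Matrix ι ι ℂ) (t : ℂ))))) = L (qformCLM v (fracInt s X)) :=
    (L.integral_comp_comm h1).trans
      (congrArg L ((qformCLM v).integral_comp_comm (integrableOn_fracInt hs h)))
  rw [← h3, e1, ← smul_eq_mul, ← map_smul L, ← Complex.coe_smul, ← map_smul (qformCLM v),
    qformCLM_apply, fpow]
  simp

lemma fpow_qform_re_pos {s : ℝ} (hs : s ∈ Ioo (0 : ℝ) 1) {X : Matrix ι ι ℂ}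
    (h : ∀ v ≠ 0, 0 < (qform X v).re) {v : ι → ℂ} (hv : v ≠ 0) :
    0 < (qform (fpow s X) v).re := by
  obtain ⟨c, hc, h1, h2⟩ := map_fpow_qform hs (slitSpec_of_accretive h) v Complex.reCLM
  rw [Complex.reCLM_apply] at h1
  rw [h1]
  refine mul_pos hc ?_
  have hpos : ∀ t ∈ Ioi (0 : ℝ), 0 < t ^ (s - 1) * Complex.reCLM
      (qform (X * Ring.inverse (X + algebraMap ℂ (Matrix ι ι ℂ) (t : ℂ))) v) := by
    intro t ht
    have ht' : (0 : ℝ) < t := ht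
    obtain ⟨y, hy, d, hd, h3⟩ := qform_mul_inverse (slitSpec_of_accretive h t ht'.le) hv
    rw [h3]
    have := h y hy
    simp only [Complex.reCLM_apply, Complex.add_re, Complex.ofReal_re, Complex.mul_re,
      Complex.ofReal_im, zero_mul, sub_zero]
    positivity
  rw [setIntegral_pos_iff_support_of_nonneg_ae
    ((ae_restrict_iff' measurableSet_Ioi).2 (ae_of_all _ fun t ht => (hpos t ht).le)) h2]
  refine lt_of_lt_of_le (b := volume (Ioi (0 : ℝ))) (by simp) (measure_mono fun t ht => ?_)
  exact ⟨(hpos t ht).ne', ht⟩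

lemma fpow_qform_im {s : ℝ} (hs : s ∈ Ioo (0 : ℝ) 1) {X : Matrix ι ι ℂ} (hX : SlitSpec X)
    {ε : ℝ} (h : ∀ v, 0 ≤ ε * (qform X v).im) (v : ι → ℂ) :
    0 ≤ ε * (qform (fpow s X) v).im := by
  rcases eq_or_ne v 0 with rfl | hv
  · simp [qform_zero]
  obtain ⟨c, hc, h1, -⟩ := map_fpow_qform hs hX v Complex.imCLM
  rw [Complex.imCLM_apply] at h1
  rw [h1, mul_left_comm, ← integral_const_mul]
  refine mul_nonneg hc.le (setIntegral_nonneg measurableSet_Ioi fun t ht => ?_)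
  have ht' : (0 : ℝ) < t := ht
  obtain ⟨y, hy, d, hd, h3⟩ := qform_mul_inverse (hX t ht'.le) hv
  rw [h3, mul_left_comm]
  refine mul_nonneg (by positivity) ?_
  have := h y
  simp only [Complex.imCLM_apply, Complex.add_im, Complex.ofReal_im, Complex.mul_im,
    Complex.ofReal_re, zero_mul, add_zero, zero_add]
  rw [mul_left_comm]
  positivity

end QuadraticForm

section HermitianPower

lemma exists_diagonalization_mpow {n : ℕ} {A : Matrix (Fin n) (Fin n) ℂ} (hA : A.IsHermitian) :
    ∃ U : Matrix (Fin n) (Fin n) ℂ, Uᴴ * U = 1 ∧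
      A = U * diagonal (fun i => (hA.eigenvalues i : ℂ)) * Uᴴ ∧
      ∀ p : ℝ, mpow A p = U * diagonal (fun i => ((hA.eigenvalues i ^ p : ℝ) : ℂ)) * Uᴴ := by
  refine ⟨hA.eigenvectorUnitary, ?_, ?_, fun p => ?_⟩
  · exact Unitary.coe_star_mul_self hA.eigenvectorUnitary
  · conv_lhs => rw [hA.spectral_theorem, Unitary.conjStarAlgAut_apply]
    rfl
  · rw [mpow, hA.cfc_eq, IsHermitian.cfc, Unitary.conjStarAlgAut_apply]
    rfl

lemma charpoly_roots_mpow {n : ℕ} {A : Matrix (Fin n) (Fin n) ℂ} (hA : A.IsHermitian) (p : ℝ) :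
    (mpow A p).charpoly.roots =
      Finset.univ.val.map fun i => ((hA.eigenvalues i ^ p : ℝ) : ℂ) := by
  rw [mpow, hA.charpoly_cfc_eq, Polynomial.roots_prod _ _
    (Finset.prod_ne_zero_iff.2 fun i _ => Polynomial.X_sub_C_ne_zero _)]
  simp [Multiset.bind_singleton]

end HermitianPower

section MatrixFractionalPower

open Set MeasureTheory
open scoped Matrix.Norms.Operator

set_option linter.unusedSectionVars false

variable {ι : Type*} [Fintype ι] [DecidableEq ι]

lemma inverse_conj_diagonal {U V : Matrix ι ι ℂ} (hVU : V * U = 1) {d : ι → ℂ}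
    (hd : ∀ i, d i ≠ 0) :
    Ring.inverse (U * diagonal d * V) = U * diagonal (fun i => (d i)⁻¹) * V := by
  have hUV : U * V = 1 := mul_eq_one_comm.1 hVU
  have h1 : (U * diagonal d * V) * (U * diagonal (fun i => (d i)⁻¹) * V) = 1 := by
    calc _ = U * (diagonal d * (V * U) * diagonal (fun i => (d i)⁻¹)) * V := by
          simp only [Matrix.mul_assoc]
      _ = 1 := by
          rw [hVU, mul_one, diagonal_mul_diagonal]
          simp [hd, hUV]
  exact Ring.inverse_unit ⟨_, _, h1, mul_eq_one_comm.1 h1⟩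

lemma slitSpec_conj_diagonal {U V : Matrix ι ι ℂ} (hVU : V * U = 1) {d : ι → ℂ}
    (hd : ∀ i, d i ∈ Complex.slitPlane) : SlitSpec (U * diagonal d * V) := by
  have hUV : U * V = 1 := mul_eq_one_comm.1 hVU
  refine slitSpec_of_mulVec_ne fun v hv μ hμ => ?_
  set w := V *ᵥ v with hw
  have hUw : U *ᵥ w = v := by rw [hw, mulVec_mulVec, hUV, one_mulVec]
  have hw0 : w ≠ 0 := by
    intro h
    rw [h, mulVec_zero] at hUw
    exact hv hUw.symm
  have h1 : diagonal d *ᵥ w = μ • w := by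
    have := congrArg (V *ᵥ ·) hμ
    simp only [← mulVec_mulVec, mulVec_smul] at this
    rwa [mulVec_mulVec, hVU, one_mulVec] at this
  obtain ⟨i, hi⟩ := Function.ne_iff.1 hw0
  have h2 := congrFun h1 i
  rw [mulVec_diagonal, Pi.smul_apply, smul_eq_mul] at h2
  rw [← mul_right_cancel₀ hi h2]
  exact hd i

/-- The entry `(i, j)` of `V X U` as a functional of `X`. -/
def conjEntryCLM (U V : Matrix ι ι ℂ) (i j : ι) : Matrix ι ι ℂ →L[ℂ] ℂ :=
  LinearMap.toContinuousLinearMap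
    { toFun := fun X => (V * X * U) i j
      map_add' := fun X Y => by simp [Matrix.mul_add, Matrix.add_mul]
      map_smul' := fun c X => by simp }

lemma fpow_conj_diagonal {s : ℝ} (hs : s ∈ Ioo (0 : ℝ) 1) {U V : Matrix ι ι ℂ} (hVU : V * U = 1)
    {d : ι → ℂ} (hd : ∀ i, d i ∈ Complex.slitPlane) :
    fpow s (U * diagonal d * V) = U * diagonal (fun i => d i ^ (s : ℂ)) * V := by
  have hUV : U * V = 1 := mul_eq_one_comm.1 hVU
  have hX := slitSpec_conj_diagonal hVU hd
  have key : ∀ Y : Matrix ι ι ℂ, V * (U * Y * V) * U = Y := fun Y => by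
    calc _ = (V * U) * Y * (V * U) := by simp only [Matrix.mul_assoc]
      _ = Y := by rw [hVU, one_mul, mul_one]
  have hR : ∀ t : ℝ, 0 < t → V * ((U * diagonal d * V) * Ring.inverse ((U * diagonal d * V) +
      algebraMap ℂ (Matrix ι ι ℂ) (t : ℂ))) * U = diagonal fun i => d i * (d i + t)⁻¹ := by
    intro t ht
    have h1 : (U * diagonal d * V) + algebraMap ℂ (Matrix ι ι ℂ) (t : ℂ) =
        U * diagonal (fun i => d i + t) * V := by
      rw [← diagonal_add, Matrix.mul_add, Matrix.add_mul, Algebra.algebraMap_eq_smul_one,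
        show diagonal (fun _ : ι => (t : ℂ)) = (t : ℂ) • (1 : Matrix ι ι ℂ) by
          rw [smul_one_eq_diagonal]]
      simp [hUV]
    have h2 : ∀ i, d i + t ≠ 0 := fun i => by
      simpa using (slitSpec_complex (hd i) t ht.le).ne_zero
    rw [h1, inverse_conj_diagonal hVU h2]
    calc _ = V * (U * (diagonal d * (V * U) * diagonal (fun i => (d i + t)⁻¹)) * V) * U := by
          simp only [Matrix.mul_assoc]
      _ = _ := by rw [key, hVU, mul_one, diagonal_mul_diagonal]
  have hent : V * fpow s (U * diagonal d * V) * U = diagonal (fun i => d i ^ (s : ℂ)) := by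
    ext i j
    have h1 : (V * fpow s (U * diagonal d * V) * U) i j =
        ((∫ t in Ioi (0 : ℝ), Real.rpowIntegrand₀₁ s t 1 : ℝ) : ℂ)⁻¹ *
          conjEntryCLM U V i j (fracInt s (U * diagonal d * V)) := by
      simp [fpow, conjEntryCLM]
    have e1 : conjEntryCLM U V i j (fracInt s (U * diagonal d * V)) =
        ∫ t in Ioi (0 : ℝ), ((t ^ (s - 1) : ℝ) : ℂ) • conjEntryCLM U V i j
          ((U * diagonal d * V) * Ring.inverse ((U * diagonal d * V) +
            algebraMap ℂ (Matrix ι ι ℂ) (t : ℂ))) :=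
      map_fracInt hs hX (conjEntryCLM U V i j)
    have h2 : ∀ t ∈ Ioi (0 : ℝ), ((t ^ (s - 1) : ℝ) : ℂ) • conjEntryCLM U V i j
        ((U * diagonal d * V) * Ring.inverse ((U * diagonal d * V) +
          algebraMap ℂ (Matrix ι ι ℂ) (t : ℂ))) =
        ((t ^ (s - 1) : ℝ) : ℂ) • (diagonal fun i => d i * (d i + t)⁻¹ : Matrix ι ι ℂ) i j :=
      fun t ht => by
        rw [← hR t ht]
        rfl
    rw [h1, e1, setIntegral_congr_fun measurableSet_Ioi h2]
    rcases eq_or_ne i j with rfl | hij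
    · simp only [diagonal_apply_eq]
      rw [← fpow_complex hs (hd i), fpow, fracInt, smul_eq_mul]
      simp
    · simp [diagonal_apply_ne _ hij]
  rw [← hent]
  calc _ = (U * V) * fpow s (U * diagonal d * V) * (U * V) := by rw [hUV, one_mul, mul_one]
    _ = _ := by simp only [Matrix.mul_assoc]

/-- The matrix power `X ^ r` for `0 < r ≤ 1`. -/
def gpow (r : ℝ) (X : Matrix ι ι ℂ) : Matrix ι ι ℂ := if r = 1 then X else fpow r X

lemma differentiableOn_gpow {r : ℝ} (hr : r ∈ Ioc (0 : ℝ) 1) {U : Set ℂ} (hU : IsOpen U)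
    {X : ℂ → Matrix ι ι ℂ} (hX : DifferentiableOn ℂ X U) (h : ∀ p ∈ U, SlitSpec (X p)) :
    DifferentiableOn ℂ (fun p => gpow r (X p)) U := by
  unfold gpow
  split_ifs with h1
  · exact hX
  · exact differentiableOn_fpow ⟨hr.1, lt_of_le_of_ne hr.2 h1⟩ hU hX h

lemma gpow_eq_mpow {n : ℕ} {r : ℝ} (hr : r ∈ Ioc (0 : ℝ) 1) {A : Matrix (Fin n) (Fin n) ℂ}
    (hA : A.PosDef) : gpow r A = mpow A r := by
  obtain ⟨U, hU, h1, h2⟩ := exists_diagonalization_mpow hA.1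
  rw [h2, gpow]
  split_ifs with h
  · conv_lhs => rw [h1]
    simp [h]
  · conv_lhs => rw [h1]
    rw [fpow_conj_diagonal ⟨hr.1, lt_of_le_of_ne hr.2 h⟩ hU
      fun i => Complex.ofReal_mem_slitPlane.2 (hA.eigenvalues_pos i)]
    congr 3
    funext i
    rw [Complex.ofReal_cpow (hA.eigenvalues_pos i).le]

/-- The pencil `p Z₁ + p⁻¹ Z₀`. -/
def pencil (Z₁ Z₀ : Matrix ι ι ℂ) (p : ℂ) : Matrix ι ι ℂ := p • Z₁ + p⁻¹ • Z₀

lemma differentiableOn_pencil (Z₁ Z₀ : Matrix ι ι ℂ) :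
    DifferentiableOn ℂ (pencil Z₁ Z₀) {p | 0 < p.re} := by
  intro p hp
  have hp0 : p ≠ 0 := by rintro rfl; simp at hp
  exact ((differentiableAt_id.smul_const _).add
    ((differentiableAt_inv hp0).smul_const _)).differentiableWithinAt

lemma exists_qform_eq_of_posDef {Z : Matrix ι ι ℂ} (hZ : Z.PosDef) {v : ι → ℂ} (hv : v ≠ 0) :
    ∃ a : ℝ, 0 < a ∧ qform Z v = a := by
  have := Complex.pos_iff.1 (hZ.dotProduct_mulVec_pos hv)
  exact ⟨(qform Z v).re, this.1, Complex.ext rfl this.2.symm⟩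

lemma re_inv_pos {p : ℂ} (hp : 0 < p.re) : 0 < p⁻¹.re := by
  have hp0 : p ≠ 0 := by rintro rfl; simp at hp
  rw [Complex.inv_re]
  exact div_pos hp (Complex.normSq_pos.2 hp0)

lemma pencil_accretive {Z₁ Z₀ : Matrix ι ι ℂ} (h₁ : Z₁.PosDef) (h₀ : Z₀.PosDef) {p : ℂ}
    (hp : 0 < p.re) {v : ι → ℂ} (hv : v ≠ 0) : 0 < (qform (pencil Z₁ Z₀ p) v).re := by
  obtain ⟨a, ha, ha'⟩ := exists_qform_eq_of_posDef h₁ hv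
  obtain ⟨b, hb, hb'⟩ := exists_qform_eq_of_posDef h₀ hv
  have := re_inv_pos hp
  rw [pencil, qform_add, qform_smul, qform_smul, ha', hb', Complex.add_re, Complex.re_mul_ofReal,
    Complex.re_mul_ofReal]
  positivity

lemma qform_smul_pencil_im {Z₁ Z₀ : Matrix ι ι ℂ} (h₁ : Z₁.PosDef) (h₀ : Z₀.PosDef) {p : ℂ}
    (hp : 0 < p.re) {ε : ℝ} (hε : 0 ≤ ε * p.im) (v : ι → ℂ) :
    0 ≤ ε * (qform (p • pencil Z₁ Z₀ p) v).im ∧ 0 ≤ -ε * (qform (p⁻¹ • pencil Z₁ Z₀ p) v).im := by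
  rcases eq_or_ne v 0 with rfl | hv
  · simp [qform_zero]
  have hp0 : p ≠ 0 := by rintro rfl; simp at hp
  obtain ⟨a, ha, ha'⟩ := exists_qform_eq_of_posDef h₁ hv
  obtain ⟨b, hb, hb'⟩ := exists_qform_eq_of_posDef h₀ hv
  have hn := Complex.normSq_pos.2 hp0
  rw [qform_smul, qform_smul, pencil, qform_add, qform_smul, qform_smul, ha', hb',
    mul_add, mul_add, ← mul_assoc, ← mul_assoc, ← mul_assoc, ← mul_assoc, mul_inv_cancel₀ hp0,
    inv_mul_cancel₀ hp0, one_mul, one_mul, Complex.add_im, Complex.add_im, Complex.im_mul_ofReal,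
    Complex.im_mul_ofReal, Complex.ofReal_im, Complex.ofReal_im, Complex.mul_im, Complex.mul_im,
    Complex.inv_re, Complex.inv_im]
  constructor
  · have : ε * ((p.re * p.im + p.im * p.re) * a + 0) = (ε * p.im) * (2 * p.re * a) := by ring
    rw [this]
    positivity
  · have : -ε * (0 + (p.re / Complex.normSq p * (-p.im / Complex.normSq p) +
        -p.im / Complex.normSq p * (p.re / Complex.normSq p)) * b) =
        (ε * p.im) * (2 * p.re * b / (Complex.normSq p * Complex.normSq p)) := by
      field_simp
      ring
    rw [this]
    positivity

lemma gpow_pencil_sector {r : ℝ} (hr : r ∈ Ioc (0 : ℝ) 1) {Z₁ Z₀ : Matrix ι ι ℂ} (h₁ : Z₁.PosDef)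
    (h₀ : Z₀.PosDef) {p : ℂ} (hp : 0 < p.re) {v : ι → ℂ} (hv : v ≠ 0) :
    qform (gpow r (pencil Z₁ Z₀ p)) v ≠ 0 ∧
      |(qform (gpow r (pencil Z₁ Z₀ p)) v).arg| ≤ r * |p.arg| := by
  have hacc : ∀ v ≠ 0, 0 < (qform (pencil Z₁ Z₀ p) v).re := fun v hv => pencil_accretive h₁ h₀ hp hv
  suffices hs : 0 < (qform (gpow r (pencil Z₁ Z₀ p)) v).re ∧ ∀ ε : ℝ, 0 ≤ ε * p.im →
      0 ≤ ε * (p ^ (r : ℂ) * qform (gpow r (pencil Z₁ Z₀ p)) v).im ∧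
        0 ≤ -ε * (p⁻¹ ^ (r : ℂ) * qform (gpow r (pencil Z₁ Z₀ p)) v).im from
    ⟨fun h => by simp [h] at hs, abs_arg_le_of_im_cpow_mul hr hp hs.1 hs.2⟩
  by_cases h1 : r = 1
  · simp only [gpow, if_pos h1]
    refine ⟨hacc v hv, fun ε hε => ?_⟩
    have := qform_smul_pencil_im h₁ h₀ hp hε v
    rw [qform_smul, qform_smul] at this
    simpa [h1] using this
  · have hr' : r ∈ Ioo (0 : ℝ) 1 := ⟨hr.1, lt_of_le_of_ne hr.2 h1⟩
    simp only [gpow, if_neg h1]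
    refine ⟨fpow_qform_re_pos hr' hacc hv, fun ε hε => ?_⟩
    have hsm : ∀ z : ℂ, 0 < z.re → fpow r (z • pencil Z₁ Z₀ p) =
        z ^ (r : ℂ) • fpow r (pencil Z₁ Z₀ p) := fun z hz =>
      fpow_smul hr' (U := {z : ℂ | 0 < z.re}) (isOpen_lt continuous_const Complex.continuous_re)
        (convex_halfSpace_re_gt 0).isPreconnected (by simp) (fun z hz => Or.inl hz)
        (fun z hz => slitSpec_smul_of_accretive hacc hz) hz
    have h2 := qform_smul_pencil_im h₁ h₀ hp hε
    have h3 := fpow_qform_im hr' (slitSpec_smul_of_accretive hacc hp) (fun v => (h2 v).1) v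
    have h4 := fpow_qform_im hr' (slitSpec_smul_of_accretive hacc (re_inv_pos hp))
      (fun v => (h2 v).2) v
    rw [hsm _ hp, qform_smul] at h3
    rw [hsm _ (re_inv_pos hp), qform_smul] at h4
    exact ⟨h3, h4⟩

end MatrixFractionalPower

section RootPower

open Set MeasureTheory Polynomial
open scoped Matrix.Norms.Operator

set_option linter.unusedSectionVars false

variable {ι : Type*} [Fintype ι] [DecidableEq ι]

/-- The trace of the `α`-th power of `M`, through the eigenvalues of `M`. -/
def rootPow (α : ℝ) (M : Matrix ι ι ℂ) : ℂ := (M.charpoly.roots.map fun μ => μ ^ (α : ℂ)).sum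

lemma card_roots_charpoly (M : Matrix ι ι ℂ) :
    Multiset.card M.charpoly.roots = Fintype.card ι := by
  rw [← (IsAlgClosed.splits M.charpoly).natDegree_eq_card_roots, charpoly_natDegree_eq_dim]

lemma det_smul_one_sub (M : Matrix ι ι ℂ) (w : ℂ) :
    (w • (1 : Matrix ι ι ℂ) - M).det = (M.charpoly.roots.map fun μ => w - μ).prod := by
  have h1 : M.charpoly = (M.charpoly.roots.map fun μ => X - C μ).prod :=
    (IsAlgClosed.splits M.charpoly).eq_prod_roots_of_monic M.charpoly_monic
  have h2 := eval_charpoly M w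
  rw [scalar_apply, ← smul_one_eq_diagonal] at h2
  rw [← h2]
  conv_lhs => rw [h1]
  rw [eval_multiset_prod, Multiset.map_map]
  simp

lemma exists_mulVec_eq_of_mem_roots {M : Matrix ι ι ℂ} {μ : ℂ} (hμ : μ ∈ M.charpoly.roots) :
    ∃ v ≠ 0, M *ᵥ v = μ • v := by
  have h1 : (μ • (1 : Matrix ι ι ℂ) - M).det = 0 := by
    rw [det_smul_one_sub]
    exact Multiset.prod_eq_zero (Multiset.mem_map.2 ⟨μ, hμ, sub_self μ⟩)
  obtain ⟨v, hv, hv0⟩ := exists_mulVec_eq_zero_iff.2 h1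
  refine ⟨v, hv, ?_⟩
  rw [sub_mulVec, smul_mulVec, one_mulVec, sub_eq_zero] at hv0
  exact hv0.symm

lemma mem_slitPlane_of_mem_roots {M : Matrix ι ι ℂ} (hM : SlitSpec M) {μ : ℂ}
    (hμ : μ ∈ M.charpoly.roots) : μ ∈ Complex.slitPlane := by
  by_contra hcon
  obtain ⟨v, hv, hMv⟩ := exists_mulVec_eq_of_mem_roots hμ
  rw [Complex.mem_slitPlane_iff] at hcon
  push Not at hcon
  have hμ' : μ = ((-(-μ.re) : ℝ) : ℂ) := by
    rw [neg_neg]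
    exact Complex.ext rfl hcon.2
  obtain ⟨u, hu⟩ := hM (-μ.re) (by linarith [hcon.1])
  have h0 : (M + algebraMap ℂ (Matrix ι ι ℂ) ((-μ.re : ℝ) : ℂ)) *ᵥ v = 0 := by
    rw [add_algebraMap_mulVec, hMv, ← add_smul]
    nth_rewrite 1 [hμ']
    push_cast
    simp
  refine hv ?_
  have : (u⁻¹ : (Matrix ι ι ℂ)ˣ).val *ᵥ ((u : Matrix ι ι ℂ) *ᵥ v) = v := by
    rw [mulVec_mulVec, Units.inv_mul, one_mulVec]
  rw [← this, hu, h0, mulVec_zero]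

lemma charpoly_inverse_add {M : Matrix ι ι ℂ} {c : ℂ}
    (h : IsUnit (M + algebraMap ℂ (Matrix ι ι ℂ) c)) :
    (Ring.inverse (M + algebraMap ℂ (Matrix ι ι ℂ) c)).charpoly =
      (M.charpoly.roots.map fun μ => X - C (μ + c)⁻¹).prod := by
  set R := Ring.inverse (M + algebraMap ℂ (Matrix ι ι ℂ) c) with hR
  have hdet : (M + algebraMap ℂ (Matrix ι ι ℂ) c).det =
      (M.charpoly.roots.map fun μ => μ + c).prod := by
    have h1 : M + algebraMap ℂ (Matrix ι ι ℂ) c = -((-c) • (1 : Matrix ι ι ℂ) - M) := by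
      rw [Algebra.algebraMap_eq_smul_one, neg_smul]; abel
    rw [h1, det_neg, det_smul_one_sub, ← card_roots_charpoly M, ← Multiset.prod_replicate,
      ← Multiset.map_const', ← Multiset.prod_map_mul]
    congr 2
    funext μ
    ring
  have hne : ∀ μ ∈ M.charpoly.roots, μ + c ≠ 0 := by
    intro μ hμ h0
    have h1 : (M + algebraMap ℂ (Matrix ι ι ℂ) c).det = 0 := by
      rw [hdet]
      exact Multiset.prod_eq_zero (Multiset.mem_map.2 ⟨μ, hμ, h0⟩)
    exact ((isUnit_iff_isUnit_det _).1 h).ne_zero h1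
  refine Polynomial.eq_of_infinite_eval_eq _ _ ?_
  refine Set.Infinite.mono (s := {z : ℂ | z ≠ 0}) ?_ (Set.finite_singleton (0 : ℂ)).infinite_compl
  intro z hz
  have hz : z ≠ 0 := hz
  rw [mem_ofPred_eq, eval_charpoly, scalar_apply, ← smul_one_eq_diagonal]
  have hd0 : (M + algebraMap ℂ (Matrix ι ι ℂ) c).det ≠ 0 :=
    ((isUnit_iff_isUnit_det _).1 h).ne_zero
  refine mul_right_cancel₀ hd0 ?_
  rw [← det_mul, sub_mul, hR, Ring.inverse_mul_cancel _ h, smul_mul_assoc, one_mul]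
  have h2 : z • (M + algebraMap ℂ (Matrix ι ι ℂ) c) - 1 =
      (-z) • ((z⁻¹ - c) • (1 : Matrix ι ι ℂ) - M) := by
    rw [Algebra.algebraMap_eq_smul_one, smul_sub, smul_smul, smul_add, smul_smul,
      show -z * (z⁻¹ - c) = z * c - 1 by field_simp; ring, sub_smul, one_smul, neg_smul]
    abel
  rw [h2, det_smul, det_smul_one_sub, ← card_roots_charpoly M, ← Multiset.prod_replicate,
    ← Multiset.map_const', ← Multiset.prod_map_mul, hdet, eval_multiset_prod, Multiset.map_map,
    ← Multiset.prod_map_mul]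
  congr 1
  refine Multiset.map_congr rfl fun μ hμ => ?_
  have := hne μ hμ
  simp only [Function.comp_apply, eval_sub, eval_X, eval_C]
  field_simp
  ring

lemma trace_mul_inverse_add {M : Matrix ι ι ℂ} {c : ℂ}
    (h : IsUnit (M + algebraMap ℂ (Matrix ι ι ℂ) c)) (hne : ∀ μ ∈ M.charpoly.roots, μ + c ≠ 0) :
    (M * Ring.inverse (M + algebraMap ℂ (Matrix ι ι ℂ) c)).trace =
      (M.charpoly.roots.map fun μ => μ * (μ + c)⁻¹).sum := by
  rw [mul_inverse_add h, trace_sub, trace_one, trace_smul, trace_eq_sum_roots_charpoly,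
    charpoly_inverse_add h]
  have h1 : (M.charpoly.roots.map fun μ => (X - C (μ + c)⁻¹ : ℂ[X])) =
      (M.charpoly.roots.map fun μ => (μ + c)⁻¹).map fun a => X - C a := by
    rw [Multiset.map_map]; rfl
  rw [h1, roots_multiset_prod_X_sub_C, ← card_roots_charpoly M, smul_eq_mul,
    ← Multiset.sum_map_mul_left]
  have h2 : ((Multiset.card M.charpoly.roots : ℕ) : ℂ) =
      (M.charpoly.roots.map fun _ => (1 : ℂ)).sum := by simp
  rw [h2, ← Multiset.sum_map_sub]
  congr 1
  refine Multiset.map_congr rfl fun μ hμ => ?_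
  have := hne μ hμ
  field_simp
  ring

lemma integral_multiset_fracInt {s : ℝ} (hs : s ∈ Ioo (0 : ℝ) 1) (m : Multiset ℂ)
    (hm : ∀ μ ∈ m, μ ∈ Complex.slitPlane) :
    IntegrableOn (fun t : ℝ => ((t ^ (s - 1) : ℝ) : ℂ) •
      (m.map fun μ => μ * (μ + (t : ℂ))⁻¹).sum) (Ioi 0) ∧
    ∫ t in Ioi (0 : ℝ), ((t ^ (s - 1) : ℝ) : ℂ) • (m.map fun μ => μ * (μ + (t : ℂ))⁻¹).sum =
      (m.map fun μ => fracInt s μ).sum := by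
  induction m using Multiset.induction_on with
  | empty => simp
  | cons μ m ih =>
    obtain ⟨h1, h2⟩ := ih fun ν hν => hm ν (Multiset.mem_cons_of_mem hν)
    have h3 := integrableOn_fracInt hs (slitSpec_complex (hm μ (Multiset.mem_cons_self μ m)))
    simp only [Ring.inverse_eq_inv', Algebra.algebraMap_self, RingHom.id_apply] at h3
    simp only [Multiset.map_cons, Multiset.sum_cons, smul_add]
    refine ⟨h3.add h1, ?_⟩
    rw [integral_add h3 h1, h2, fracInt]
    simp

/-- The trace as a continuous functional. -/
def traceCLM : Matrix ι ι ℂ →L[ℂ] ℂ :=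
  LinearMap.toContinuousLinearMap (Matrix.traceLinearMap ι ℂ ℂ)

lemma trace_fpow {s : ℝ} (hs : s ∈ Ioo (0 : ℝ) 1) {M : Matrix ι ι ℂ} (hM : SlitSpec M) :
    traceCLM (fpow s M) = rootPow s M := by
  have hmem : ∀ μ ∈ M.charpoly.roots, μ ∈ Complex.slitPlane := fun μ hμ =>
    mem_slitPlane_of_mem_roots hM hμ
  have e1 : traceCLM (fracInt s M) = ∫ t in Ioi (0 : ℝ), ((t ^ (s - 1) : ℝ) : ℂ) •
      traceCLM (M * Ring.inverse (M + algebraMap ℂ (Matrix ι ι ℂ) (t : ℂ))) :=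
    map_fracInt hs hM traceCLM
  have e2 : ∀ t ∈ Ioi (0 : ℝ), ((t ^ (s - 1) : ℝ) : ℂ) •
      traceCLM (M * Ring.inverse (M + algebraMap ℂ (Matrix ι ι ℂ) (t : ℂ))) =
      ((t ^ (s - 1) : ℝ) : ℂ) • (M.charpoly.roots.map fun μ => μ * (μ + (t : ℂ))⁻¹).sum :=
    fun t ht => by
      congr 1
      refine trace_mul_inverse_add (hM t (le_of_lt ht)) fun μ hμ => ?_
      simpa using (slitSpec_complex (hmem μ hμ) t (le_of_lt ht)).ne_zero
  rw [setIntegral_congr_fun measurableSet_Ioi e2, (integral_multiset_fracInt hs _ hmem).2] at e1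
  rw [fpow, map_smul, e1, rootPow, smul_eq_mul, ← Multiset.sum_map_mul_left]
  congr 1
  refine Multiset.map_congr rfl fun μ hμ => ?_
  rw [← fpow_complex hs (hmem μ hμ), fpow, smul_eq_mul]

lemma differentiableOn_rootPow {s : ℝ} (hs : s ∈ Ioo (0 : ℝ) 1) {U : Set ℂ} (hU : IsOpen U)
    {M : ℂ → Matrix ι ι ℂ} (hMd : DifferentiableOn ℂ M U) (hM : ∀ p ∈ U, SlitSpec (M p)) :
    DifferentiableOn ℂ (fun p => rootPow s (M p)) U := by
  have h := differentiableOn_fpow hs hU hMd hM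
  refine DifferentiableOn.congr (f := fun p => traceCLM (fpow s (M p))) (fun p hp => ?_)
    fun p hp => (trace_fpow hs (hM p hp)).symm
  exact (ContinuousLinearMap.differentiableAt traceCLM).comp_differentiableWithinAt p (h p hp)

lemma rootPow_congr (α : ℝ) {κ : Type*} [Fintype κ] [DecidableEq κ] {M : Matrix ι ι ℂ}
    {N : Matrix κ κ ℂ} (h : M.charpoly = N.charpoly) : rootPow α M = rootPow α N := by
  rw [rootPow, h, rootPow]

/-- Eigenvalues of a product of two sectorial matrices. -/
lemma eigenvalue_sector {G N : Matrix ι ι ℂ} {p : ℂ} {α r : ℝ} (hα : 1 / 2 ≤ α)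
    (hr : α * (1 + r) = 1) (hp : 0 < p.re)
    (hG : ∀ v ≠ 0, qform G v ≠ 0 ∧ |(qform G v).arg| ≤ |p.arg|)
    (hN : ∀ v ≠ 0, qform N v ≠ 0 ∧ |(qform N v).arg| ≤ r * |p.arg|)
    {v : ι → ℂ} (hv : v ≠ 0) {μ : ℂ} (hμ : (G * N) *ᵥ v = μ • v) :
    μ ∈ Complex.slitPlane ∧ ∀ ε : ℝ, 0 ≤ ε * p.im → 0 ≤ ε * (p * μ ^ (α : ℂ)).im := by
  obtain ⟨hκ, hκa⟩ := hN v hv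
  set y := N *ᵥ v with hy
  have hy0 : y ≠ 0 := by
    intro h0
    apply hκ
    rw [qform, ← hy, h0, dotProduct_zero]
  obtain ⟨hg, hga⟩ := hG y hy0
  have h1 : qform G y = μ * star (qform N v) := by
    rw [qform, hy, mulVec_mulVec, hμ, dotProduct_smul, smul_eq_mul, qform, star_dotProduct]
  have h2 : μ = qform G y / star (qform N v) := by
    rw [h1, mul_div_cancel_right₀]
    exact star_ne_zero.2 hκ
  rw [h2]
  exact mem_slitPlane_and_im_mul_cpow hα hr hp hg hκ hga hκa

end RootPower

section PsiS

open Set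

lemma mpow_smul {n : ℕ} {A : Matrix (Fin n) (Fin n) ℂ} (hA : A.PosSemidef) (p : ℝ) {c : ℝ}
    (hc : 0 ≤ c) : mpow (c • A) p = c ^ p • mpow A p := by
  have hfin : (spectrum ℝ A).Finite := Matrix.finite_real_spectrum
  have hfin' : (spectrum ℝ (c • A)).Finite := Matrix.finite_real_spectrum
  have hsa : IsSelfAdjoint A := hA.1
  rw [mpow, ← cfc_comp_smul c (fun x : ℝ => x ^ p) A ((hfin.image _).continuousOn _) hsa, mpow,
    ← cfc_smul (c ^ p) (fun x : ℝ => x ^ p) A (hfin.continuousOn _)]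
  refine cfc_congr fun x hx => ?_
  have hx0 : 0 ≤ x := by
    simpa using (Matrix.posSemidef_iff_isHermitian_and_spectrum_nonneg.1 hA).2
      (spectrum.algebraMap_mem ℂ hx)
  simp only [smul_eq_mul]
  rw [Real.mul_rpow hc hx0]

lemma mpow_posSemidef {n : ℕ} {A : Matrix (Fin n) (Fin n) ℂ} (hA : A.PosSemidef) (p : ℝ) :
    (mpow A p).PosSemidef := by
  obtain ⟨U, hU, -, h2⟩ := exists_diagonalization_mpow hA.1
  rw [h2]
  refine PosSemidef.mul_mul_conjTranspose_same (PosSemidef.diagonal fun i => ?_) U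
  change (0 : ℂ) ≤ _
  exact_mod_cast Real.rpow_nonneg (hA.eigenvalues_nonneg i) p

lemma mpow_half_mul_self {n : ℕ} {A : Matrix (Fin n) (Fin n) ℂ} (hA : A.PosSemidef) :
    mpow A (1 / 2) * mpow A (1 / 2) = A := by
  obtain ⟨U, hU, h1, h2⟩ := exists_diagonalization_mpow hA.1
  rw [h2]
  conv_rhs => rw [h1]
  rw [show ∀ D : Matrix (Fin n) (Fin n) ℂ, U * D * Uᴴ * (U * D * Uᴴ) = U * (D * (Uᴴ * U) * D) * Uᴴ
    from fun D => by simp only [Matrix.mul_assoc], hU, Matrix.mul_one, diagonal_mul_diagonal]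
  congr 3
  funext i
  rw [← Complex.ofReal_mul, ← Real.rpow_add_of_nonneg (hA.eigenvalues_nonneg i)] <;> norm_num

variable {n k : ℕ} {α : ℝ} {S : Matrix (Fin n) (Fin k) ℂ} {G : Matrix (Fin k) (Fin k) ℂ}
  {Z : Matrix (Fin n) (Fin n) ℂ}

lemma PsiS_core_posSemidef (S : Matrix (Fin n) (Fin k) ℂ) (r : ℝ) (hG : G.PosSemidef)
    (hZ : Z.PosSemidef) :
    (mpow G (1 / 2) * Sᴴ * mpow Z r * S * mpow G (1 / 2)).PosSemidef := by
  have h := (mpow_posSemidef hZ r).conjTranspose_mul_mul_same (S * mpow G (1 / 2))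
  rwa [conjTranspose_mul, (mpow_posSemidef hG (1 / 2)).1.eq, ← Matrix.mul_assoc] at h

lemma PsiS_nonneg (α : ℝ) (S : Matrix (Fin n) (Fin k) ℂ) (hG : G.PosSemidef)
    (hZ : Z.PosSemidef) : 0 ≤ PsiS α S G Z :=
  (Complex.le_def.1 (mpow_posSemidef (PsiS_core_posSemidef S _ hG hZ) α).trace_nonneg).1

lemma ofReal_PsiS (α : ℝ) (S : Matrix (Fin n) (Fin k) ℂ) (hG : G.PosSemidef)
    (hZ : Z.PosSemidef) :
    (PsiS α S G Z : ℂ) = rootPow α (G * (Sᴴ * mpow Z ((1 - α) / α) * S)) := by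
  have hB := PsiS_core_posSemidef S ((1 - α) / α) hG hZ
  have h1 : rootPow α (G * (Sᴴ * mpow Z ((1 - α) / α) * S)) =
      rootPow α (mpow G (1 / 2) * Sᴴ * mpow Z ((1 - α) / α) * S * mpow G (1 / 2)) := by
    refine rootPow_congr α ?_
    conv_lhs => rw [← mpow_half_mul_self hG, Matrix.mul_assoc, charpoly_mul_comm]
    simp only [Matrix.mul_assoc]
  have h2 : (mpow (mpow G (1 / 2) * Sᴴ * mpow Z ((1 - α) / α) * S * mpow G (1 / 2)) α).trace =
      rootPow α (mpow G (1 / 2) * Sᴴ * mpow Z ((1 - α) / α) * S * mpow G (1 / 2)) := by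
    rw [trace_eq_sum_roots_charpoly, charpoly_roots_mpow hB.1, rootPow,
      hB.1.roots_charpoly_eq_eigenvalues, Multiset.map_map]
    congr 1
    refine Multiset.map_congr rfl fun i _ => ?_
    rw [Complex.ofReal_cpow (hB.eigenvalues_nonneg i)]
    rfl
  rw [h1, ← h2, PsiS]
  exact Complex.ext rfl (Complex.le_def.1 (mpow_posSemidef hB α).trace_nonneg).2

lemma PsiS_smul (hα : 0 < α) (S : Matrix (Fin n) (Fin k) ℂ) (hG : G.PosSemidef)
    (hZ : Z.PosSemidef) {c : ℝ} (hc : 0 < c) :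
    PsiS α S (c • G) (c • Z) = c * PsiS α S G Z := by
  rw [PsiS, mpow_smul hG _ hc.le, mpow_smul hZ _ hc.le]
  have h1 : c ^ (1 / 2 : ℝ) • mpow G (1 / 2) * Sᴴ * c ^ ((1 - α) / α) • mpow Z ((1 - α) / α) * S *
      c ^ (1 / 2 : ℝ) • mpow G (1 / 2) =
      c ^ (1 / α) • (mpow G (1 / 2) * Sᴴ * mpow Z ((1 - α) / α) * S * mpow G (1 / 2)) := by
    simp only [Matrix.smul_mul, Matrix.mul_smul, smul_smul]
    congr 1
    rw [← Real.rpow_add hc, ← Real.rpow_add hc]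
    congr 1
    field_simp
    ring
  rw [h1, mpow_smul (PsiS_core_posSemidef S _ hG hZ) _ (Real.rpow_nonneg hc.le _),
    ← Real.rpow_mul hc.le, one_div_mul_cancel hα.ne', Real.rpow_one, trace_smul, PsiS,
    Complex.smul_re, smul_eq_mul]

end PsiS

section PencilProduct

open Set
open scoped Matrix.Norms.Operator

set_option linter.unusedSectionVars false

variable {n k : ℕ} {α : ℝ} {S : Matrix (Fin n) (Fin k) ℂ} {G₁ G₀ : Matrix (Fin k) (Fin k) ℂ}
  {Z₁ Z₀ : Matrix (Fin n) (Fin n) ℂ}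

lemma exponent_mem_Ioc (hα : α ∈ Ico (1 / 2 : ℝ) 1) : (1 - α) / α ∈ Ioc (0 : ℝ) 1 := by
  have h0 : 0 < α := by linarith [hα.1]
  refine ⟨div_pos (by linarith [hα.2]) h0, ?_⟩
  rw [div_le_one h0]
  linarith [hα.1]

/-- The product `G (Sᴴ Z ^ r S)` along pencils. -/
def pencilProd (r : ℝ) (S : Matrix (Fin n) (Fin k) ℂ) (G₁ G₀ : Matrix (Fin k) (Fin k) ℂ)
    (Z₁ Z₀ : Matrix (Fin n) (Fin n) ℂ) (p : ℂ) : Matrix (Fin k) (Fin k) ℂ :=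
  pencil G₁ G₀ p * (Sᴴ * gpow r (pencil Z₁ Z₀ p) * S)

lemma mulVec_ne_zero_of_isometry (hS : Sᴴ * S = 1) {v : Fin k → ℂ} (hv : v ≠ 0) : S *ᵥ v ≠ 0 := by
  intro h
  apply hv
  rw [← one_mulVec v, ← hS, ← mulVec_mulVec, h, mulVec_zero]

lemma qform_conjTranspose_mul_mul (S : Matrix (Fin n) (Fin k) ℂ) (K : Matrix (Fin n) (Fin n) ℂ)
    (v : Fin k → ℂ) : qform (Sᴴ * K * S) v = qform K (S *ᵥ v) := by
  rw [qform, qform, star_mulVec, ← mulVec_mulVec, ← mulVec_mulVec, dotProduct_mulVec]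

lemma pencilProd_eigenvalue (hα : α ∈ Ico (1 / 2 : ℝ) 1) (hS : Sᴴ * S = 1) (hG₁ : G₁.PosDef)
    (hG₀ : G₀.PosDef) (hZ₁ : Z₁.PosDef) (hZ₀ : Z₀.PosDef) {p : ℂ} (hp : 0 < p.re)
    {v : Fin k → ℂ} (hv : v ≠ 0) {μ : ℂ}
    (hμ : pencilProd ((1 - α) / α) S G₁ G₀ Z₁ Z₀ p *ᵥ v = μ • v) :
    μ ∈ Complex.slitPlane ∧ ∀ ε : ℝ, 0 ≤ ε * p.im → 0 ≤ ε * (p * μ ^ (α : ℂ)).im := by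
  have h0 : 0 < α := by linarith [hα.1]
  refine eigenvalue_sector hα.1 (r := (1 - α) / α) (by field_simp; ring) hp (fun v hv => ?_)
    (fun v hv => ?_) hv hμ
  · simpa [gpow] using gpow_pencil_sector (r := 1) (by simp) hG₁ hG₀ hp hv
  · rw [qform_conjTranspose_mul_mul]
    exact gpow_pencil_sector (exponent_mem_Ioc hα) hZ₁ hZ₀ hp (mulVec_ne_zero_of_isometry hS hv)

lemma differentiableOn_pencilProd (hα : α ∈ Ico (1 / 2 : ℝ) 1) (S : Matrix (Fin n) (Fin k) ℂ)
    (G₁ G₀ : Matrix (Fin k) (Fin k) ℂ) (hZ₁ : Z₁.PosDef) (hZ₀ : Z₀.PosDef) :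
    DifferentiableOn ℂ (pencilProd ((1 - α) / α) S G₁ G₀ Z₁ Z₀) {p | 0 < p.re} := by
  have h1 := differentiableOn_gpow (exponent_mem_Ioc hα)
    (isOpen_lt continuous_const Complex.continuous_re) (differentiableOn_pencil Z₁ Z₀)
    fun p hp => slitSpec_of_accretive fun v hv => pencil_accretive hZ₁ hZ₀ hp hv
  let L : Matrix (Fin n) (Fin n) ℂ →L[ℂ] Matrix (Fin k) (Fin k) ℂ :=
    LinearMap.toContinuousLinearMap
      { toFun := fun K => Sᴴ * K * S
        map_add' := fun K K' => by rw [Matrix.mul_add, Matrix.add_mul]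
        map_smul' := fun c K => by simp }
  intro p hp
  exact (differentiableOn_pencil G₁ G₀ p hp).mul
    (L.differentiableAt.comp_differentiableWithinAt p (h1 p hp))

lemma exists_holomorphic_extension (hα : α ∈ Ico (1 / 2 : ℝ) 1) (hS : Sᴴ * S = 1)
    (hG₁ : G₁.PosDef) (hG₀ : G₀.PosDef) (hZ₁ : Z₁.PosDef) (hZ₀ : Z₀.PosDef) :
    ∃ Q : ℂ → ℂ, DifferentiableOn ℂ Q {p | 0 < p.re} ∧
      (∀ p : ℂ, 0 < p.re → ∀ ε : ℝ, 0 ≤ ε * p.im → 0 ≤ ε * (Q p).im) ∧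
      ∀ x : ℝ, 0 < x → Q x = ((x * PsiS α S (x • G₁ + x⁻¹ • G₀) (x • Z₁ + x⁻¹ • Z₀) : ℝ) : ℂ) := by
  have hα' : α ∈ Ioo (0 : ℝ) 1 := ⟨by linarith [hα.1], hα.2⟩
  have hslit : ∀ p : ℂ, 0 < p.re → SlitSpec (pencilProd ((1 - α) / α) S G₁ G₀ Z₁ Z₀ p) :=
    fun p hp => slitSpec_of_mulVec_ne fun v hv μ hμ =>
      (pencilProd_eigenvalue hα hS hG₁ hG₀ hZ₁ hZ₀ hp hv hμ).1
  refine ⟨fun p => p * rootPow α (pencilProd ((1 - α) / α) S G₁ G₀ Z₁ Z₀ p), ?_, ?_, ?_⟩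
  · exact differentiableOn_id.mul (differentiableOn_rootPow hα'
      (isOpen_lt continuous_const Complex.continuous_re)
      (differentiableOn_pencilProd hα S G₁ G₀ hZ₁ hZ₀) hslit)
  · intro p hp ε hε
    beta_reduce
    rw [rootPow, ← Multiset.sum_map_mul_left]
    have key : ∀ m : Multiset ℂ, (∀ μ ∈ m, 0 ≤ ε * (p * μ ^ (α : ℂ)).im) →
        0 ≤ ε * ((m.map fun μ => p * μ ^ (α : ℂ)).sum).im := by
      intro m
      induction m using Multiset.induction_on with
      | empty => simp
      | cons μ m ih =>
        intro h
        rw [Multiset.map_cons, Multiset.sum_cons, Complex.add_im, mul_add]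
        exact add_nonneg (h μ (Multiset.mem_cons_self μ m))
          (ih fun ν hν => h ν (Multiset.mem_cons_of_mem hν))
    refine key _ fun μ hμ => ?_
    obtain ⟨v, hv, hμv⟩ := exists_mulVec_eq_of_mem_roots hμ
    exact (pencilProd_eigenvalue hα hS hG₁ hG₀ hZ₁ hZ₀ hp hv hμv).2 ε hε
  · intro x hx
    have hpen : ∀ {l : ℕ} (X Y : Matrix (Fin l) (Fin l) ℂ),
        pencil X Y (x : ℂ) = x • X + x⁻¹ • Y := by
      intro l X Y
      rw [pencil, ← Complex.ofReal_inv, Complex.coe_smul, Complex.coe_smul]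
    have hpd : ∀ {l : ℕ} {X Y : Matrix (Fin l) (Fin l) ℂ}, X.PosDef → Y.PosDef →
        (x • X + x⁻¹ • Y).PosDef := fun hX hY =>
      (hX.smul hx).add (hY.smul (inv_pos.2 hx))
    beta_reduce
    rw [Complex.ofReal_mul, ofReal_PsiS α S (hpd hG₁ hG₀).posSemidef (hpd hZ₁ hZ₀).posSemidef,
      pencilProd, hpen, hpen, gpow_eq_mpow (exponent_mem_Ioc hα) (hpd hZ₁ hZ₀)]

end PencilProduct

section TypicallyReal

open Set MeasureTheory Metric Asymptotics Filter Topology Real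

lemma continuous_comp_circleMap {q : ℂ → ℂ} (hq : DifferentiableOn ℂ q (ball 0 1)) {ρ : ℝ}
    (hρ : ρ ∈ Ioo (0 : ℝ) 1) : Continuous fun θ : ℝ => q (circleMap 0 ρ θ) := by
  refine hq.continuousOn.comp_continuous (continuous_circleMap 0 ρ) fun θ => ?_
  rw [mem_ball_zero_iff, norm_circleMap_zero, abs_of_pos hρ.1]
  exact hρ.2

lemma integral_im_mul_sin {q : ℂ → ℂ} (hq : DifferentiableOn ℂ q (ball 0 1)) {ρ : ℝ}
    (hρ : ρ ∈ Ioo (0 : ℝ) 1) (m : ℕ) :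
    ∫ θ in (0 : ℝ)..2 * π, (q (circleMap 0 ρ θ)).im * sin ((m + 1 : ℕ) * θ) =
      π * (ρ ^ (m + 1) * (iteratedDeriv (m + 1) q 0 / (m + 1).factorial).re) := by
  have hsub : closedBall (0 : ℂ) ρ ⊆ ball 0 1 := closedBall_subset_ball hρ.2
  have hqc := hq.mono hsub
  have h1 := hqc.circleIntegral_one_div_sub_center_pow_smul hρ.1 (m + 1)
  have h2 : (∮ z in C((0 : ℂ), ρ), z ^ m * q z) = 0 :=
    Complex.circleIntegral_eq_zero_of_differentiable_on_off_countable hρ.1.le countable_empty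
      ((continuous_pow m).continuousOn.mul hqc.continuousOn) fun z hz =>
      (differentiableAt_pow m).mul (hq.differentiableAt
        (isOpen_ball.mem_nhds (hsub (ball_subset_closedBall hz.1))))
  have hρ0 : (ρ : ℂ) ≠ 0 := by exact_mod_cast hρ.1.ne'
  have hcont := continuous_comp_circleMap hq hρ
  have hexp : ∀ (θ : ℝ) (j : ℕ), circleMap 0 ρ θ ^ j = ρ ^ j * Complex.exp (j * θ * Complex.I) := by
    intro θ j
    rw [circleMap_zero, mul_pow, ← Complex.exp_nat_mul, mul_assoc]
  have hne : ∀ θ : ℝ, circleMap 0 ρ θ ≠ 0 := fun θ => circleMap_ne_center hρ.1.ne'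
  have hcm := continuous_circleMap 0 ρ
  have i1 : IntervalIntegrable (fun θ : ℝ => (circleMap 0 ρ θ * Complex.I) *
      ((circleMap 0 ρ θ ^ (m + 2))⁻¹ * q (circleMap 0 ρ θ))) volume 0 (2 * π) := by
    refine Continuous.intervalIntegrable ?_ _ _
    exact (hcm.mul continuous_const).mul (((hcm.pow _).inv₀ fun θ => pow_ne_zero _ (hne θ)).mul hcont)
  have i2 : IntervalIntegrable (fun θ : ℝ => (circleMap 0 ρ θ * Complex.I) *
      (circleMap 0 ρ θ ^ m * q (circleMap 0 ρ θ))) volume 0 (2 * π) := by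
    refine Continuous.intervalIntegrable ?_ _ _
    exact (hcm.mul continuous_const).mul ((hcm.pow _).mul hcont)
  simp only [circleIntegral, deriv_circleMap, sub_zero, one_div, smul_eq_mul] at h1 h2
  have h3 : ∫ θ in (0 : ℝ)..2 * π, 2 * (q (circleMap 0 ρ θ) * ((sin ((m + 1 : ℕ) * θ) : ℝ) : ℂ)) =
      (ρ : ℂ) ^ (m + 1) *
        (2 * π * Complex.I / ((m + 1).factorial : ℂ) * iteratedDeriv (m + 1) q 0) := by
    have h0 : ((ρ : ℂ) ^ (m + 1))⁻¹ * ∫ θ in (0 : ℝ)..2 * π, (circleMap 0 ρ θ * Complex.I) *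
      (circleMap 0 ρ θ ^ m * q (circleMap 0 ρ θ)) = 0 := by rw [h2, mul_zero]
    have hsub0 : ∀ {A B C : ℂ}, B = 0 → C = A - B → C = A := fun hB hC => by rw [hC, hB, sub_zero]
    rw [← h1]
    refine hsub0 h0 ?_
    rw [← intervalIntegral.integral_const_mul, ← intervalIntegral.integral_const_mul,
      ← intervalIntegral.integral_sub (i1.const_mul _) (i2.const_mul _)]
    refine intervalIntegral.integral_congr fun θ _ => ?_
    have e1 : (ρ : ℂ) ^ (m + 1) * (circleMap 0 ρ θ * Complex.I *
        ((circleMap 0 ρ θ ^ (m + 2))⁻¹ * q (circleMap 0 ρ θ))) = Complex.I * q (circleMap 0 ρ θ) *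
        (ρ ^ (m + 1) * (circleMap 0 ρ θ ^ (m + 1))⁻¹) := by
      have := hne θ
      field_simp
      ring
    have e2 : ((ρ : ℂ) ^ (m + 1))⁻¹ * (circleMap 0 ρ θ * Complex.I *
        (circleMap 0 ρ θ ^ m * q (circleMap 0 ρ θ))) = Complex.I * q (circleMap 0 ρ θ) *
        (((ρ : ℂ) ^ (m + 1))⁻¹ * (circleMap 0 ρ θ ^ (m + 1))) := by ring
    rw [e1, e2, hexp, mul_inv, ← mul_assoc ((ρ : ℂ) ^ (m + 1)), mul_inv_cancel₀ (pow_ne_zero _ hρ0),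
      ← mul_assoc (((ρ : ℂ) ^ (m + 1))⁻¹), inv_mul_cancel₀ (pow_ne_zero _ hρ0), one_mul, one_mul,
      ← Complex.exp_neg, Complex.ofReal_sin, Complex.sin]
    push_cast
    rw [neg_mul]
    ring
  have i3 : IntervalIntegrable (fun θ : ℝ =>
      q (circleMap 0 ρ θ) * ((sin ((m + 1 : ℕ) * θ) : ℝ) : ℂ)) volume 0 (2 * π) := by
    refine Continuous.intervalIntegrable (hcont.mul ?_) _ _
    fun_prop
  rw [intervalIntegral.integral_const_mul] at h3
  have h4 : ∫ θ in (0 : ℝ)..2 * π, q (circleMap 0 ρ θ) * ((sin ((m + 1 : ℕ) * θ) : ℝ) : ℂ) =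
      Complex.I * ((π * ρ ^ (m + 1) : ℝ) *
        (iteratedDeriv (m + 1) q 0 / ((m + 1).factorial : ℂ))) := by
    refine mul_left_cancel₀ (two_ne_zero (α := ℂ)) ?_
    rw [h3]
    push_cast
    ring
  have h5 := congrArg Complex.imCLM h4
  rw [← ContinuousLinearMap.intervalIntegral_comp_comm _ i3] at h5
  simp only [Complex.imCLM_apply, Complex.im_mul_ofReal, Complex.I_mul_im, Complex.re_ofReal_mul]
    at h5
  rw [h5, mul_assoc]

/-- Positivity of trigonometric moments of a typically real function. -/
lemma moment_nonneg {q : ℂ → ℂ} (hq : DifferentiableOn ℂ q (ball 0 1))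
    (him : ∀ ω ∈ ball (0 : ℂ) 1, 0 ≤ ω.im * (q ω).im) {a₁ a₂ a₃ : ℝ}
    (ha : ∀ θ : ℝ, ∃ κ : ℝ, 0 ≤ κ ∧
      a₁ * sin θ + a₂ * sin (2 * θ) + a₃ * sin (3 * θ) = sin θ * κ) :
    0 ≤ a₁ * (iteratedDeriv 1 q 0 / (Nat.factorial 1)).re +
      a₂ * (iteratedDeriv 2 q 0 / (Nat.factorial 2)).re +
      a₃ * (iteratedDeriv 3 q 0 / (Nat.factorial 3)).re := by
  set c : ℕ → ℝ := fun m => (iteratedDeriv m q 0 / (m.factorial : ℂ)).re with hc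
  change 0 ≤ a₁ * c 1 + a₂ * c 2 + a₃ * c 3
  have key : ∀ ρ ∈ Ioo (0 : ℝ) 1, 0 ≤ a₁ * (ρ ^ 1 * c 1) + a₂ * (ρ ^ 2 * c 2) +
      a₃ * (ρ ^ 3 * c 3) := by
    intro ρ hρ
    have hcont : Continuous fun θ : ℝ => (q (circleMap 0 ρ θ)).im :=
      Complex.continuous_im.comp (continuous_comp_circleMap hq hρ)
    have hintg : ∀ j : ℕ, IntervalIntegrable (fun θ : ℝ =>
        (q (circleMap 0 ρ θ)).im * sin ((j : ℕ) * θ)) volume 0 (2 * π) := fun j =>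
      (hcont.mul (by fun_prop)).intervalIntegrable _ _
    have h1 := integral_im_mul_sin hq hρ 0
    have h2 := integral_im_mul_sin hq hρ 1
    have h3 := integral_im_mul_sin hq hρ 2
    have h4 : ∫ θ in (0 : ℝ)..2 * π, (a₁ * ((q (circleMap 0 ρ θ)).im * sin ((0 + 1 : ℕ) * θ)) +
        a₂ * ((q (circleMap 0 ρ θ)).im * sin ((1 + 1 : ℕ) * θ)) +
        a₃ * ((q (circleMap 0 ρ θ)).im * sin ((2 + 1 : ℕ) * θ))) =
        π * (a₁ * (ρ ^ 1 * c 1) + a₂ * (ρ ^ 2 * c 2) + a₃ * (ρ ^ 3 * c 3)) := by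
      rw [intervalIntegral.integral_add (((hintg _).const_mul _).add ((hintg _).const_mul _))
        ((hintg _).const_mul _), intervalIntegral.integral_add ((hintg _).const_mul _)
        ((hintg _).const_mul _), intervalIntegral.integral_const_mul,
        intervalIntegral.integral_const_mul, intervalIntegral.integral_const_mul, h1, h2, h3]
      simp only [hc]
      ring
    have h5 : 0 ≤ π * (a₁ * (ρ ^ 1 * c 1) + a₂ * (ρ ^ 2 * c 2) + a₃ * (ρ ^ 3 * c 3)) := by
      rw [← h4]
      refine intervalIntegral.integral_nonneg (by positivity) fun θ _ => ?_
      obtain ⟨κ, hκ, hκ'⟩ := ha θ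
      have h6 := him (circleMap 0 ρ θ) (by
        rw [mem_ball_zero_iff, norm_circleMap_zero, abs_of_pos hρ.1]
        exact hρ.2)
      have h7 : (circleMap 0 ρ θ).im = ρ * sin θ := by
        rw [circleMap_zero, Complex.im_ofReal_mul, Complex.exp_ofReal_mul_I_im]
      rw [h7, mul_assoc] at h6
      have h8 := nonneg_of_mul_nonneg_right h6 hρ.1
      calc (0 : ℝ) ≤ (sin θ * (q (circleMap 0 ρ θ)).im) * κ := mul_nonneg h8 hκ
        _ = (q (circleMap 0 ρ θ)).im * (a₁ * sin θ + a₂ * sin (2 * θ) + a₃ * sin (3 * θ)) := by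
          rw [hκ']; ring
        _ = _ := by push_cast; ring_nf
    exact nonneg_of_mul_nonneg_right h5 pi_pos
  have hlim : Tendsto (fun ρ : ℝ => a₁ * (ρ ^ 1 * c 1) + a₂ * (ρ ^ 2 * c 2) +
      a₃ * (ρ ^ 3 * c 3)) (𝓝[<] 1) (𝓝 (a₁ * (1 ^ 1 * c 1) + a₂ * (1 ^ 2 * c 2) +
      a₃ * (1 ^ 3 * c 3))) := by
    refine Tendsto.mono_left (Continuous.tendsto ?_ 1) nhdsWithin_le_nhds
    fun_prop
  have h := ge_of_tendsto hlim (eventually_of_mem (Ioo_mem_nhdsLT zero_lt_one) key)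
  simpa using h

/-- Coefficient inequalities for typically real functions. -/
lemma typically_real_expansion {q : ℂ → ℂ} (hq : DifferentiableOn ℂ q (ball 0 1))
    (him : ∀ ω ∈ ball (0 : ℂ) 1, 0 ≤ ω.im * (q ω).im) :
    ∃ b : ℕ → ℝ, (fun x : ℝ => (q x).re - (b 0 + b 1 * x + b 2 * x ^ 2 + b 3 * x ^ 3))
        =o[𝓝 0] (fun x => x ^ 3) ∧
      b 2 ≤ 2 * b 1 ∧ |b 3 - 2 * b 2 + b 1| ≤ 2 * (2 * b 1 - b 2) := by
  refine ⟨fun m => (iteratedDeriv m q 0 / (m.factorial : ℂ)).re, ?_, ?_, ?_⟩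
  · have han : AnalyticAt ℂ q 0 := hq.analyticAt (ball_mem_nhds 0 one_pos)
    have h1 := han.hasFPowerSeriesAt.isBigO_sub_partialSum_pow 4
    have h2 : Tendsto (fun x : ℝ => (x : ℂ)) (𝓝 0) (𝓝 0) := by
      simpa using Complex.continuous_ofReal.tendsto 0
    have h3 := h1.comp_tendsto h2
    have h4 : (fun x : ℝ => (x : ℝ) ^ 4) =o[𝓝 0] fun x : ℝ => x ^ 3 :=
      isLittleO_pow_pow (by norm_num)
    have h5 : (fun x : ℝ => ‖(x : ℂ)‖ ^ 4) =o[𝓝 0] fun x : ℝ => x ^ 3 := by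
      simpa using h4.norm_left
    refine IsBigO.trans_isLittleO (IsBigO.of_bound 1 (Eventually.of_forall fun x => ?_))
      (h3.trans_isLittleO h5)
    rw [one_mul]
    refine le_trans (le_of_eq ?_) (Complex.abs_re_le_norm _)
    rw [Real.norm_eq_abs]
    congr 1
    simp only [Function.comp_apply, zero_add, FormalMultilinearSeries.partialSum,
      FormalMultilinearSeries.ofScalars_apply_eq, Finset.sum_range_succ, Finset.sum_range_zero,
      Complex.sub_re, Complex.add_re, smul_eq_mul, ← Complex.ofReal_pow, Complex.re_mul_ofReal]
    simp
  · have h := moment_nonneg hq him (a₁ := 2) (a₂ := -1) (a₃ := 0) fun θ =>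
      ⟨2 * (1 - cos θ), by linarith [cos_le_one θ], by rw [sin_two_mul]; ring⟩
    beta_reduce
    linarith
  · have h1 := moment_nonneg hq him (a₁ := 3) (a₂ := 0) (a₃ := -1) fun θ =>
      ⟨4 * (1 - cos θ ^ 2), by nlinarith [cos_sq_le_one θ], by
        rw [sin_three_mul, show 1 - cos θ ^ 2 = sin θ ^ 2 by rw [sin_sq]]; ring⟩
    have h2 := moment_nonneg hq him (a₁ := 5) (a₂ := -4) (a₃ := 1) fun θ =>
      ⟨4 * (1 - cos θ) ^ 2, by positivity, by
        rw [sin_three_mul, sin_two_mul, show sin θ ^ 3 = sin θ * sin θ ^ 2 by ring, sin_sq]; ring⟩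
    beta_reduce
    rw [abs_le]
    constructor <;> linarith

end TypicallyReal

section ThirdDerivative

open Set Metric Asymptotics Filter Topology

lemma cubic_coeff_eq_zero {a₀ a₁ a₂ a₃ : ℝ}
    (h : (fun x : ℝ => a₀ + a₁ * x + a₂ * x ^ 2 + a₃ * x ^ 3) =o[𝓝 0] fun x => x ^ 3) :
    a₀ = 0 ∧ a₂ = 0 ∧ a₃ = 0 := by
  have h' : Tendsto (fun x : ℝ => (a₀ + a₁ * x + a₂ * x ^ 2 + a₃ * x ^ 3) / x ^ 3) (𝓝[≠] 0)
      (𝓝 0) := h.tendsto_div_nhds_zero.mono_left nhdsWithin_le_nhds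
  have step : ∀ (j : ℕ) (g : ℝ → ℝ), Continuous g →
      (∀ x : ℝ, x ≠ 0 → (a₀ + a₁ * x + a₂ * x ^ 2 + a₃ * x ^ 3) / x ^ 3 * x ^ j = g x) → g 0 = 0 := by
    intro j g hg hj
    have h1 : Tendsto (fun x : ℝ => (a₀ + a₁ * x + a₂ * x ^ 2 + a₃ * x ^ 3) / x ^ 3 * x ^ j)
        (𝓝[≠] 0) (𝓝 (0 * 0 ^ j)) :=
      h'.mul (((continuous_pow j).tendsto 0).mono_left nhdsWithin_le_nhds)
    have h2 : Tendsto g (𝓝[≠] 0) (𝓝 (0 * 0 ^ j)) :=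
      h1.congr' (eventually_of_mem self_mem_nhdsWithin fun x hx => hj x hx)
    have h3 := tendsto_nhds_unique h2 ((hg.tendsto 0).mono_left nhdsWithin_le_nhds)
    rw [← h3, zero_mul]
  have e0 : a₀ = 0 := by
    have := step 3 (fun x => a₀ + a₁ * x + a₂ * x ^ 2 + a₃ * x ^ 3) (by fun_prop)
      (fun x hx => by field_simp)
    simpa using this
  have e1 : a₁ = 0 := by
    have := step 2 (fun x => a₁ + a₂ * x + a₃ * x ^ 2) (by fun_prop)
      (fun x hx => by rw [e0]; field_simp; ring)
    simpa using this
  have e2 : a₂ = 0 := by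
    have := step 1 (fun x => a₂ + a₃ * x) (by fun_prop)
      (fun x hx => by rw [e0, e1]; field_simp; ring)
    simpa using this
  have e3 : a₃ = 0 := by
    have := step 0 (fun _ => a₃) (by fun_prop)
      (fun x hx => by rw [e0, e1, e2]; field_simp; ring)
    simpa using this
  exact ⟨e0, e2, e3⟩

lemma taylor_three {φ : ℝ → ℝ} (hφ : ContDiffOn ℝ 3 φ (Ioo (-1) 1)) :
    (fun t => φ t - (φ 0 + deriv φ 0 * t + iteratedDeriv 2 φ 0 / 2 * t ^ 2 +
      iteratedDeriv 3 φ 0 / 6 * t ^ 3)) =o[𝓝 0] fun t => t ^ 3 := by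
  have h0 : (0 : ℝ) ∈ Ioo (-1 : ℝ) 1 := by simp
  have h := taylor_isLittleO (n := 3) (convex_Ioo (-1 : ℝ) 1) h0 hφ
  rw [isOpen_Ioo.nhdsWithin_eq h0] at h
  refine (h.congr_left fun t => ?_).congr_right fun t => by rw [sub_zero]
  have hat : ContDiffAt ℝ 3 φ 0 := hφ.contDiffAt (isOpen_Ioo.mem_nhds h0)
  have hd : ∀ m : ℕ, m ≤ 3 → iteratedDerivWithin m φ (Ioo (-1) 1) 0 = iteratedDeriv m φ 0 :=
    fun m hm => iteratedDerivWithin_eq_iteratedDeriv (uniqueDiffOn_Ioo _ _)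
      (hat.of_le (by exact_mod_cast hm)) h0
  rw [taylor_within_apply]
  simp only [Finset.sum_range_succ, Finset.sum_range_zero, smul_eq_mul, sub_zero]
  rw [hd 0 (by norm_num), hd 1 (by norm_num), hd 2 (by norm_num), hd 3 le_rfl]
  simp only [iteratedDeriv_zero, iteratedDeriv_one, Nat.factorial]
  push_cast
  ring

lemma contDiffOn_of_holomorphic_extension {φ : ℝ → ℝ} {Q : ℂ → ℂ}
    (hQ : DifferentiableOn ℂ Q {p | 0 < p.re})
    (hQφ : ∀ x : ℝ, 0 < x → Q x = (((x ^ 2 + 1) * φ ((x ^ 2 - 1) / (x ^ 2 + 1)) : ℝ) : ℂ)) :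
    ContDiffOn ℝ 3 φ (Ioo (-1) 1) := by
  have heq : ∀ t ∈ Ioo (-1 : ℝ) 1,
      φ t = (1 - t) / 2 * (Q ((Real.sqrt ((1 + t) / (1 - t)) : ℝ) : ℂ)).re := by
    intro t ht
    have h1 : 0 < 1 - t := by linarith [ht.2]
    have h2 : 0 < (1 + t) / (1 - t) := div_pos (by linarith [ht.1]) h1
    rw [hQφ _ (Real.sqrt_pos.2 h2), Complex.ofReal_re, Real.sq_sqrt h2.le]
    have h3 : (1 + t) / (1 - t) + 1 = 2 / (1 - t) := by field_simp; ring
    have h4 : ((1 + t) / (1 - t) - 1) / (2 / (1 - t)) = t := by field_simp; ring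
    rw [h3, h4]
    field_simp
  refine ContDiffOn.congr (fun t ht => ContDiffAt.contDiffWithinAt ?_) heq
  have h1 : 0 < 1 - t := by linarith [ht.2]
  have h2 : 0 < (1 + t) / (1 - t) := div_pos (by linarith [ht.1]) h1
  have hs : ContDiffAt ℝ 3 (fun t : ℝ => Real.sqrt ((1 + t) / (1 - t))) t :=
    ((contDiffAt_const.add contDiffAt_id).div (contDiffAt_const.sub contDiffAt_id) h1.ne').sqrt h2.ne'
  have hQt : ContDiffAt ℝ 3 Q ((Real.sqrt ((1 + t) / (1 - t)) : ℝ) : ℂ) := by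
    refine ContDiffAt.restrict_scalars ℝ (𝕜' := ℂ) ?_
    exact (hQ.analyticAt ((isOpen_lt continuous_const Complex.continuous_re).mem_nhds
      (by simpa using Real.sqrt_pos.2 h2))).contDiffAt
  have hcomp : ContDiffAt ℝ 3 (fun t : ℝ => Q ((Real.sqrt ((1 + t) / (1 - t)) : ℝ) : ℂ)) t :=
    ContDiffAt.comp t hQt (Complex.ofRealCLM.contDiff.contDiffAt.comp t hs)
  exact ((contDiffAt_const.sub contDiffAt_id).div_const 2).mul
    (Complex.reCLM.contDiff.contDiffAt.comp t hcomp)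

lemma re_cayley_pos {ω : ℂ} (hω : ω ∈ ball (0 : ℂ) 1) :
    1 - ω ≠ 0 ∧ 0 < ((1 + ω) / (1 - ω)).re ∧
      ∃ κ : ℝ, 0 ≤ κ ∧ ((1 + ω) / (1 - ω)).im = κ * ω.im := by
  rw [mem_ball_zero_iff] at hω
  have h0 : 1 - ω ≠ 0 := by
    intro h
    rw [← sub_eq_zero.1 h] at hω
    simp at hω
  have hn : 0 < Complex.normSq (1 - ω) := Complex.normSq_pos.2 h0
  have hsq : ω.re * ω.re + ω.im * ω.im < 1 := by
    rw [← Complex.normSq_apply, Complex.normSq_eq_norm_sq]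
    nlinarith [norm_nonneg ω]
  refine ⟨h0, ?_, 2 / Complex.normSq (1 - ω), by positivity, ?_⟩
  · rw [Complex.div_re, ← add_div]
    refine div_pos ?_ hn
    simp only [Complex.add_re, Complex.sub_re, Complex.one_re, Complex.add_im, Complex.sub_im,
      Complex.one_im]
    nlinarith
  · rw [Complex.div_im]
    simp only [Complex.add_re, Complex.sub_re, Complex.one_re, Complex.add_im, Complex.sub_im,
      Complex.one_im]
    field_simp
    ring

/-- Second and third derivative estimates from a holomorphic extension preserving the upper and
lower half planes. -/
lemma deriv_bounds_of_holomorphic_extension {φ : ℝ → ℝ} {Q : ℂ → ℂ}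
    (hQ : DifferentiableOn ℂ Q {p | 0 < p.re})
    (hQim : ∀ p : ℂ, 0 < p.re → ∀ ε : ℝ, 0 ≤ ε * p.im → 0 ≤ ε * (Q p).im)
    (hQφ : ∀ x : ℝ, 0 < x → Q x = (((x ^ 2 + 1) * φ ((x ^ 2 - 1) / (x ^ 2 + 1)) : ℝ) : ℂ)) :
    iteratedDeriv 2 φ 0 ≤ 0 ∧ |iteratedDeriv 3 φ 0| ≤ 3 * -iteratedDeriv 2 φ 0 := by
  have hφ := contDiffOn_of_holomorphic_extension hQ hQφ
  have hcay : DifferentiableOn ℂ (fun ω : ℂ => (1 + ω) / (1 - ω)) (ball 0 1) := by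
    intro ω hω
    refine DifferentiableAt.differentiableWithinAt ?_
    exact (differentiableAt_const _ |>.add differentiableAt_id).div
      (differentiableAt_const _ |>.sub differentiableAt_id) (re_cayley_pos hω).1
  obtain ⟨b, hb, hb1, hb2⟩ := typically_real_expansion
    (q := fun ω => Q ((1 + ω) / (1 - ω))) (hQ.comp hcay fun ω hω => (re_cayley_pos hω).2.1)
    (fun ω hω => by
      obtain ⟨-, h1, κ, hκ, h2⟩ := re_cayley_pos hω
      refine hQim _ h1 _ ?_
      rw [h2]
      nlinarith [mul_self_nonneg ω.im])
  set c₀ := φ 0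
  set c₁ := deriv φ 0
  set c₂ := iteratedDeriv 2 φ 0 / 2 with hc2
  set c₃ := iteratedDeriv 3 φ 0 / 6 with hc3
  have hT := taylor_three hφ
  have hτ : Tendsto (fun x : ℝ => 2 * x / (1 + x ^ 2)) (𝓝 0) (𝓝 0) := by
    have : ContinuousAt (fun x : ℝ => 2 * x / (1 + x ^ 2)) 0 :=
      ContinuousAt.div (by fun_prop) (by fun_prop) (by norm_num)
    simpa [ContinuousAt] using this
  have hO : ∀ g : ℝ → ℝ, ContinuousAt g 0 → g =O[𝓝 0] fun _ => (1 : ℝ) := fun g hg =>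
    hg.tendsto.isBigO_one ℝ
  have h4 : (fun x : ℝ => x ^ 4) =o[𝓝 0] fun x : ℝ => x ^ 3 := isLittleO_pow_pow (by norm_num)
  have hmul : ∀ g f : ℝ → ℝ, ContinuousAt g 0 → f =o[𝓝 0] (fun x : ℝ => x ^ 3) →
      (fun x => g x * f x) =o[𝓝 0] fun x : ℝ => x ^ 3 := fun g f hg hf =>
    ((hO g hg).mul_isLittleO hf).congr_right fun x => one_mul _
  have hR1 : (fun x : ℝ => φ (2 * x / (1 + x ^ 2)) - (c₀ + c₁ * (2 * x / (1 + x ^ 2)) +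
      c₂ * (2 * x / (1 + x ^ 2)) ^ 2 + c₃ * (2 * x / (1 + x ^ 2)) ^ 3)) =o[𝓝 0]
      fun x : ℝ => x ^ 3 := by
    refine (hT.comp_tendsto hτ).trans_isBigO ?_
    have : (fun x : ℝ => 8 / (1 + x ^ 2) ^ 3 * x ^ 3) =O[𝓝 0] fun x : ℝ => x ^ 3 := by
      refine ((hO (fun x : ℝ => 8 / (1 + x ^ 2) ^ 3) ?_).mul
        (isBigO_refl (fun x : ℝ => x ^ 3) _)).congr_right fun x => one_mul _
      exact ContinuousAt.div (by fun_prop) (by fun_prop) (by norm_num)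
    refine this.congr_left fun x => ?_
    simp only [Function.comp_apply]
    field_simp
    ring
  have hR2 := hmul (fun x => 1 + x ^ 2) _ (by fun_prop) hR1
  have hR3 := hmul (fun x => -4 * c₂ / (1 + x ^ 2) -
    8 * c₃ * (2 * x + x ^ 3) / (1 + x ^ 2) ^ 2) _ (by
      refine ContinuousAt.sub (ContinuousAt.div (by fun_prop) (by fun_prop) (by norm_num))
        (ContinuousAt.div (by fun_prop) (by fun_prop) (by norm_num))) h4
  have hL2 := hmul (fun x => (1 - x) ^ 2 / 2) _ (by fun_prop) hb
  have hL3 := hmul (fun x => (b 2 - 2 * b 3 + b 3 * x) / 2) _ (by fun_prop) h4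
  have htot := ((hR2.add hR3).sub hL2).sub hL3
  have hfin : (fun x : ℝ => (b 0 / 2 - c₀) + ((b 1 - 2 * b 0) / 2 - 2 * c₁) * x +
      ((b 2 - 2 * b 1 + b 0) / 2 - (c₀ + 4 * c₂)) * x ^ 2 +
      ((b 3 - 2 * b 2 + b 1) / 2 - 8 * c₃) * x ^ 3) =o[𝓝 0] fun x : ℝ => x ^ 3 := by
    refine htot.congr' ?_ EventuallyEq.rfl
    have hev : ∀ᶠ x : ℝ in 𝓝 0, x ∈ Ioo (-1 : ℝ) 1 := isOpen_Ioo.mem_nhds (by simp)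
    filter_upwards [hev] with x hx
    have h1 : (0 : ℝ) < 1 - x := by linarith [hx.2]
    have h2 : 0 < (1 + x) / (1 - x) := div_pos (by linarith [hx.1]) h1
    have h3 := hQφ _ h2
    have h5 : (((1 + x) / (1 - x)) ^ 2 - 1) / (((1 + x) / (1 - x)) ^ 2 + 1) =
        2 * x / (1 + x ^ 2) := by
      have : (1 + x) ^ 2 + (1 - x) ^ 2 ≠ 0 := by positivity
      field_simp
      ring
    have h6 : ((1 + x) / (1 - x)) ^ 2 + 1 = 2 * (1 + x ^ 2) / (1 - x) ^ 2 := by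
      field_simp
      ring
    rw [h5, h6] at h3
    push_cast at h3
    have h7 := congrArg Complex.re h3
    rw [h7]
    have h8 : ((2 * (1 + (x : ℂ) ^ 2) / (1 - x) ^ 2) * (φ (2 * x / (1 + x ^ 2)) : ℂ)).re =
        2 * (1 + x ^ 2) / (1 - x) ^ 2 * φ (2 * x / (1 + x ^ 2)) := by
      have : (2 * (1 + (x : ℂ) ^ 2) / (1 - x) ^ 2) * (φ (2 * x / (1 + x ^ 2)) : ℂ) =
        ((2 * (1 + x ^ 2) / (1 - x) ^ 2 * φ (2 * x / (1 + x ^ 2)) : ℝ) : ℂ) := by push_cast; rfl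
      rw [this, Complex.ofReal_re]
    rw [h8]
    generalize φ (2 * x / (1 + x ^ 2)) = F
    have h9 : (1 - x) ^ 2 / 2 * (2 * (1 + x ^ 2) / (1 - x) ^ 2 * F) = (1 + x ^ 2) * F := by
      field_simp
    rw [mul_sub ((1 - x) ^ 2 / 2), h9]
    have h10 : (1 : ℝ) + x ^ 2 ≠ 0 := by positivity
    field_simp
    ring
  obtain ⟨e0, e2, e3⟩ := cubic_coeff_eq_zero hfin
  have hφ2 : iteratedDeriv 2 φ 0 = (b 2 - 2 * b 1) / 4 := by linarith
  have hφ3 : iteratedDeriv 3 φ 0 = 3 / 8 * (b 3 - 2 * b 2 + b 1) := by linarith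
  rw [hφ2, hφ3, abs_mul, abs_of_pos (by norm_num : (0 : ℝ) < 3 / 8)]
  constructor <;> linarith

end ThirdDerivative

section PsiLine

open Set

variable {q k m n : ℕ}

/-- Pairs of positive definite matrices. -/
def posPairs (q m : ℕ) : Set (Herm q × Herm m) :=
  {x | (x.1 : Matrix (Fin q) (Fin q) ℂ).PosDef ∧ (x.2 : Matrix (Fin m) (Fin m) ℂ).PosDef}

/-- The function `Ψ̂` on pairs of Hermitian matrices. -/
def psiPair (Ghat : Herm q →ₗ[ℝ] Herm k) (Zhat : Herm m →ₗ[ℝ] Herm n)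
    (S : Matrix (Fin n) (Fin k) ℂ) (α : ℝ) (x : Herm q × Herm m) : ℝ :=
  PsiS α S (Ghat x.1 : Matrix (Fin k) (Fin k) ℂ) (Zhat x.2 : Matrix (Fin n) (Fin n) ℂ)

lemma convex_posPairs : Convex ℝ (posPairs q m) := by
  intro x hx y hy a b ha hb hab
  have key : ∀ {l : ℕ} {A B : Matrix (Fin l) (Fin l) ℂ}, A.PosDef → B.PosDef →
      (a • A + b • B).PosDef := by
    intro l A B hA hB
    rcases ha.eq_or_lt with rfl | ha
    · rw [zero_add] at hab
      simpa [hab] using hB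
    · exact (hA.smul ha).add_posSemidef (hB.posSemidef.smul hb)
  exact ⟨key hx.1 hy.1, key hx.2 hy.2⟩

lemma smul_mem_posPairs {x : Herm q × Herm m} (hx : x ∈ posPairs q m) {c : ℝ} (hc : 0 < c) :
    c • x ∈ posPairs q m :=
  ⟨hx.1.smul hc, hx.2.smul hc⟩

lemma iteratedDeriv_comp_mul_left {φ : ℝ → ℝ} (hφ : ContDiffAt ℝ 3 φ 0) (δ : ℝ) :
    deriv (fun t => φ (δ * t)) 0 = δ * deriv φ 0 ∧
    iteratedDeriv 2 (fun t => φ (δ * t)) 0 = δ ^ 2 * iteratedDeriv 2 φ 0 ∧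
      iteratedDeriv 3 (fun t => φ (δ * t)) 0 = δ ^ 3 * iteratedDeriv 3 φ 0 := by
  have h1 : deriv (fun t : ℝ => δ * t) = fun _ => δ := by
    funext t
    simp
  have h2 : iteratedDeriv 2 (fun t : ℝ => δ * t) = fun _ => 0 := by
    rw [iteratedDeriv_succ, iteratedDeriv_one, h1]
    funext t
    simp
  have h3 : iteratedDeriv 3 (fun t : ℝ => δ * t) = fun _ => 0 := by
    rw [iteratedDeriv_succ, h2]
    funext t
    simp
  have hd : ContDiffAt ℝ 3 (fun t : ℝ => δ * t) 0 := by fun_prop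
  have hφ' : ContDiffAt ℝ 3 φ ((fun t : ℝ => δ * t) 0) := by simpa using hφ
  refine ⟨?_, ?_, ?_⟩
  · simpa using deriv_comp_mul_left δ φ 0
  · have := iteratedDeriv_comp_two (hφ'.of_le (by norm_num)) (hd.of_le (by norm_num))
    rw [h1, h2] at this
    simp only [mul_zero, add_zero] at this
    rw [mul_comm, ← this]
    rfl
  · have := iteratedDeriv_comp_three hφ' hd
    rw [h1, h2, h3] at this
    simp only [mul_zero, add_zero, zero_mul] at this
    rw [mul_comm, ← this]
    rfl

variable {Ghat : Herm q →ₗ[ℝ] Herm k} {Zhat : Herm m →ₗ[ℝ] Herm n}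
  {S : Matrix (Fin n) (Fin k) ℂ} {α : ℝ}

lemma psiPair_nonneg
    (hGpd : ∀ ρ : Herm q, (ρ : Matrix (Fin q) (Fin q) ℂ).PosDef →
      ((Ghat ρ : Matrix (Fin k) (Fin k) ℂ)).PosDef)
    (hZpd : ∀ σ : Herm m, (σ : Matrix (Fin m) (Fin m) ℂ).PosDef →
      ((Zhat σ : Matrix (Fin n) (Fin n) ℂ)).PosDef)
    {x : Herm q × Herm m} (hx : x ∈ posPairs q m) : 0 ≤ psiPair Ghat Zhat S α x :=
  PsiS_nonneg α S (hGpd _ hx.1).posSemidef (hZpd _ hx.2).posSemidef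

lemma psiPair_smul (hα : 0 < α)
    (hGpd : ∀ ρ : Herm q, (ρ : Matrix (Fin q) (Fin q) ℂ).PosDef →
      ((Ghat ρ : Matrix (Fin k) (Fin k) ℂ)).PosDef)
    (hZpd : ∀ σ : Herm m, (σ : Matrix (Fin m) (Fin m) ℂ).PosDef →
      ((Zhat σ : Matrix (Fin n) (Fin n) ℂ)).PosDef)
    {x : Herm q × Herm m} (hx : x ∈ posPairs q m) {c : ℝ} (hc : 0 < c) :
    psiPair Ghat Zhat S α (c • x) = c * psiPair Ghat Zhat S α x := by
  rw [psiPair, Prod.smul_fst, Prod.smul_snd, map_smul, map_smul]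
  exact PsiS_smul hα S (hGpd _ hx.1).posSemidef (hZpd _ hx.2).posSemidef hc

lemma psiPair_unit_line (hS : Sᴴ * S = 1) (hα : α ∈ Ico (1 / 2 : ℝ) 1)
    (hGpd : ∀ ρ : Herm q, (ρ : Matrix (Fin q) (Fin q) ℂ).PosDef →
      ((Ghat ρ : Matrix (Fin k) (Fin k) ℂ)).PosDef)
    (hZpd : ∀ σ : Herm m, (σ : Matrix (Fin m) (Fin m) ℂ).PosDef →
      ((Zhat σ : Matrix (Fin n) (Fin n) ℂ)).PosDef)
    {x h : Herm q × Herm m} (h₁ : x + h ∈ posPairs q m) (h₀ : x - h ∈ posPairs q m) :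
    ContDiffOn ℝ 3 (fun t : ℝ => psiPair Ghat Zhat S α (x + t • h)) (Ioo (-1) 1) ∧
    iteratedDeriv 2 (fun t : ℝ => psiPair Ghat Zhat S α (x + t • h)) 0 ≤ 0 ∧
    |iteratedDeriv 3 (fun t : ℝ => psiPair Ghat Zhat S α (x + t • h)) 0| ≤
      3 * -iteratedDeriv 2 (fun t : ℝ => psiPair Ghat Zhat S α (x + t • h)) 0 := by
  have hα0 : 0 < α := by linarith [hα.1]
  obtain ⟨Q, hQ, hQim, hQx⟩ := exists_holomorphic_extension hα hS (hGpd _ h₁.1) (hGpd _ h₀.1)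
    (hZpd _ h₁.2) (hZpd _ h₀.2)
  have hQφ : ∀ s : ℝ, 0 < s → Q s =
      (((s ^ 2 + 1) * psiPair Ghat Zhat S α (x + ((s ^ 2 - 1) / (s ^ 2 + 1)) • h) : ℝ) : ℂ) := by
    intro s hs
    have e1 : s • (x + h) + s⁻¹ • (x - h) =
        (s + s⁻¹) • (x + ((s ^ 2 - 1) / (s ^ 2 + 1)) • h) := by
      rw [smul_add, smul_sub, smul_add, smul_smul,
        show (s + s⁻¹) * ((s ^ 2 - 1) / (s ^ 2 + 1)) = s - s⁻¹ by field_simp, add_smul, sub_smul]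
      abel
    have hsum : (s + s⁻¹) • (x + ((s ^ 2 - 1) / (s ^ 2 + 1)) • h) ∈ posPairs q m := by
      rw [← e1]
      exact ⟨(h₁.1.smul hs).add (h₀.1.smul (inv_pos.2 hs)),
        (h₁.2.smul hs).add (h₀.2.smul (inv_pos.2 hs))⟩
    have hs' : 0 < s + s⁻¹ := by positivity
    have hmem : x + ((s ^ 2 - 1) / (s ^ 2 + 1)) • h ∈ posPairs q m := by
      have := smul_mem_posPairs hsum (inv_pos.2 hs')
      rwa [smul_smul, inv_mul_cancel₀ hs'.ne', one_smul] at this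
    have e2 : PsiS α S (s • (Ghat (x + h).1 : Matrix (Fin k) (Fin k) ℂ) +
          s⁻¹ • (Ghat (x - h).1 : Matrix (Fin k) (Fin k) ℂ))
        (s • (Zhat (x + h).2 : Matrix (Fin n) (Fin n) ℂ) +
          s⁻¹ • (Zhat (x - h).2 : Matrix (Fin n) (Fin n) ℂ)) =
        psiPair Ghat Zhat S α (s • (x + h) + s⁻¹ • (x - h)) := by
      have g₁ : Ghat (s • (x + h) + s⁻¹ • (x - h)).1 =
          s • Ghat (x + h).1 + s⁻¹ • Ghat (x - h).1 := by
        rw [show (s • (x + h) + s⁻¹ • (x - h)).1 = s • (x + h).1 + s⁻¹ • (x - h).1 from rfl,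
          map_add, map_smul, map_smul]
      have g₂ : Zhat (s • (x + h) + s⁻¹ • (x - h)).2 =
          s • Zhat (x + h).2 + s⁻¹ • Zhat (x - h).2 := by
        rw [show (s • (x + h) + s⁻¹ • (x - h)).2 = s • (x + h).2 + s⁻¹ • (x - h).2 from rfl,
          map_add, map_smul, map_smul]
      rw [psiPair, g₁, g₂]
      rfl
    rw [hQx s hs, e2, e1, psiPair_smul hα0 hGpd hZpd hmem hs']
    congr 1
    field_simp
  exact ⟨contDiffOn_of_holomorphic_extension hQ hQφ,
    deriv_bounds_of_holomorphic_extension hQ hQim hQφ⟩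

lemma psiPair_line (hS : Sᴴ * S = 1) (hα : α ∈ Ico (1 / 2 : ℝ) 1)
    (hGpd : ∀ ρ : Herm q, (ρ : Matrix (Fin q) (Fin q) ℂ).PosDef →
      ((Ghat ρ : Matrix (Fin k) (Fin k) ℂ)).PosDef)
    (hZpd : ∀ σ : Herm m, (σ : Matrix (Fin m) (Fin m) ℂ).PosDef →
      ((Zhat σ : Matrix (Fin n) (Fin n) ℂ)).PosDef)
    {x h : Herm q × Herm m} {δ : ℝ} (hδ : 0 < δ) (h₁ : x + δ • h ∈ posPairs q m)
    (h₀ : x - δ • h ∈ posPairs q m) :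
    ContDiffAt ℝ 3 (fun t : ℝ => psiPair Ghat Zhat S α (x + t • h)) 0 ∧
    iteratedDeriv 2 (fun t : ℝ => psiPair Ghat Zhat S α (x + t • h)) 0 ≤ 0 ∧
    δ * |iteratedDeriv 3 (fun t : ℝ => psiPair Ghat Zhat S α (x + t • h)) 0| ≤
      3 * -iteratedDeriv 2 (fun t : ℝ => psiPair Ghat Zhat S α (x + t • h)) 0 := by
  obtain ⟨hc, h2, h3⟩ := psiPair_unit_line hS hα hGpd hZpd h₁ h₀
  set φ : ℝ → ℝ := fun t => psiPair Ghat Zhat S α (x + t • h) with hφ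
  have hφδ : (fun t : ℝ => psiPair Ghat Zhat S α (x + t • δ • h)) = fun t => φ (δ * t) := by
    funext t
    rw [hφ, smul_smul, mul_comm]
  rw [hφδ] at hc h2 h3
  have hat : ContDiffAt ℝ 3 (fun t => φ (δ * t)) 0 :=
    hc.contDiffAt (isOpen_Ioo.mem_nhds (by simp))
  have hφat : ContDiffAt ℝ 3 φ 0 := by
    have hd : ContDiffAt ℝ 3 (fun t : ℝ => δ⁻¹ * t) 0 := by fun_prop
    have hat' : ContDiffAt ℝ 3 (fun t => φ (δ * t)) ((fun t : ℝ => δ⁻¹ * t) 0) := by simpa using hat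
    have := ContDiffAt.comp (0 : ℝ) hat' hd
    refine this.congr_of_eventuallyEq (Filter.Eventually.of_forall fun t => ?_)
    simp only [Function.comp_apply]
    rw [← mul_assoc, mul_inv_cancel₀ hδ.ne', one_mul]
  obtain ⟨-, e2, e3⟩ := iteratedDeriv_comp_mul_left hφat δ
  rw [e2] at h2 h3
  rw [e3, abs_mul, abs_of_pos (by positivity)] at h3
  have hδ2 : 0 < δ ^ 2 := by positivity
  refine ⟨hφat, by nlinarith, ?_⟩
  refine le_of_mul_le_mul_left ?_ hδ2
  linarith [h3, show δ ^ 2 * (δ * |iteratedDeriv 3 φ 0|) = δ ^ 3 * |iteratedDeriv 3 φ 0| by ring]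

end PsiLine

section Jets

/-- `f` is `C³` near `0` with first three derivatives `a`, `b`, `c` at `0`. -/
def HasJetThree (f : ℝ → ℝ) (a b c : ℝ) : Prop :=
  ContDiffAt ℝ 3 f 0 ∧ deriv f 0 = a ∧ iteratedDeriv 2 f 0 = b ∧ iteratedDeriv 3 f 0 = c

namespace HasJetThree

variable {f g : ℝ → ℝ} {a b c a' b' c' : ℝ}

lemma congr_of_eventuallyEq (hf : HasJetThree f a b c) (h : g =ᶠ[nhds 0] f) :
    HasJetThree g a b c := by
  obtain ⟨h0, h1, h2, h3⟩ := hf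
  exact ⟨h0.congr_of_eventuallyEq h, h.deriv_eq.trans h1, (h.iteratedDeriv_eq 2).trans h2,
    (h.iteratedDeriv_eq 3).trans h3⟩

lemma congr_jet (hf : HasJetThree f a b c) (ha : a = a') (hb : b = b') (hc : c = c') :
    HasJetThree f a' b' c' := by
  subst ha hb hc
  exact hf

protected lemma add (hf : HasJetThree f a b c) (hg : HasJetThree g a' b' c') :
    HasJetThree (fun t => f t + g t) (a + a') (b + b') (c + c') := by
  obtain ⟨h0, h1, h2, h3⟩ := hf
  obtain ⟨g0, g1, g2, g3⟩ := hg
  refine ⟨h0.add g0, ?_, ?_, ?_⟩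
  · rw [← h1, ← g1]
    exact deriv_add (h0.differentiableAt (by norm_num)) (g0.differentiableAt (by norm_num))
  · rw [← h2, ← g2]
    exact iteratedDeriv_add (h0.of_le (by norm_num)) (g0.of_le (by norm_num))
  · rw [← h3, ← g3]
    exact iteratedDeriv_add h0 g0

lemma const_add_mul (r s : ℝ) : HasJetThree (fun t => r + s * t) s 0 0 := by
  have h1 : deriv (fun t : ℝ => r + s * t) = fun _ => s := by
    funext t
    simp
  have h2 : iteratedDeriv 2 (fun t : ℝ => r + s * t) = fun _ => 0 := by
    rw [iteratedDeriv_succ, iteratedDeriv_one, h1]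
    funext t
    simp
  have h3 : iteratedDeriv 3 (fun t : ℝ => r + s * t) = fun _ => 0 := by
    rw [iteratedDeriv_succ, h2]
    funext t
    simp
  exact ⟨by fun_prop, congrFun h1 0, congrFun h2 0, congrFun h3 0⟩

protected lemma sum {ι : Type*} {s : Finset ι} {F : ι → ℝ → ℝ} {A B C : ι → ℝ}
    (h : ∀ i ∈ s, HasJetThree (F i) (A i) (B i) (C i)) :
    HasJetThree (fun t => ∑ i ∈ s, F i t) (∑ i ∈ s, A i) (∑ i ∈ s, B i) (∑ i ∈ s, C i) := by
  classical
  induction s using Finset.induction_on with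
  | empty => simpa using const_add_mul 0 0
  | insert i s hi ih =>
    simp only [Finset.sum_insert hi]
    exact (h i (Finset.mem_insert_self i s)).add
      (ih fun j hj => h j (Finset.mem_insert_of_mem hj))

lemma neg_log (hf : HasJetThree f a b c) (h : 0 < f 0) :
    HasJetThree (fun t => -Real.log (f t)) (-(a / f 0)) ((a / f 0) ^ 2 - b / f 0)
      (-2 * (a / f 0) ^ 3 + 3 * (a / f 0) * (b / f 0) - c / f 0) := by
  obtain ⟨h0, h1, h2, h3⟩ := hf
  have l0 : ContDiffAt ℝ 3 (fun x => -Real.log x) (f 0) := (Real.contDiffAt_log.2 h.ne').neg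
  have l1 : deriv (fun x => -Real.log x) = fun x => -x⁻¹ := by
    funext x
    simp
  have l2 : iteratedDeriv 2 (fun x => -Real.log x) = fun x => (x ^ 2)⁻¹ := by
    rw [iteratedDeriv_succ, iteratedDeriv_one, l1]
    funext x
    simp
  have l3 : iteratedDeriv 3 (fun x => -Real.log x) (f 0) = -2 / f 0 ^ 3 := by
    rw [iteratedDeriv_succ, l2]
    have hd : HasDerivAt (fun x : ℝ => (x ^ 2)⁻¹) (-(2 * f 0 ^ 1) / (f 0 ^ 2) ^ 2) (f 0) := by
      exact ((hasDerivAt_pow 2 (f 0)).inv (by positivity)).congr_deriv (by simp)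
    rw [hd.deriv]
    field_simp
  have hne := h.ne'
  refine ⟨l0.comp (0 : ℝ) h0, ?_, ?_, ?_⟩
  · have := deriv_comp (0 : ℝ) (l0.differentiableAt (by norm_num))
      (h0.differentiableAt (by norm_num))
    rw [l1, h1] at this
    refine this.trans ?_
    field_simp
  · have := iteratedDeriv_comp_two (l0.of_le (by norm_num)) (h0.of_le (by norm_num))
    rw [l1, l2, h1, h2] at this
    refine this.trans ?_
    field_simp
    ring
  · have := iteratedDeriv_comp_three l0 h0
    rw [l1, l2, l3, h1, h2, h3] at this
    refine this.trans ?_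
    field_simp
    ring

end HasJetThree

end Jets

section LogDet

lemma exists_diagonal_line {d : ℕ} {ρ h : Herm d}
    (hρ : (ρ : Matrix (Fin d) (Fin d) ℂ).PosDef) :
    ∃ (c : ℝ) (μ : Fin d → ℝ), 0 < c ∧
      (∀ t : ℝ, ((ρ + t • h : Herm d) : Matrix (Fin d) (Fin d) ℂ).det.re = c * ∏ i, (1 + μ i * t)) ∧
      ∀ t : ℝ, (∀ i, 0 < 1 + μ i * t) → ((ρ + t • h : Herm d) : Matrix (Fin d) (Fin d) ℂ).PosDef := by
  obtain ⟨U, hU, hρU, -⟩ := exists_diagonalization_mpow hρ.1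
  set R : Matrix (Fin d) (Fin d) ℂ := diagonal fun i => ((√(hρ.1.eigenvalues i) : ℝ) : ℂ) with hR
  set T : Matrix (Fin d) (Fin d) ℂ := diagonal fun i => (((√(hρ.1.eigenvalues i))⁻¹ : ℝ) : ℂ)
    with hT
  have hpos := fun i => Real.sqrt_pos.2 (hρ.eigenvalues_pos i)
  have hU' : U * Uᴴ = 1 := mul_eq_one_comm.1 hU
  have hRT : R * T = 1 := by
    rw [hR, hT, diagonal_mul_diagonal, ← diagonal_one]
    congr 1
    funext i
    rw [← Complex.ofReal_mul, mul_inv_cancel₀ (hpos i).ne', Complex.ofReal_one]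
  have hRR : R * Rᴴ = diagonal fun i => (hρ.1.eigenvalues i : ℂ) := by
    rw [hR, diagonal_conjTranspose, diagonal_mul_diagonal]
    congr 1
    funext i
    simp only [Pi.star_apply, RCLike.star_def, Complex.conj_ofReal]
    rw [← Complex.ofReal_mul, Real.mul_self_sqrt (hρ.eigenvalues_pos i).le]
  have hM : (T * Uᴴ * (h : Matrix (Fin d) (Fin d) ℂ) * U * Tᴴ).IsHermitian := by
    have := isHermitian_mul_mul_conjTranspose (T * Uᴴ) (show IsHermitian h.1 from h.2)
    simpa [Matrix.mul_assoc, conjTranspose_mul] using this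
  obtain ⟨W, hW, hMW, -⟩ := exists_diagonalization_mpow hM
  have hW' : W * Wᴴ = 1 := mul_eq_one_comm.1 hW
  set μ := hM.eigenvalues
  set C := U * R * W with hC
  have hCunit : IsUnit C := by
    refine isUnit_iff_exists_inv.2 ⟨Wᴴ * T * Uᴴ, ?_⟩
    rw [hC, show U * R * W * (Wᴴ * T * Uᴴ) = U * (R * (W * Wᴴ) * T) * Uᴴ by
      simp only [Matrix.mul_assoc], hW', Matrix.mul_one, hRT, Matrix.mul_one, hU']
  have hρC : (ρ : Matrix (Fin d) (Fin d) ℂ) = C * Cᴴ := by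
    rw [hC, conjTranspose_mul, conjTranspose_mul,
      show U * R * W * (Wᴴ * (Rᴴ * Uᴴ)) = U * (R * (W * Wᴴ) * Rᴴ) * Uᴴ by
        simp only [Matrix.mul_assoc], hW', Matrix.mul_one, hRR]
    exact hρU
  have hTR : (R * T)ᴴ = 1 := by rw [hRT, conjTranspose_one]
  have hhC : (h : Matrix (Fin d) (Fin d) ℂ) = C * diagonal (fun i => (μ i : ℂ)) * Cᴴ := by
    have e : C * diagonal (fun i => (μ i : ℂ)) * Cᴴ =
        U * R * (W * diagonal (fun i => (μ i : ℂ)) * Wᴴ) * Rᴴ * Uᴴ := by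
      rw [hC, conjTranspose_mul, conjTranspose_mul]
      simp only [Matrix.mul_assoc]
    rw [e, ← hMW, show U * R * (T * Uᴴ * (h : Matrix (Fin d) (Fin d) ℂ) * U * Tᴴ) * Rᴴ * Uᴴ =
      U * (R * T) * Uᴴ * (h : Matrix (Fin d) (Fin d) ℂ) * U * (Tᴴ * Rᴴ) * Uᴴ by
        simp only [Matrix.mul_assoc], ← conjTranspose_mul, hTR, hRT, Matrix.mul_one, Matrix.mul_one,
      hU', Matrix.one_mul, Matrix.mul_assoc, hU', Matrix.mul_one]
  have hline : ∀ t : ℝ, ((ρ + t • h : Herm d) : Matrix (Fin d) (Fin d) ℂ) =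
      C * diagonal (fun i => ((1 + μ i * t : ℝ) : ℂ)) * Cᴴ := by
    intro t
    have e : diagonal (fun i => ((1 + μ i * t : ℝ) : ℂ)) =
        1 + t • diagonal (fun i => (μ i : ℂ)) := by
      rw [← diagonal_one, ← diagonal_smul, diagonal_add]
      congr 1
      funext i
      simp [mul_comm]
    rw [e, Matrix.mul_add, Matrix.add_mul, Matrix.mul_one, Matrix.mul_smul, Matrix.smul_mul,
      ← hhC, ← hρC]
    rfl
  refine ⟨Complex.normSq C.det, μ, Complex.normSq_pos.2 ((isUnit_iff_isUnit_det C).1 hCunit).ne_zero,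
    fun t => ?_, fun t ht => ?_⟩
  · rw [hline, det_mul, det_mul, det_diagonal, det_conjTranspose, mul_right_comm, RCLike.star_def,
      Complex.mul_conj, ← Complex.ofReal_prod, ← Complex.ofReal_mul, Complex.ofReal_re]
  · rw [hline]
    refine (Matrix.IsUnit.posDef_star_right_conjugate_iff hCunit).2 (posDef_diagonal_iff.2 fun i => ?_)
    exact_mod_cast ht i

lemma hasJetThree_neg_log_prod {ι : Type*} [Fintype ι] {c : ℝ} (hc : 0 < c) (μ : ι → ℝ) :
    HasJetThree (fun t => -Real.log (c * ∏ i, (1 + μ i * t))) (-∑ i, μ i) (∑ i, μ i ^ 2)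
      (-2 * ∑ i, μ i ^ 3) := by
  have hi : ∀ i ∈ Finset.univ,
      HasJetThree (fun t => -Real.log (1 + μ i * t)) (-μ i) (μ i ^ 2) (-2 * μ i ^ 3) :=
    fun i _ => ((HasJetThree.const_add_mul 1 (μ i)).neg_log (by simp)).congr_jet
      (by simp) (by simp) (by simp)
  have hsum := (HasJetThree.const_add_mul (-Real.log c) 0).add (HasJetThree.sum hi)
  refine (hsum.congr_of_eventuallyEq ?_).congr_jet (by simp) (by simp) (by simp [Finset.mul_sum])
  have hev : ∀ᶠ t : ℝ in nhds 0, ∀ i, 0 < 1 + μ i * t := by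
    refine Filter.eventually_all.2 fun i => ?_
    have hcont : ContinuousAt (fun t : ℝ => 1 + μ i * t) 0 := by fun_prop
    exact hcont.eventually (lt_mem_nhds (by simp))
  filter_upwards [hev] with t ht
  rw [Real.log_mul hc.ne' (Finset.prod_pos fun i _ => ht i).ne',
    Real.log_prod fun i _ => (ht i).ne', Finset.sum_neg_distrib]
  ring

end LogDet

section LineBounds

open Set

lemma exists_common_radius {q m : ℕ} {x h : Herm q × Herm m} (hx : x ∈ posPairs q m) :
    ∃ (c₁ c₂ : ℝ) (μ : Fin q → ℝ) (η : Fin m → ℝ), 0 < c₁ ∧ 0 < c₂ ∧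
      (∀ t : ℝ, ((x + t • h).1 : Matrix (Fin q) (Fin q) ℂ).det.re = c₁ * ∏ i, (1 + μ i * t)) ∧
      (∀ t : ℝ, ((x + t • h).2 : Matrix (Fin m) (Fin m) ℂ).det.re = c₂ * ∏ i, (1 + η i * t)) ∧
      ∀ δ : ℝ, 0 < δ → δ * √(∑ i, μ i ^ 2 + ∑ i, η i ^ 2) < 1 →
        x + δ • h ∈ posPairs q m ∧ x - δ • h ∈ posPairs q m := by
  obtain ⟨c₁, μ, hc₁, hdet₁, hpos₁⟩ := exists_diagonal_line (h := h.1) hx.1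
  obtain ⟨c₂, η, hc₂, hdet₂, hpos₂⟩ := exists_diagonal_line (h := h.2) hx.2
  refine ⟨c₁, c₂, μ, η, hc₁, hc₂, hdet₁, hdet₂, fun δ hδ hlt => ?_⟩
  have hμ : ∀ i, |μ i| ≤ √(∑ i, μ i ^ 2 + ∑ i, η i ^ 2) := fun i =>
    Real.abs_le_sqrt ((Finset.single_le_sum (f := fun i => μ i ^ 2) (fun j _ => sq_nonneg _)
      (Finset.mem_univ i)).trans
      (le_add_of_nonneg_right (Finset.sum_nonneg fun j _ => sq_nonneg _)))
  have hη : ∀ i, |η i| ≤ √(∑ i, μ i ^ 2 + ∑ i, η i ^ 2) := fun i =>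
    Real.abs_le_sqrt ((Finset.single_le_sum (f := fun i => η i ^ 2) (fun j _ => sq_nonneg _)
      (Finset.mem_univ i)).trans
      (le_add_of_nonneg_left (Finset.sum_nonneg fun j _ => sq_nonneg _)))
  have key : ∀ a t : ℝ, |a| ≤ √(∑ i, μ i ^ 2 + ∑ i, η i ^ 2) → |t| = δ → 0 < 1 + a * t := by
    intro a t ha ht
    have h1 : |a * t| < 1 := by
      rw [abs_mul, ht, mul_comm]
      exact (mul_le_mul_of_nonneg_left ha hδ.le).trans_lt hlt
    linarith [(abs_lt.1 h1).1]
  have hmem : ∀ t : ℝ, |t| = δ → x + t • h ∈ posPairs q m := fun t ht =>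
    ⟨hpos₁ t fun i => key _ t (hμ i) ht, hpos₂ t fun i => key _ t (hη i) ht⟩
  refine ⟨hmem δ (abs_of_pos hδ), ?_⟩
  have := hmem (-δ) (by rw [abs_neg, abs_of_pos hδ])
  rwa [neg_smul, ← sub_eq_add_neg] at this

lemma self_concordance_inequality {P a s d T : ℝ} (ha : 0 ≤ a) (hs : 0 ≤ s)
    (hd : |d| ≤ 3 * s * a) (hT : |T| ≤ s ^ 3) :
    |-2 * P ^ 3 - 3 * P * a - d - 2 * T| ≤ 2 * (P ^ 2 + a + s ^ 2) ^ (3 / 2 : ℝ) := by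
  set y := √(P ^ 2 + a + s ^ 2) with hy
  have hnn : 0 ≤ P ^ 2 + a + s ^ 2 := by positivity
  have hy2 : y ^ 2 = P ^ 2 + a + s ^ 2 := Real.sq_sqrt hnn
  have hpow : (P ^ 2 + a + s ^ 2) ^ (3 / 2 : ℝ) = y ^ 3 := by
    rw [hy, Real.sqrt_eq_rpow, ← Real.rpow_mul_natCast hnn]
    norm_num
  have hy0 : 0 ≤ y := Real.sqrt_nonneg _
  have hP0 := abs_nonneg P
  have hP2 : |P| ^ 2 = P ^ 2 := sq_abs P
  have hle : |-2 * P ^ 3 - 3 * P * a - d - 2 * T| ≤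
      2 * |P| ^ 3 + 3 * |P| * a + 3 * s * a + 2 * s ^ 3 := by
    have e1 : |-2 * P ^ 3| = 2 * |P| ^ 3 := by rw [abs_mul, abs_pow]; norm_num
    have e2 : |3 * P * a| = 3 * |P| * a := by
      rw [abs_mul, abs_mul, abs_of_nonneg ha]; norm_num
    have e3 : |2 * T| = 2 * |T| := by rw [abs_mul]; norm_num
    have t1 := abs_sub (-2 * P ^ 3 - 3 * P * a - d) (2 * T)
    have t2 := abs_sub (-2 * P ^ 3 - 3 * P * a) d
    have t3 := abs_sub (-2 * P ^ 3) (3 * P * a)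
    linarith
  rw [hpow]
  refine hle.trans ?_
  have ha' : a = y ^ 2 - |P| ^ 2 - s ^ 2 := by rw [hy2, hP2]; ring
  have hfac : 0 ≤ (y - (|P| + s)) ^ 2 * (2 * y + (|P| + s)) := by positivity
  rw [ha']
  nlinarith [hfac]

lemma abs_sum_cube_le {ι : Type*} {t : Finset ι} {μ : ι → ℝ} {s : ℝ}
    (hμ : ∀ i ∈ t, |μ i| ≤ s) : |∑ i ∈ t, μ i ^ 3| ≤ s * ∑ i ∈ t, μ i ^ 2 := by
  rw [Finset.mul_sum]
  refine (Finset.abs_sum_le_sum_abs _ _).trans (Finset.sum_le_sum fun i hi => ?_)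
  rw [abs_pow, pow_succ, sq_abs, mul_comm]
  exact mul_le_mul_of_nonneg_right (hμ i hi) (sq_nonneg _)

lemma sq_add_sum_le {ι : Type*} [Fintype ι] (P : ℝ) (μ : ι → ℝ) :
    (P + ∑ i, μ i) ^ 2 ≤ (1 + Fintype.card ι) * (P ^ 2 + ∑ i, μ i ^ 2) := by
  have := sq_sum_le_card_mul_sum_sq (s := (Finset.univ : Finset (Option ι)))
    (f := fun o => o.elim P μ)
  simpa [Fintype.sum_option, add_comm] using this

variable {q k m n : ℕ} {Ghat : Herm q →ₗ[ℝ] Herm k} {Zhat : Herm m →ₗ[ℝ] Herm n}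
  {S : Matrix (Fin n) (Fin k) ℂ} {α : ℝ}

lemma psiPair_jet (hS : Sᴴ * S = 1) (hα : α ∈ Ico (1 / 2 : ℝ) 1)
    (hGpd : ∀ ρ : Herm q, (ρ : Matrix (Fin q) (Fin q) ℂ).PosDef →
      ((Ghat ρ : Matrix (Fin k) (Fin k) ℂ)).PosDef)
    (hZpd : ∀ σ : Herm m, (σ : Matrix (Fin m) (Fin m) ℂ).PosDef →
      ((Zhat σ : Matrix (Fin n) (Fin n) ℂ)).PosDef)
    {x h : Herm q × Herm m} {s : ℝ} (hs : 0 ≤ s)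
    (hδ : ∀ δ : ℝ, 0 < δ → δ * s < 1 → x + δ • h ∈ posPairs q m ∧ x - δ • h ∈ posPairs q m) :
    ∃ a b c, HasJetThree (fun t : ℝ => psiPair Ghat Zhat S α (x + t • h)) a b c ∧ b ≤ 0 ∧
      |c| ≤ 3 * s * -b := by
  have hR : ∀ ε : ℝ, 0 < ε → (s + ε)⁻¹ * s < 1 := fun ε hε => by
    rw [inv_mul_lt_iff₀ (by positivity)]
    linarith
  have hline := fun (ε : ℝ) (hε : 0 < ε) =>
    have hp : 0 < (s + ε)⁻¹ := by positivity
    psiPair_line (S := S) (α := α) hS hα hGpd hZpd hp (hδ _ hp (hR ε hε)).1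
      (hδ _ hp (hR ε hε)).2
  obtain ⟨hc, hb, -⟩ := hline 1 one_pos
  refine ⟨_, _, _, ⟨hc, rfl, rfl, rfl⟩, hb, ?_⟩
  generalize hbd : iteratedDeriv 2 (fun t : ℝ => psiPair Ghat Zhat S α (x + t • h)) 0 = b at *
  generalize hcd : iteratedDeriv 3 (fun t : ℝ => psiPair Ghat Zhat S α (x + t • h)) 0 = c at *
  refine le_of_forall_pos_le_add fun ε hε => ?_
  have hb' : 0 < 3 * -b + 1 := by linarith
  have := (hline (ε / (3 * -b + 1)) (by positivity)).2.2
  rw [inv_mul_le_iff₀ (by positivity)] at this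
  have e : ε / (3 * -b + 1) * (3 * -b) ≤ ε := by
    rw [div_mul_eq_mul_div, div_le_iff₀ hb']
    nlinarith
  nlinarith

/-- The barrier in terms of `psiPair`. -/
def psiBarrier (Ghat : Herm q →ₗ[ℝ] Herm k) (Zhat : Herm m →ₗ[ℝ] Herm n)
    (S : Matrix (Fin n) (Fin k) ℂ) (α : ℝ) (p : ℝ × Herm q × Herm m) : ℝ :=
  -Real.log (psiPair Ghat Zhat S α p.2 - p.1)
    - Real.log ((p.2.1 : Matrix (Fin q) (Fin q) ℂ).det.re)
    - Real.log ((p.2.2 : Matrix (Fin m) (Fin m) ℂ).det.re)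

lemma psiBarrier_jet (hS : Sᴴ * S = 1) (hα : α ∈ Ico (1 / 2 : ℝ) 1)
    (hGpd : ∀ ρ : Herm q, (ρ : Matrix (Fin q) (Fin q) ℂ).PosDef →
      ((Ghat ρ : Matrix (Fin k) (Fin k) ℂ)).PosDef)
    (hZpd : ∀ σ : Herm m, (σ : Matrix (Fin m) (Fin m) ℂ).PosDef →
      ((Zhat σ : Matrix (Fin n) (Fin n) ℂ)).PosDef)
    {p : ℝ × Herm q × Herm m} (hp : p.2 ∈ posPairs q m) (hu : p.1 < psiPair Ghat Zhat S α p.2)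
    (h : ℝ × Herm q × Herm m) :
    ∃ A B C, HasJetThree (fun t : ℝ => psiBarrier Ghat Zhat S α (p + t • h)) A B C ∧
      |C| ≤ 2 * B ^ (3 / 2 : ℝ) ∧ A ^ 2 ≤ (1 + q + m) * B := by
  obtain ⟨c₁, c₂, μ, η, hc₁, hc₂, hdet₁, hdet₂, hδ⟩ := exists_common_radius (h := h.2) hp
  set s := √(∑ i, μ i ^ 2 + ∑ i, η i ^ 2) with hs
  have hs0 : 0 ≤ s := Real.sqrt_nonneg _
  have hs2 : s ^ 2 = ∑ i, μ i ^ 2 + ∑ i, η i ^ 2 :=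
    Real.sq_sqrt (add_nonneg (Finset.sum_nonneg fun _ _ => sq_nonneg _)
      (Finset.sum_nonneg fun _ _ => sq_nonneg _))
  obtain ⟨a, b, c, hjet, hb, hc⟩ := psiPair_jet (S := S) (α := α) hS hα hGpd hZpd hs0 hδ
  set y := psiPair Ghat Zhat S α p.2 - p.1 with hy
  have hy0 : 0 < y := sub_pos.2 hu
  have hψ := hjet.add (HasJetThree.const_add_mul (-p.1) (-h.1))
  have hψ0 : psiPair Ghat Zhat S α (p.2 + (0 : ℝ) • h.2) + (-p.1 + -h.1 * 0) = y := by
    rw [zero_smul, add_zero, mul_zero, add_zero, hy, sub_eq_add_neg]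
  have hlog := hψ.neg_log (by rw [hψ0]; exact hy0)
  rw [hψ0] at hlog
  have htot := (hlog.add (hasJetThree_neg_log_prod hc₁ μ)).add (hasJetThree_neg_log_prod hc₂ η)
  refine ⟨_, _, _, htot.congr_of_eventuallyEq (Filter.Eventually.of_forall fun t => ?_), ?_, ?_⟩
  · change -Real.log (psiPair Ghat Zhat S α (p.2 + t • h.2) - (p.1 + t • h.1)) -
      Real.log ((p.2 + t • h.2).1 : Matrix (Fin q) (Fin q) ℂ).det.re -
      Real.log ((p.2 + t • h.2).2 : Matrix (Fin m) (Fin m) ℂ).det.re = _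
    rw [hdet₁, hdet₂, show psiPair Ghat Zhat S α (p.2 + t • h.2) - (p.1 + t • h.1) =
      psiPair Ghat Zhat S α (p.2 + t • h.2) + (-p.1 + -h.1 * t) by rw [smul_eq_mul]; ring]
    ring
  · have hsq : ∀ {ι : Type} {t : Finset ι} {μ : ι → ℝ}, 0 ≤ ∑ i ∈ t, μ i ^ 2 :=
      Finset.sum_nonneg fun _ _ => sq_nonneg _
    have hμ : ∀ i ∈ Finset.univ, |μ i| ≤ s := fun i hi =>
      Real.abs_le_sqrt ((Finset.single_le_sum (f := fun i => μ i ^ 2) (fun j _ => sq_nonneg _)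
        hi).trans (le_add_of_nonneg_right hsq))
    have hη : ∀ i ∈ Finset.univ, |η i| ≤ s := fun i hi =>
      Real.abs_le_sqrt ((Finset.single_le_sum (f := fun i => η i ^ 2) (fun j _ => sq_nonneg _)
        hi).trans (le_add_of_nonneg_left hsq))
    have hT : |∑ i, μ i ^ 3 + ∑ i, η i ^ 3| ≤ s ^ 3 := by
      refine (abs_add_le _ _).trans ?_
      have := abs_sum_cube_le hμ
      have := abs_sum_cube_le hη
      nlinarith
    have hd : |c / y| ≤ 3 * s * (-b / y) := by
      rw [abs_div, abs_of_pos hy0, ← mul_div_assoc]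
      exact div_le_div_of_nonneg_right hc hy0.le
    have := self_concordance_inequality (P := (a + -h.1) / y)
      (div_nonneg (neg_nonneg.2 hb) hy0.le) hs0 hd hT
    convert this using 2
    · ring
    · rw [hs2]
      congr 1
      ring
  · have h1 := sq_add_sum_le ((a + -h.1) / y) (Sum.elim μ η)
    have h2 : 0 ≤ -b / y := div_nonneg (neg_nonneg.2 hb) hy0.le
    have h3 : (0 : ℝ) ≤ 1 + q + m := by positivity
    simp only [Fintype.sum_sum_type, Sum.elim_inl, Sum.elim_inr, Fintype.card_sum, Fintype.card_fin,
      Nat.cast_add] at h1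
    calc _ = ((a + -h.1) / y + (∑ i, μ i + ∑ i, η i)) ^ 2 := by ring
      _ ≤ _ := h1
      _ ≤ (1 + q + m) * (((a + -h.1) / y) ^ 2 + (∑ i, μ i ^ 2 + ∑ i, η i ^ 2) + -b / y) := by
        nlinarith [mul_nonneg h3 h2]
      _ = _ := by ring

end LineBounds

section Convexity

open Set

lemma convexOn_of_hasJetThree {V : Type*} [AddCommGroup V] [Module ℝ V] {D : Set V} {f : V → ℝ}
    (hD : Convex ℝ D)
    (h : ∀ x ∈ D, ∀ v : V, ∃ a b c, HasJetThree (fun t : ℝ => f (x + t • v)) a b c ∧ 0 ≤ b) :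
    ConvexOn ℝ D f := by
  refine ⟨hD, fun x hx y hy a b ha hb hab => ?_⟩
  set g : ℝ → ℝ := fun t => f (x + t • (y - x)) with hg
  have hmem : ∀ t ∈ Icc (0 : ℝ) 1, x + t • (y - x) ∈ D := fun t ht =>
    hD.add_smul_sub_mem hx hy ht
  have hshift : ∀ t s : ℝ, g (t + s) = f ((x + t • (y - x)) + s • (y - x)) := fun t s => by
    rw [hg, add_assoc, ← add_smul]
  have hsmooth : ∀ t ∈ Icc (0 : ℝ) 1, ContDiffAt ℝ 3 g t ∧ 0 ≤ deriv^[2] g t := by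
    intro t ht
    obtain ⟨a, b, c, ⟨h0, -, h2, -⟩, hb⟩ := h _ (hmem t ht) (y - x)
    have e : (fun s : ℝ => f ((x + t • (y - x)) + s • (y - x))) = fun s => g (t + s) :=
      funext fun s => (hshift t s).symm
    rw [e] at h0 h2
    constructor
    · have hd : ContDiffAt ℝ 3 (fun r : ℝ => r - t) t := by fun_prop
      have h0' : ContDiffAt ℝ 3 (fun s => g (t + s)) ((fun r : ℝ => r - t) t) := by
        simpa using h0
      refine (ContDiffAt.comp (f := fun r : ℝ => r - t) t h0' hd).congr_of_eventuallyEq (Filter.Eventually.of_forall fun r => ?_)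
      simp
    · rw [← iteratedDeriv_eq_iterate]
      have := congrFun (iteratedDeriv_comp_const_add 2 g t) 0
      rw [h2] at this
      simp only [add_zero] at this
      rw [← this]
      exact hb
  have hconv : ConvexOn ℝ (Icc (0 : ℝ) 1) g := by
    refine convexOn_of_deriv2_nonneg' (convex_Icc 0 1)
      (fun t ht => ((hsmooth t ht).1.differentiableAt (by norm_num)).differentiableWithinAt)
      (fun t ht => ?_) fun t ht => (hsmooth t ht).2
    have h1 : ContDiffAt ℝ 1 (deriv g) t := by
      have := (hsmooth t ht).1.fderiv_right (m := 1) (by norm_num)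
      exact this.clm_apply contDiffAt_const
    exact (h1.differentiableAt (by norm_num)).differentiableWithinAt
  have := hconv.2 (left_mem_Icc.2 zero_le_one) (right_mem_Icc.2 zero_le_one) ha hb hab
  simp only [hg, smul_eq_mul, mul_zero, mul_one, zero_add, zero_smul, add_zero, one_smul] at this
  have e : x + b • (y - x) = a • x + b • y := by
    rw [eq_sub_of_add_eq hab, smul_sub, sub_smul, one_smul]
    abel
  rw [e, add_sub_cancel] at this
  exact this

variable {q k m n : ℕ} {Ghat : Herm q →ₗ[ℝ] Herm k} {Zhat : Herm m →ₗ[ℝ] Herm n}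
  {S : Matrix (Fin n) (Fin k) ℂ} {α : ℝ}

lemma concaveOn_psiPair (hS : Sᴴ * S = 1) (hα : α ∈ Ico (1 / 2 : ℝ) 1)
    (hGpd : ∀ ρ : Herm q, (ρ : Matrix (Fin q) (Fin q) ℂ).PosDef →
      ((Ghat ρ : Matrix (Fin k) (Fin k) ℂ)).PosDef)
    (hZpd : ∀ σ : Herm m, (σ : Matrix (Fin m) (Fin m) ℂ).PosDef →
      ((Zhat σ : Matrix (Fin n) (Fin n) ℂ)).PosDef) :
    ConcaveOn ℝ (posPairs q m) (psiPair Ghat Zhat S α) := by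
  rw [← neg_convexOn_iff]
  refine convexOn_of_hasJetThree convex_posPairs fun x hx v => ?_
  obtain ⟨c₁, c₂, μ, η, -, -, -, -, hδ⟩ := exists_common_radius (h := v) hx
  obtain ⟨a, b, c, ⟨h0, h1, h2, h3⟩, hb, -⟩ :=
    psiPair_jet (S := S) (α := α) hS hα hGpd hZpd (Real.sqrt_nonneg _) hδ
  refine ⟨-a, -b, -c, ⟨h0.neg, ?_, ?_, ?_⟩, neg_nonneg.2 hb⟩
  · rw [← h1]
    exact deriv.fun_neg
  · rw [← h2]
    exact iteratedDeriv_fun_neg 2 _ 0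
  · rw [← h3]
    exact iteratedDeriv_fun_neg 3 _ 0

/-- The domain of the barrier. -/
def psiHypograph (Ghat : Herm q →ₗ[ℝ] Herm k) (Zhat : Herm m →ₗ[ℝ] Herm n)
    (S : Matrix (Fin n) (Fin k) ℂ) (α : ℝ) : Set (ℝ × Herm q × Herm m) :=
  {p | p.2 ∈ posPairs q m ∧ p.1 < psiPair Ghat Zhat S α p.2}

lemma convexOn_psiBarrier (hS : Sᴴ * S = 1) (hα : α ∈ Ico (1 / 2 : ℝ) 1)
    (hGpd : ∀ ρ : Herm q, (ρ : Matrix (Fin q) (Fin q) ℂ).PosDef →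
      ((Ghat ρ : Matrix (Fin k) (Fin k) ℂ)).PosDef)
    (hZpd : ∀ σ : Herm m, (σ : Matrix (Fin m) (Fin m) ℂ).PosDef →
      ((Zhat σ : Matrix (Fin n) (Fin n) ℂ)).PosDef) :
    ConvexOn ℝ (psiHypograph Ghat Zhat S α) (psiBarrier Ghat Zhat S α) := by
  refine convexOn_of_hasJetThree ?_ fun p hp v => ?_
  · exact (concaveOn_psiPair hS hα hGpd hZpd).convex_strict_hypograph.linear_preimage
      (LinearEquiv.prodComm ℝ ℝ (Herm q × Herm m)).toLinearMap
  · obtain ⟨A, B, C, hjet, -, hB⟩ := psiBarrier_jet hS hα hGpd hZpd hp.1 hp.2 v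
    refine ⟨A, B, C, hjet, ?_⟩
    have h3 : (0 : ℝ) < 1 + q + m := by positivity
    exact nonneg_of_mul_nonneg_right ((sq_nonneg A).trans hB) h3

lemma monotone_psiPair (hS : Sᴴ * S = 1) (hα : α ∈ Ico (1 / 2 : ℝ) 1)
    (hGpd : ∀ ρ : Herm q, (ρ : Matrix (Fin q) (Fin q) ℂ).PosDef →
      ((Ghat ρ : Matrix (Fin k) (Fin k) ℂ)).PosDef)
    (hZpd : ∀ σ : Herm m, (σ : Matrix (Fin m) (Fin m) ℂ).PosDef →
      ((Zhat σ : Matrix (Fin n) (Fin n) ℂ)).PosDef)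
    {x y : Herm q × Herm m} (hx : x ∈ posPairs q m) (hxy : y - x ∈ posPairs q m) :
    psiPair Ghat Zhat S α x ≤ psiPair Ghat Zhat S α y := by
  have hα0 : 0 < α := by linarith [hα.1]
  have h2 : (0 : ℝ) < 2 := two_pos
  have := (concaveOn_psiPair (S := S) (α := α) hS hα hGpd hZpd).2
    (smul_mem_posPairs hx h2) (smul_mem_posPairs hxy h2)
    (by norm_num : (0 : ℝ) ≤ 1 / 2) (by norm_num : (0 : ℝ) ≤ 1 / 2) (by norm_num)
  rw [psiPair_smul hα0 hGpd hZpd hx h2, psiPair_smul hα0 hGpd hZpd hxy h2, smul_smul, smul_smul,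
    show (1 / 2 : ℝ) * 2 = 1 by norm_num, one_smul, one_smul, add_sub_cancel, smul_eq_mul,
    smul_eq_mul] at this
  linarith [psiPair_nonneg (S := S) (α := α) hGpd hZpd hxy]

end Convexity

section Boundary

open Set Filter Topology

lemma continuous_qform_re {d : ℕ} :
    Continuous fun z : Herm d × (Fin d → ℂ) => (qform (z.1 : Matrix (Fin d) (Fin d) ℂ) z.2).re := by
  unfold qform
  fun_prop

lemma posDef_iff_qform_re {d : ℕ} (A : Herm d) :
    (A : Matrix (Fin d) (Fin d) ℂ).PosDef ↔
      ∀ v : Fin d → ℂ, v ≠ 0 → 0 < (qform (A : Matrix (Fin d) (Fin d) ℂ) v).re := by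
  refine ⟨fun h v hv => (Complex.pos_iff.1 (h.dotProduct_mulVec_pos hv)).1, fun h => ?_⟩
  refine PosDef.of_dotProduct_mulVec_pos A.2 fun v hv => Complex.pos_iff.2 ⟨h v hv, ?_⟩
  exact (IsHermitian.im_star_dotProduct_mulVec_self (𝕜 := ℂ) A.2 v).symm

lemma isOpen_posDef {d : ℕ} : IsOpen {A : Herm d | (A : Matrix (Fin d) (Fin d) ℂ).PosDef} := by
  rw [isOpen_iff_mem_nhds]
  intro A hA
  have hopen : IsOpen {z : Herm d × (Fin d → ℂ) | 0 < (qform (z.1 : Matrix (Fin d) (Fin d) ℂ) z.2).re} :=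
    isOpen_lt continuous_const continuous_qform_re
  obtain ⟨u, v, hu, -, hAu, hv, huv⟩ := generalized_tube_lemma (isCompact_singleton (x := A))
    (isCompact_sphere (0 : Fin d → ℂ) 1) hopen (by
      rintro ⟨B, w⟩ ⟨rfl, hw⟩
      refine (posDef_iff_qform_re B).1 hA w ?_
      rintro rfl
      simp at hw)
  refine mem_of_superset (hu.mem_nhds (hAu (mem_singleton A))) fun B hB => ?_
  refine (posDef_iff_qform_re B).2 fun w hw => ?_
  have hw' : 0 < ‖w‖ := norm_pos_iff.2 hw
  have hmem : (‖w‖⁻¹ : ℝ) • w ∈ Metric.sphere (0 : Fin d → ℂ) 1 := by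
    rw [mem_sphere_zero_iff_norm, norm_smul, norm_inv, norm_norm, inv_mul_cancel₀ hw'.ne']
  have h1 : 0 < (qform (B : Matrix (Fin d) (Fin d) ℂ) ((‖w‖⁻¹ : ℝ) • w)).re :=
    huv (mk_mem_prod hB (hv hmem))
  have e : qform (B : Matrix (Fin d) (Fin d) ℂ) ((‖w‖⁻¹ : ℝ) • w) =
      ((‖w‖⁻¹ * ‖w‖⁻¹ : ℝ) : ℂ) * qform (B : Matrix (Fin d) (Fin d) ℂ) w := by
    rw [qform, qform, mulVec_smul, star_smul, smul_dotProduct, dotProduct_smul, smul_smul]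
    simp
  rw [e, Complex.re_ofReal_mul] at h1
  exact (pos_iff_pos_of_mul_pos h1).1 (by positivity)

lemma isClosed_posSemidef {d : ℕ} :
    IsClosed {A : Herm d | (A : Matrix (Fin d) (Fin d) ℂ).PosSemidef} := by
  have e : {A : Herm d | (A : Matrix (Fin d) (Fin d) ℂ).PosSemidef} =
      ⋂ v : Fin d → ℂ, {A : Herm d | 0 ≤ (qform (A : Matrix (Fin d) (Fin d) ℂ) v).re} := by
    ext A
    simp only [mem_ofPred_eq, mem_iInter]
    refine ⟨fun h v => (Complex.nonneg_iff.1 (h.dotProduct_mulVec_nonneg v)).1, fun h => ?_⟩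
    refine PosSemidef.of_dotProduct_mulVec_nonneg A.2 fun v => Complex.nonneg_iff.2 ⟨h v, ?_⟩
    exact (IsHermitian.im_star_dotProduct_mulVec_self (𝕜 := ℂ) A.2 v).symm
  rw [e]
  exact isClosed_iInter fun v => isClosed_le continuous_const
    (continuous_qform_re.comp (Continuous.prodMk_left v))

lemma continuous_det_re {d : ℕ} :
    Continuous fun A : Herm d => (A : Matrix (Fin d) (Fin d) ℂ).det.re :=
  Complex.continuous_re.comp continuous_subtype_val.matrix_det

lemma det_re_pos {d : ℕ} {A : Herm d} (hA : (A : Matrix (Fin d) (Fin d) ℂ).PosDef) :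
    0 < (A : Matrix (Fin d) (Fin d) ℂ).det.re :=
  (Complex.pos_iff.1 hA.det_pos).1

instance continuousSMul_herm {d : ℕ} : ContinuousSMul ℝ (Herm d) where
  continuous_smul := by
    refine Continuous.subtype_mk (f := fun z : ℝ × Herm d => z.1 • (z.2 : Matrix (Fin d) (Fin d) ℂ))
      ?_ _
    fun_prop

lemma isOpen_posPairs {q m : ℕ} : IsOpen (posPairs q m) :=
  (isOpen_posDef.preimage continuous_fst).inter (isOpen_posDef.preimage continuous_snd)

lemma one_mem_posPairs {q m : ℕ} : (1 : Herm q × Herm m) ∈ posPairs q m :=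
  ⟨PosDef.one, PosDef.one⟩

lemma exists_smul_one_sub_mem_posPairs {q m : ℕ} (x : Herm q × Herm m) :
    ∃ c : ℝ, 0 < c ∧ c • (1 : Herm q × Herm m) - x ∈ posPairs q m := by
  have hcont : ContinuousAt (fun t : ℝ => (1 : Herm q × Herm m) - t • x) 0 := by fun_prop
  have hev : ∀ᶠ t : ℝ in 𝓝 0, (1 : Herm q × Herm m) - t • x ∈ posPairs q m :=
    hcont.eventually (isOpen_posPairs.mem_nhds (by simpa using one_mem_posPairs))
  obtain ⟨t, ht, ht0⟩ := ((hev.filter_mono nhdsWithin_le_nhds).and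
    (self_mem_nhdsWithin : Ioi (0 : ℝ) ∈ 𝓝[>] 0)).exists
  have ht0' : 0 < t := ht0
  refine ⟨t⁻¹, inv_pos.2 ht0', ?_⟩
  have := smul_mem_posPairs ht (inv_pos.2 ht0')
  rwa [smul_sub, smul_smul, inv_mul_cancel₀ ht0'.ne', one_smul] at this

lemma tendsto_neg_log_atTop {X : Type*} {l : Filter X} {g : X → ℝ}
    (h : ∀ ε : ℝ, 0 < ε → ∀ᶠ p in l, 0 < g p ∧ g p < ε) :
    Tendsto (fun p => -Real.log (g p)) l atTop := by
  refine tendsto_atTop.2 fun b => ?_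
  filter_upwards [h (Real.exp (-b)) (Real.exp_pos _)] with p hp
  have := Real.log_le_log hp.1 hp.2.le
  rw [Real.log_exp] at this
  linarith

lemma tendsto_sub_log_sub_log_atTop {X : Type*} {l : Filter X} {g₁ g₂ g₃ : X → ℝ} {M : ℝ}
    (h₁ : ∀ᶠ p in l, 0 < g₁ p ∧ g₁ p < M) (h₂ : ∀ᶠ p in l, 0 < g₂ p ∧ g₂ p < M)
    (h₃ : ∀ᶠ p in l, 0 < g₃ p ∧ g₃ p < M)
    (h : (∀ ε : ℝ, 0 < ε → ∀ᶠ p in l, g₁ p < ε) ∨ (∀ ε : ℝ, 0 < ε → ∀ᶠ p in l, g₂ p < ε) ∨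
      ∀ ε : ℝ, 0 < ε → ∀ᶠ p in l, g₃ p < ε) :
    Tendsto (fun p => -Real.log (g₁ p) - Real.log (g₂ p) - Real.log (g₃ p)) l atTop := by
  have hb : ∀ {g : X → ℝ}, (∀ᶠ p in l, 0 < g p ∧ g p < M) →
      ∀ᶠ p in l, -Real.log M ≤ -Real.log (g p) := fun hg => by
    filter_upwards [hg] with p hp
    exact neg_le_neg (Real.log_le_log hp.1 hp.2.le)
  have ht : ∀ {g : X → ℝ}, (∀ᶠ p in l, 0 < g p ∧ g p < M) →
      (∀ ε : ℝ, 0 < ε → ∀ᶠ p in l, g p < ε) → Tendsto (fun p => -Real.log (g p)) l atTop :=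
    fun hg hε => tendsto_neg_log_atTop fun ε hε0 =>
      (hg.mono fun _ hp => hp.1).and (hε ε hε0)
  simp only [sub_eq_add_neg (_ : ℝ) (Real.log _)]
  rcases h with h | h | h
  · exact tendsto_atTop_add_right_of_le' l _
      (tendsto_atTop_add_right_of_le' l _ (ht h₁ h) (hb h₂)) (hb h₃)
  · exact tendsto_atTop_add_right_of_le' l _
      (tendsto_atTop_add_left_of_le' l _ (hb h₁) (ht h₂ h)) (hb h₃)
  · refine tendsto_atTop_add_left_of_le' l (-Real.log M + -Real.log M) ?_ (ht h₃ h)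
    filter_upwards [hb h₁, hb h₂] with p hp₁ hp₂ using add_le_add hp₁ hp₂

variable {q k m n : ℕ} {Ghat : Herm q →ₗ[ℝ] Herm k} {Zhat : Herm m →ₗ[ℝ] Herm n}
  {S : Matrix (Fin n) (Fin k) ℂ} {α : ℝ}

lemma continuousAt_psiPair (hS : Sᴴ * S = 1) (hα : α ∈ Ico (1 / 2 : ℝ) 1)
    (hGpd : ∀ ρ : Herm q, (ρ : Matrix (Fin q) (Fin q) ℂ).PosDef →
      ((Ghat ρ : Matrix (Fin k) (Fin k) ℂ)).PosDef)
    (hZpd : ∀ σ : Herm m, (σ : Matrix (Fin m) (Fin m) ℂ).PosDef →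
      ((Zhat σ : Matrix (Fin n) (Fin n) ℂ)).PosDef)
    {x : Herm q × Herm m} (hx : x ∈ posPairs q m) :
    ContinuousAt (psiPair Ghat Zhat S α) x := by
  have hα0 : 0 < α := by linarith [hα.1]
  have hψ := psiPair_nonneg (S := S) (α := α) hGpd hZpd hx
  rw [Metric.continuousAt_iff']
  intro ε hε
  set ψ := psiPair Ghat Zhat S α x with hψd
  obtain ⟨η, hη0, hη1, hηε⟩ : ∃ η : ℝ, 0 < η ∧ η < 1 ∧ η * ψ < ε := by
    refine ⟨min (1 / 2) (ε / (ψ + 1)), by positivity, by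
      linarith [min_le_left (1 / 2 : ℝ) (ε / (ψ + 1))], ?_⟩
    calc _ ≤ ε / (ψ + 1) * ψ := mul_le_mul_of_nonneg_right (min_le_right _ _) hψ
      _ < ε := by
        rw [div_mul_eq_mul_div, div_lt_iff₀ (by positivity)]
        nlinarith
  have c₁ : ContinuousAt (fun y : Herm q × Herm m => y - (1 - η) • x) x := by fun_prop
  have c₂ : ContinuousAt (fun y : Herm q × Herm m => (1 + η) • x - y) x := by fun_prop
  have m₁ : x - (1 - η) • x ∈ posPairs q m := by
    have := smul_mem_posPairs hx hη0
    rwa [show x - (1 - η) • x = η • x by rw [sub_smul, one_smul]; abel]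
  have m₂ : (1 + η) • x - x ∈ posPairs q m := by
    have := smul_mem_posPairs hx hη0
    rwa [show (1 + η) • x - x = η • x by rw [add_smul, one_smul]; abel]
  filter_upwards [c₁.eventually (isOpen_posPairs.mem_nhds m₁),
    c₂.eventually (isOpen_posPairs.mem_nhds m₂), isOpen_posPairs.mem_nhds hx] with y h₁ h₂ hy
  have l₁ := monotone_psiPair (S := S) (α := α) hS hα hGpd hZpd
    (smul_mem_posPairs hx (sub_pos.2 hη1)) h₁
  have l₂ := monotone_psiPair (S := S) (α := α) hS hα hGpd hZpd hy h₂
  rw [psiPair_smul hα0 hGpd hZpd hx (sub_pos.2 hη1)] at l₁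
  rw [psiPair_smul hα0 hGpd hZpd hx (by positivity)] at l₂
  rw [Real.dist_eq, abs_lt]
  constructor <;> nlinarith

lemma isOpen_psiHypograph (hS : Sᴴ * S = 1) (hα : α ∈ Ico (1 / 2 : ℝ) 1)
    (hGpd : ∀ ρ : Herm q, (ρ : Matrix (Fin q) (Fin q) ℂ).PosDef →
      ((Ghat ρ : Matrix (Fin k) (Fin k) ℂ)).PosDef)
    (hZpd : ∀ σ : Herm m, (σ : Matrix (Fin m) (Fin m) ℂ).PosDef →
      ((Zhat σ : Matrix (Fin n) (Fin n) ℂ)).PosDef) :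
    IsOpen (psiHypograph Ghat Zhat S α) := by
  rw [isOpen_iff_mem_nhds]
  intro p hp
  have hψ : ContinuousAt (fun z : ℝ × Herm q × Herm m => psiPair Ghat Zhat S α z.2) p :=
    ContinuousAt.comp (g := psiPair Ghat Zhat S α) (f := Prod.snd)
      (continuousAt_psiPair hS hα hGpd hZpd hp.1) continuousAt_snd
  exact (continuousAt_snd.eventually (isOpen_posPairs.mem_nhds hp.1)).and
    (continuousAt_fst.eventually_lt hψ hp.2)

lemma tendsto_psiBarrier (hS : Sᴴ * S = 1) (hα : α ∈ Ico (1 / 2 : ℝ) 1)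
    (hGpd : ∀ ρ : Herm q, (ρ : Matrix (Fin q) (Fin q) ℂ).PosDef →
      ((Ghat ρ : Matrix (Fin k) (Fin k) ℂ)).PosDef)
    (hZpd : ∀ σ : Herm m, (σ : Matrix (Fin m) (Fin m) ℂ).PosDef →
      ((Zhat σ : Matrix (Fin n) (Fin n) ℂ)).PosDef)
    {p : ℝ × Herm q × Herm m} (hp : p ∈ frontier (psiHypograph Ghat Zhat S α)) :
    Tendsto (psiBarrier Ghat Zhat S α) (𝓝[psiHypograph Ghat Zhat S α] p) atTop := by
  set D := psiHypograph Ghat Zhat S α with hD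
  rw [(isOpen_psiHypograph hS hα hGpd hZpd).frontier_eq] at hp
  obtain ⟨hpc, hpD⟩ := hp
  have hself : ∀ᶠ z in 𝓝[D] p, z ∈ D := self_mem_nhdsWithin
  obtain ⟨c, hc, hcp⟩ := exists_smul_one_sub_mem_posPairs p.2
  have hψle : ∀ᶠ z in 𝓝[D] p, psiPair Ghat Zhat S α z.2 - z.1 <
      psiPair Ghat Zhat S α (c • (1 : Herm q × Herm m)) - p.1 + 1 := by
    have hcont : ContinuousAt (fun z : ℝ × Herm q × Herm m => c • (1 : Herm q × Herm m) - z.2) p := by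
      fun_prop
    have h1 : ∀ᶠ z : ℝ × Herm q × Herm m in 𝓝 p, p.1 - 1 < z.1 :=
      continuousAt_fst.eventually (lt_mem_nhds (by linarith))
    filter_upwards [hself, (hcont.eventually (isOpen_posPairs.mem_nhds hcp)).filter_mono
      nhdsWithin_le_nhds, h1.filter_mono nhdsWithin_le_nhds] with z hz hz1 hz2
    have := monotone_psiPair (S := S) (α := α) hS hα hGpd hZpd hz.1 hz1
    linarith
  have hd₁ : ContinuousAt (fun z : ℝ × Herm q × Herm m =>
      (z.2.1 : Matrix (Fin q) (Fin q) ℂ).det.re) p :=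
    (continuous_det_re.comp (continuous_fst.comp continuous_snd)).continuousAt
  have hd₂ : ContinuousAt (fun z : ℝ × Herm q × Herm m =>
      (z.2.2 : Matrix (Fin m) (Fin m) ℂ).det.re) p :=
    (continuous_det_re.comp (continuous_snd.comp continuous_snd)).continuousAt
  have hlt₁ : ∀ b, (p.2.1 : Matrix (Fin q) (Fin q) ℂ).det.re < b → ∀ᶠ z in 𝓝[D] p,
      ((z.2.1 : Matrix (Fin q) (Fin q) ℂ).det.re) < b := fun b hb =>
    (hd₁.eventually (gt_mem_nhds hb)).filter_mono nhdsWithin_le_nhds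
  have hlt₂ : ∀ b, (p.2.2 : Matrix (Fin m) (Fin m) ℂ).det.re < b → ∀ᶠ z in 𝓝[D] p,
      ((z.2.2 : Matrix (Fin m) (Fin m) ℂ).det.re) < b := fun b hb =>
    (hd₂.eventually (gt_mem_nhds hb)).filter_mono nhdsWithin_le_nhds
  obtain ⟨M, hM⟩ : ∃ M, M = max (psiPair Ghat Zhat S α (c • (1 : Herm q × Herm m)) - p.1 + 1)
      (max ((p.2.1 : Matrix (Fin q) (Fin q) ℂ).det.re + 1)
        ((p.2.2 : Matrix (Fin m) (Fin m) ℂ).det.re + 1)) := ⟨_, rfl⟩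
  have hM₁ : psiPair Ghat Zhat S α (c • (1 : Herm q × Herm m)) - p.1 + 1 ≤ M :=
    hM ▸ le_max_left _ _
  have hM₂ : (p.2.1 : Matrix (Fin q) (Fin q) ℂ).det.re + 1 ≤ M :=
    hM ▸ (le_max_left _ _).trans (le_max_right _ _)
  have hM₃ : (p.2.2 : Matrix (Fin m) (Fin m) ℂ).det.re + 1 ≤ M :=
    hM ▸ (le_max_right _ _).trans (le_max_right _ _)
  refine tendsto_sub_log_sub_log_atTop (M := M) ?_ ?_ ?_ ?_
  · filter_upwards [hself, hψle] with z hz hz' using ⟨sub_pos.2 hz.2, hz'.trans_le hM₁⟩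
  · filter_upwards [hself, hlt₁ M (by linarith)] with z hz hz' using ⟨det_re_pos hz.1.1, hz'⟩
  · filter_upwards [hself, hlt₂ M (by linarith)] with z hz hz' using ⟨det_re_pos hz.1.2, hz'⟩
  · by_cases hmem : p.2 ∈ posPairs q m
    · refine Or.inl fun ε hε => ?_
      have hle : psiPair Ghat Zhat S α p.2 ≤ p.1 := not_lt.1 fun hlt => hpD ⟨hmem, hlt⟩
      have hψ : ContinuousAt (fun z : ℝ × Herm q × Herm m => psiPair Ghat Zhat S α z.2 - z.1) p :=
        (ContinuousAt.comp (g := psiPair Ghat Zhat S α) (f := Prod.snd)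
          (continuousAt_psiPair hS hα hGpd hZpd hmem) continuousAt_snd).sub continuousAt_fst
      exact (hψ.eventually (gt_mem_nhds (by linarith))).filter_mono nhdsWithin_le_nhds
    · have hsd₁ : (p.2.1 : Matrix (Fin q) (Fin q) ℂ).PosSemidef :=
        (isClosed_posSemidef.preimage (continuous_fst.comp continuous_snd)).closure_subset_iff.2
          (fun z (hz : z ∈ D) => hz.1.1.posSemidef) hpc
      have hsd₂ : (p.2.2 : Matrix (Fin m) (Fin m) ℂ).PosSemidef :=
        (isClosed_posSemidef.preimage (continuous_snd.comp continuous_snd)).closure_subset_iff.2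
          (fun z (hz : z ∈ D) => hz.1.2.posSemidef) hpc
      by_cases h₁ : (p.2.1 : Matrix (Fin q) (Fin q) ℂ).det = 0
      · exact Or.inr (Or.inl fun ε hε => hlt₁ ε (by rw [h₁]; exact hε))
      · have h₂ : (p.2.2 : Matrix (Fin m) (Fin m) ℂ).det = 0 := by
          by_contra h₂
          exact hmem ⟨hsd₁.posDef_iff_det_ne_zero.2 h₁, hsd₂.posDef_iff_det_ne_zero.2 h₂⟩
        exact Or.inr (Or.inr fun ε hε => hlt₂ ε (by rw [h₂]; exact hε))

end Boundary

/-- The barrier `f(u,ρ,σ) = −log(Ψ̂_α(ρ,σ) − u) − log det ρ − log det σ` is a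
`(1+q+m)`-self-concordant barrier for the closure of
`D = {(u,ρ,σ) : ρ ≻ 0, σ ≻ 0, u < Ψ̂_α(ρ,σ)}`, where
`Ψ̂_α(ρ,σ) = Tr[(Ĝ(ρ)^{1/2} Sᴴ Ẑ(σ)^{(1−α)/α} S Ĝ(ρ)^{1/2})^α]` for positive linear maps
`Ĝ`, `Ẑ` on Hermitian matrices and an isometry `S`. -/
theorem stmt10 {q k m n : ℕ}
    (Ghat : Herm q →ₗ[ℝ] Herm k) (Zhat : Herm m →ₗ[ℝ] Herm n)
    (hGpsd : ∀ ρ : Herm q, (ρ : Matrix (Fin q) (Fin q) ℂ).PosSemidef →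
      ((Ghat ρ : Matrix (Fin k) (Fin k) ℂ)).PosSemidef)
    (hGpd : ∀ ρ : Herm q, (ρ : Matrix (Fin q) (Fin q) ℂ).PosDef →
      ((Ghat ρ : Matrix (Fin k) (Fin k) ℂ)).PosDef)
    (hZpsd : ∀ σ : Herm m, (σ : Matrix (Fin m) (Fin m) ℂ).PosSemidef →
      ((Zhat σ : Matrix (Fin n) (Fin n) ℂ)).PosSemidef)
    (hZpd : ∀ σ : Herm m, (σ : Matrix (Fin m) (Fin m) ℂ).PosDef →
      ((Zhat σ : Matrix (Fin n) (Fin n) ℂ)).PosDef)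
    (S : Matrix (Fin n) (Fin k) ℂ) (hS : Sᴴ * S = 1)
    (α : ℝ) (hα : α ∈ Set.Ico (1 / 2 : ℝ) 1) :
    IsSelfConcordantBarrier ((1 : ℝ) + q + m)
      {p : ℝ × Herm q × Herm m |
        (p.2.1 : Matrix (Fin q) (Fin q) ℂ).PosDef ∧
        (p.2.2 : Matrix (Fin m) (Fin m) ℂ).PosDef ∧
        p.1 < PsiS α S (Ghat p.2.1 : Matrix (Fin k) (Fin k) ℂ)
                (Zhat p.2.2 : Matrix (Fin n) (Fin n) ℂ)}
      (fun p =>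
        -Real.log (PsiS α S (Ghat p.2.1 : Matrix (Fin k) (Fin k) ℂ)
            (Zhat p.2.2 : Matrix (Fin n) (Fin n) ℂ) - p.1)
        - Real.log ((p.2.1 : Matrix (Fin q) (Fin q) ℂ).det.re)
        - Real.log ((p.2.2 : Matrix (Fin m) (Fin m) ℂ).det.re)) := by
  have hD : {p : ℝ × Herm q × Herm m |
        (p.2.1 : Matrix (Fin q) (Fin q) ℂ).PosDef ∧
        (p.2.2 : Matrix (Fin m) (Fin m) ℂ).PosDef ∧
        p.1 < PsiS α S (Ghat p.2.1 : Matrix (Fin k) (Fin k) ℂ)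
                (Zhat p.2.2 : Matrix (Fin n) (Fin n) ℂ)} = psiHypograph Ghat Zhat S α :=
    Set.ext fun p => and_assoc.symm
  rw [hD]
  refine ⟨convexOn_psiBarrier hS hα hGpd hZpd, fun p hp => tendsto_psiBarrier hS hα hGpd hZpd hp,
    fun p hp h => ?_, fun p hp h => ?_⟩
  · obtain ⟨A, B, C, ⟨-, -, rfl, rfl⟩, hC, -⟩ :=
      psiBarrier_jet hS hα hGpd hZpd hp.1 hp.2 h
    exact hC
  · obtain ⟨A, B, C, ⟨-, rfl, rfl, -⟩, -, hA⟩ :=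
      psiBarrier_jet hS hα hGpd hZpd hp.1 hp.2 h
    exact hA

end
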